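/- For q = 3 and n ≥ 3, we have (3,n) ∈ B(3,2) for every n ∈ {11, 13, 14, 15} and for all n ≥ 17. -/

import Mathlib

open Polynomial

noncomputable section

/-- An element of a finite field is *primitive* if it generates the multiplicative group. -/
def IsPrimitiveElem {L : Type} [Field L] [Fintype L] (α : L) : Prop :=
  orderOf α = Fintype.card L - 1

/-- `β` is a *normal element* of `L` over `K`, where `n = [L : K]`:
the conjugates `β, β^q, …, β^(q^(n-1))` form a `K`-basis of `L`. -/
def IsNormalElem (K : Type) {L : Type} [Field K] [Fintype K] [Field L] [Algebra K L]
    (n : ℕ) (β : L) : Prop :=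
  LinearIndependent K (fun i : Fin n => β ^ Fintype.card K ^ (i : ℕ)) ∧
    Submodule.span K (Set.range fun i : Fin n => β ^ Fintype.card K ^ (i : ℕ)) = ⊤

/-- The set `Υ_Q(m₁, m₂)` of rational functions over the field `F` with `Q` elements. -/
def Upsilon (F : Type) [Field F] [Fintype F] (m₁ m₂ : ℕ) : Set (RatFunc F) :=
  {f | ∃ f₁ f₂ : F[X], f₂ ≠ 0 ∧
      f = algebraMap F[X] (RatFunc F) f₁ / algebraMap F[X] (RatFunc F) f₂ ∧
      f₁.natDegree ≤ m₁ ∧ f₂.natDegree ≤ m₂ ∧ IsCoprime f₁ f₂ ∧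
      ∃ (k : ℕ) (g : F[X]), 0 < k ∧ g.Monic ∧ Irreducible g ∧ g ≠ X ∧
        Nat.gcd k (Fintype.card F - 1) = 1 ∧
        g ^ k ∣ f₁ * f₂ ∧ ¬ g ^ (k + 1) ∣ f₁ * f₂}

/-- Evaluation of a rational function at a point of the same field (`0` if undefined). -/
def ratEval {F : Type} [Field F] (f : RatFunc F) (α : F) : F :=
  f.eval (RingHom.id F) α

/-- `α` is `s`-free. -/
def IsFree {F : Type} [Field F] (s : ℕ) (α : F) : Prop :=
  α ≠ 0 ∧ ∀ d : ℕ, d ∣ s → d ≠ 1 → ¬ ∃ β : F, β ^ d = α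

/-- The `F_q[x]`-module action `h ∘ β = ∑ hᵢ β^(qⁱ)` on `L`. -/
def polyAct {K L : Type} [Field K] [Fintype K] [Field L] [Algebra K L]
    (h : K[X]) (β : L) : L :=
  h.sum fun i a => algebraMap K L a * β ^ Fintype.card K ^ i

/-- `α` is `g`-free with respect to the `F_q[x]`-module structure of `L`. -/
def IsPolyFree (K : Type) {L : Type} [Field K] [Fintype K] [Field L] [Algebra K L]
    (g : K[X]) (α : L) : Prop :=
  ∀ h : K[X], h.Monic → h ∣ g → (∃ lam : L, α = polyAct h lam) → h = 1

/-- `N_f(e₁, e₂, g)`: the number of `α ∈ L` such that `α` is `e₁`-free,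
`f(α)` is `e₂`-free and `α` is `g`-free. -/
def NElems (K : Type) {L : Type} [Field K] [Fintype K] [Field L] [Fintype L] [Algebra K L]
    (f : RatFunc L) (e₁ e₂ : ℕ) (g : K[X]) : ℕ :=
  Nat.card {α : L | IsFree e₁ α ∧ IsFree e₂ (ratEval f α) ∧ IsPolyFree K g α}

/-- `W(ℓ)`: the number of squarefree divisors of `ℓ`. -/
def Wnat (ℓ : ℕ) : ℕ := (ℓ.divisors.filter Squarefree).card

/-- `W_q(g)`: the number of monic squarefree divisors of `g` in `F_q[x]`. -/
def Wpoly {K : Type} [Field K] (g : K[X]) : ℕ :=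
  Nat.card {h : K[X] // h.Monic ∧ Squarefree h ∧ h ∣ g}

/-- `Φ(g) = |(F_q[x]/(g))ˣ|`. -/
def PhiPoly {K : Type} [Field K] (g : K[X]) : ℕ :=
  Nat.card ((K[X] ⧸ Ideal.span ({g} : Set K[X]))ˣ)

/-- `(q, n) ∈ B(m₁, m₂)`: for every `f ∈ Υ_{qⁿ}(m₁, m₂)` there is a primitive element
`α` of `F_{qⁿ}`, normal over `F_q`, with `f(α)` also primitive. -/
def memB (m₁ m₂ q n : ℕ) : Prop :=
  ∀ (K L : Type) [Field K] [Field L] [Fintype K] [Fintype L] [Algebra K L],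
    Fintype.card K = q → Fintype.card L = q ^ n →
    ∀ f ∈ Upsilon L m₁ m₂,
      ∃ α : L, IsPrimitiveElem α ∧ IsNormalElem K n α ∧ IsPrimitiveElem (ratEval f α)

/-- `𝔑(q, n)`: the number of primitive elements of `F_{qⁿ}` that are normal over `F_q`. -/
def NNum (K L : Type) [Field K] [Fintype K] [Field L] [Fintype L] [Algebra K L] (n : ℕ) : ℕ :=
  Nat.card {α : L | IsPrimitiveElem α ∧ IsNormalElem K n α}

end

section
open Polynomial
namespace S12
theorem exists_root_ps {F : Type*} [Field F] (d : ℕ) (hd : (d:F) ≠ 0) (H : PowerSeries F) (y0 : F)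
    (hy : y0 ≠ 0) (h : y0 ^ d = PowerSeries.constantCoeff H) :
    ∃ Y : PowerSeries F, Y ^ d = H ∧ PowerSeries.constantCoeff Y = y0 := by
  have hd0 : d ≠ 0 := by rintro rfl; simp at hd
  have hmem : ∀ a : PowerSeries F, a ∈ (Ideal.span {PowerSeries.X} : Ideal (PowerSeries F)) ↔
      PowerSeries.constantCoeff a = 0 := by
    intro a
    rw [Ideal.mem_span_singleton, PowerSeries.X_dvd_iff]
  obtain ⟨Y, hY, hY2⟩ := HenselianRing.is_henselian (I := (Ideal.span {PowerSeries.X} : Ideal (PowerSeries F)))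
    (X ^ d - C H) (monic_X_pow_sub_C H hd0) (PowerSeries.C y0)
    (by rw [hmem]; simp [h]) (by
      have : IsUnit ((derivative (X ^ d - C H : (PowerSeries F)[X])).eval (PowerSeries.C y0)) := by
        rw [PowerSeries.isUnit_iff_constantCoeff]
        simp [derivative_X_pow, hd, hy]
      exact this.map _)
  refine ⟨Y, ?_, ?_⟩
  · simpa [IsRoot, sub_eq_zero] using hY
  · rw [hmem] at hY2
    simpa [sub_eq_zero] using hY2

theorem zero_lemma {B : Type*} [CommRing B] [IsDomain B] (q D e : ℕ) (hq : 2 ≤ q)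
    (W : ℕ → AddSubgroup B) (hcard : ∀ l, Nat.card (W l) = q ^ (D * (l + 1)))
    (hmono : Monotone W) (htop : ∀ b, ∃ l, b ∈ W l)
    (hmul : ∀ l m u v, u ∈ W l → v ∈ W m → u * v ∈ W (l + m + e))
    {A : Type*} [AddCommGroup A] [Finite A] (φ : B →+ A) (hφ : Function.Surjective φ)
    (w : ℕ) (v : B) (hv : v ∈ W w) (hv0 : v ≠ 0) (hφv : ∀ b, φ (v * b) = 0) :
    Nat.card A ≤ q ^ (D * (w + e)) := by
  classical
  have := Fintype.ofFinite A
  choose g hg using hφ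
  choose l hl using fun a => htop (g a)
  set M := Finset.univ.sup l
  have hM : ∀ a, g a ∈ W M := fun a => hmono (Finset.le_sup (f := l) (Finset.mem_univ a)) (hl a)
  have hfin : ∀ l, Finite (W l) := fun l => Nat.finite_of_card_ne_zero (by
    rw [hcard]; positivity)
  let f : A × W M → W (w + M + e) := fun x => ⟨g x.1 + v * x.2, by
    refine (W _).add_mem (hmono (by omega) (hM _)) (hmul _ _ _ _ hv x.2.2)⟩
  have hf : Function.Injective f := by
    rintro ⟨a, u⟩ ⟨a', u'⟩ h
    have h1 : g a + v * u = g a' + v * u' := congrArg Subtype.val h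
    have h2 := congrArg φ h1
    simp only [map_add, hφv, hg, add_zero] at h2
    subst h2
    simp only [add_right_inj] at h1
    have := mul_left_cancel₀ hv0 h1
    exact Prod.ext rfl (Subtype.ext this)
  have h := Nat.card_le_card_of_injective f hf
  rw [Nat.card_prod, hcard, hcard] at h
  have h3 : q ^ (D * (w + M + e + 1)) = q ^ (D * (w + e)) * q ^ (D * (M + 1)) := by
    rw [← pow_add]; congr 1; ring
  rw [h3] at h
  exact Nat.le_of_mul_le_mul_right h (by positivity)

theorem stepanov_core {F B : Type} [Field F] [Fintype F] [CommRing B] [IsDomain B]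
    (p μ r q D e : ℕ) [Fact p.Prime] [CharP F p] [CharP B p] (hr : r = p ^ μ) (hqr : q = r ^ 2)
    (hFq : Fintype.card F = q) (hq : 2 ≤ q)
    (W : ℕ → AddSubgroup B) (hcard : ∀ l, Nat.card (W l) = q ^ (D * (l + 1)))
    (hmono : Monotone W) (htop : ∀ b, ∃ l, b ∈ W l)
    (hmul : ∀ l m u v, u ∈ W l → v ∈ W m → u * v ∈ W (l + m + e))
    (hpow : ∀ l u, u ∈ W l → u ^ r ∈ W (r * l + r * e))
    (ι : B →+* PowerSeries F) (hι : Function.Injective ι)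
    (hιs : ∀ g : PowerSeries F, ∀ N : ℕ, ∃ b, ∀ i < N, PowerSeries.coeff i (ι b) = PowerSeries.coeff i g)
    (P : Type) [Fintype P] (ev : P → B →+* F)
    (hev : ∀ g : P → F, ∃ b, ∀ x, ev x b = g x)
    (l m : ℕ) (hl : D * (l + e) < r)
    (hm : r * l + r * e + m + e + 1 < D * (l + 1) * (m + 1)) :
    Fintype.card P ≤ D * (l + r * m + r * e + 2 * e) := by
  classical
  have hZ := @zero_lemma B _ _ q D e hq W hcard hmono htop hmul
  have hfin : ∀ l, Finite (W l) := fun l => Nat.finite_of_card_ne_zero (by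
    rw [hcard]; positivity)
  -- order bound
  have hord : ∀ w u, u ∈ W w → u ≠ 0 → ∃ o ≤ D * (w + e), (ι u).order = o := by
    intro w u hu hu0
    have h0 : ι u ≠ 0 := by
      intro h; exact hu0 (hι (by simpa using h))
    obtain ⟨o, ho⟩ := ENat.ne_top_iff_exists.1 (fun h => h0 (PowerSeries.order_eq_top.1 h))
    refine ⟨o, ?_, ho.symm⟩
    let φ : B →+ (Fin o → F) :=
      { toFun := fun b i => PowerSeries.coeff i (ι b)
        map_zero' := by ext; simp
        map_add' := by intros; ext; simp }
    have := hZ φ (by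
      intro g
      obtain ⟨b, hb⟩ := hιs (PowerSeries.mk fun i => if h : i < o then g ⟨i, h⟩ else 0) o
      refine ⟨b, ?_⟩
      ext i
      have := hb i i.2
      simpa [φ] using this) w u hu hu0 (by
      intro b
      ext i
      show PowerSeries.coeff i (ι (u * b)) = 0
      apply PowerSeries.coeff_of_lt_order
      rw [map_mul]
      refine lt_of_lt_of_le ?_ (PowerSeries.le_order_mul _ _)
      rw [← ho]
      refine lt_of_lt_of_le ?_ le_self_add
      exact_mod_cast i.2)
    rw [Nat.card_eq_fintype_card, Fintype.card_fun, hFq, Fintype.card_fin] at this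
    exact (Nat.pow_le_pow_iff_right hq).1 this
  -- the set of orders
  let O : Finset ℕ := (Finset.range (D * (m + e) + 1)).filter
    fun o => ∃ s ∈ W m, (ι s).order = o
  have hO : D * (m + 1) ≤ O.card := by
    let f : W m → (O → F) := fun s o => PowerSeries.coeff o (ι s)
    have hf : Function.Injective f := by
      intro s s' h
      by_contra hne
      have hne' : (s - s' : B) ≠ 0 := by
        intro h; exact hne (Subtype.ext (sub_eq_zero.1 h))
      have hmem : (s - s' : B) ∈ W m := (W m).sub_mem s.2 s'.2
      obtain ⟨o, ho1, ho2⟩ := hord m _ hmem hne'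
      have hoO : o ∈ O := by
        simp only [O, Finset.mem_filter, Finset.mem_range]
        exact ⟨by omega, _, hmem, ho2⟩
      have h1 := congrFun h ⟨o, hoO⟩
      have h2 : PowerSeries.coeff o (ι (s - s')) = 0 := by
        simp only [f] at h1
        rw [map_sub, map_sub, h1, sub_self]
      exact (PowerSeries.order_eq_nat.1 ho2).1 h2
    have h := Nat.card_le_card_of_injective f hf
    rw [hcard, Nat.card_eq_fintype_card, Fintype.card_fun, hFq, Fintype.card_coe] at h
    exact (Nat.pow_le_pow_iff_right hq).1 h
  have hs : ∀ o : O, ∃ s ∈ W m, (ι s).order = (o : ℕ) := by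
    intro o
    exact (Finset.mem_filter.1 o.2).2
  choose s hs1 hs2 using hs
  have hcharPow : ∀ x y : B, (x - y) ^ r = x ^ r - y ^ r := by
    intro x y
    rw [hr]; exact sub_pow_char_pow x y μ
  have hsumB : ∀ g : O → B, (∑ o, g o) ^ r = ∑ o, (g o) ^ r := by
    intro g; rw [hr]; exact sum_pow_char_pow p μ Finset.univ g
  have hsumF : ∀ g : O → F, (∑ o, g o) ^ r = ∑ o, (g o) ^ r := by
    intro g; rw [hr]; exact sum_pow_char_pow p μ Finset.univ g
  have hr0 : r ≠ 0 := by rw [hr]; exact pow_ne_zero _ (Fact.out : p.Prime).ne_zero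
  -- pigeonhole
  obtain ⟨f, hf0, hf⟩ : ∃ f : O → W l, f ≠ 0 ∧ ∑ o, (f o : B) ^ r * s o = 0 := by
    let Ψ : (O → W l) → W (r * l + r * e + m + e) := fun f =>
      ⟨∑ o, (f o : B) ^ r * s o, (W _).sum_mem fun o _ =>
        hmul _ _ _ _ (hpow l _ (f o).2) (hs1 o)⟩
    have hni : ¬ Function.Injective Ψ := by
      intro h
      have h := Nat.card_le_card_of_injective Ψ h
      rw [Nat.card_pi] at h
      simp only [hcard, Finset.prod_const, Finset.card_univ, Fintype.card_coe, ← pow_mul] at h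
      have h := (Nat.pow_le_pow_iff_right hq).1 h
      have h2 : D * (l + 1) * (D * (m + 1)) ≤ D * (l + 1) * O.card := Nat.mul_le_mul_left _ hO
      have h3 : D * (r * l + r * e + m + e + 1) < D * (D * (l + 1) * (m + 1)) := by
        apply Nat.mul_lt_mul_of_pos_left hm
        rcases Nat.eq_zero_or_pos D with h | h
        · subst h; simp at hm
        · exact h
      nlinarith
    simp only [Function.Injective, not_forall] at hni
    obtain ⟨f, f', hff, hne⟩ := hni
    refine ⟨f - f', sub_ne_zero.2 hne, ?_⟩
    have := congrArg Subtype.val hff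
    simp only [Ψ] at this
    simp only [Pi.sub_apply, AddSubgroup.coe_sub, hcharPow, sub_mul, Finset.sum_sub_distrib, this, sub_self]
  set v : B := ∑ o, (f o : B) * s o ^ r with hvdef
  have hvW : v ∈ W (l + r * m + r * e + e) := by
    refine (W _).sum_mem fun o _ => ?_
    have := hmul _ _ _ _ (f o).2 (hpow m _ (hs1 o))
    convert this using 2; ring
  have hv0 : v ≠ 0 := by
    intro hv
    -- choose the minimal order term
    let O' : Finset O := Finset.univ.filter fun o => f o ≠ 0
    have hO' : O'.Nonempty := by
      by_contra h
      rw [Finset.not_nonempty_iff_eq_empty] at h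
      apply hf0
      ext o
      by_contra h2
      have : o ∈ O' := by simp only [O', Finset.mem_filter, Finset.mem_univ, true_and]; intro h3; simp [h3] at h2
      rw [h] at this
      simp at this
    obtain ⟨o, ho, homin⟩ := O'.exists_min_image (fun o => (o : ℕ)) hO'
    have hfo : (f o : B) ≠ 0 := by
      have := (Finset.mem_filter.1 ho).2
      simpa using this
    obtain ⟨k, hk1, hk2⟩ := hord l _ (f o).2 hfo
    have horder : (ι ((f o : B) * s o ^ r)).order = ((k + r * o : ℕ) : ℕ∞) := by
      rw [map_mul, map_pow, PowerSeries.order_mul, PowerSeries.order_pow, hk2, hs2]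
      simp
    have hcoef := (PowerSeries.order_eq_nat.1 horder).1
    have h0 : PowerSeries.coeff (k + r * o) (ι v) = 0 := by rw [hv]; simp
    rw [hvdef, map_sum, map_sum, Finset.sum_eq_single o] at h0
    · exact hcoef h0
    · intro o' _ hne
      by_cases hfo' : (f o' : B) = 0
      · simp [hfo']
      apply PowerSeries.coeff_of_lt_order
      rw [map_mul, map_pow, PowerSeries.order_mul, PowerSeries.order_pow, hs2]
      have hlt : (o : ℕ) < o' := by
        refine lt_of_le_of_ne (homin o' (by simp only [O', Finset.mem_filter, Finset.mem_univ, true_and]; intro h3; simp [h3] at hfo')) ?_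
        intro h; exact hne (Subtype.ext h.symm)
      have hlt2 : k + r * o < r * o' := by
        have : r * (o + 1) ≤ r * (o' : ℕ) := Nat.mul_le_mul_left _ hlt
        nlinarith
      refine lt_of_lt_of_le ?_ le_add_self
      rw [nsmul_eq_mul]
      exact_mod_cast hlt2
    · intro h; exact absurd (Finset.mem_univ _) h
  have hvev : ∀ x, ev x v = 0 := by
    intro x
    have h1 : (ev x v) ^ r = 0 := by
      rw [hvdef, map_sum, hsumF]
      have : ∀ o, (ev x ((f o : B) * s o ^ r)) ^ r = ev x ((f o : B) ^ r * s o) := by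
        intro o
        rw [map_mul, map_mul, map_pow, map_pow, mul_pow, ← pow_mul, ← sq, ← hqr, ← hFq, FiniteField.pow_card]
      simp only [this]
      rw [← map_sum, hf, map_zero]
    exact pow_eq_zero_iff hr0 |>.1 h1
  let φ : B →+ (P → F) :=
      { toFun := fun b x => ev x b
        map_zero' := by ext; simp
        map_add' := by intros; ext; simp }
  have := hZ φ (by
      intro g
      obtain ⟨b, hb⟩ := hev g
      exact ⟨b, funext hb⟩) _ v hvW hv0 (by
      intro b
      ext x
      show ev x (v * b) = 0
      rw [map_mul, hvev, zero_mul])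
  rw [Nat.card_eq_fintype_card, Fintype.card_fun, hFq] at this
  have := (Nat.pow_le_pow_iff_right hq).1 this
  convert this using 2
  ring
end S12
end

section
open Polynomial
namespace S12

section
variable {F B : Type} [Field F] [Fintype F] [CommRing B] [Algebra F[X] B] {d : ℕ}

/-- Elements with coefficients of degree at most `l`. -/
def WW (b : Module.Basis (Fin d) F[X] B) (l : ℕ) : AddSubgroup B where
  carrier := {u | ∀ i, b.repr u i ∈ degreeLT F (l + 1)}
  zero_mem' := by intro i; simp
  add_mem' := by
    intro u v hu hv i
    simp only [map_add, Finsupp.add_apply]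
    exact add_mem (hu i) (hv i)
  neg_mem' := by
    intro u hu i
    simp only [map_neg, Finsupp.neg_apply]
    exact neg_mem (hu i)

theorem mem_WW (b : Module.Basis (Fin d) F[X] B) (l : ℕ) (u : B) :
    u ∈ WW b l ↔ ∀ i, (b.repr u i).natDegree ≤ l := by
  show (∀ i, b.repr u i ∈ degreeLT F (l + 1)) ↔ _
  refine forall_congr' fun i => ?_
  rw [mem_degreeLT, natDegree_le_iff_degree_le]
  rw [show ((l + 1 : ℕ) : WithBot ℕ) = Order.succ (l : WithBot ℕ) from rfl]
  exact Order.lt_succ_iff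

theorem card_WW (b : Module.Basis (Fin d) F[X] B) (l : ℕ) :
    Nat.card (WW b l) = Fintype.card F ^ (d * (l + 1)) := by
  have e1 : WW b l ≃ (Fin d → degreeLT F (l + 1)) :=
    { toFun := fun u i => ⟨b.repr u i, u.2 i⟩
      invFun := fun c => ⟨∑ i, (c i : F[X]) • b i, by
        intro i
        have := b.repr_sum_self (fun i => (c i : F[X]))
        rw [this]; exact (c i).2⟩
      left_inv := by
        intro u
        apply Subtype.ext
        exact b.sum_repr u.1
      right_inv := by
        intro c
        ext1 i
        apply Subtype.ext
        have := b.repr_sum_self (fun i => (c i : F[X]))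
        exact congrFun this i }
  rw [Nat.card_congr e1, Nat.card_congr (Equiv.piCongrRight fun _ => (degreeLTEquiv F (l+1)).toEquiv)]
  simp [← pow_mul, mul_comm]

theorem WW_mono (b : Module.Basis (Fin d) F[X] B) : Monotone (WW b) := by
  intro l m h u hu
  rw [mem_WW] at *
  exact fun i => (hu i).trans h

theorem WW_top (b : Module.Basis (Fin d) F[X] B) (u : B) : ∃ l, u ∈ WW b l := by
  refine ⟨Finset.univ.sup fun i => (b.repr u i).natDegree, ?_⟩
  rw [mem_WW]
  exact fun i => Finset.le_sup (f := fun i => (b.repr u i).natDegree) (Finset.mem_univ i)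

theorem WW_monomial (hd : 0 < d) (b : Module.Basis (Fin d) F[X] B) (y : B) (G : F[X]) (hb : ∀ i, b i = y ^ (i : ℕ))
    (hy : y ^ d = algebraMap F[X] B G) (a : F[X]) (k N : ℕ) (h : a.natDegree + (k / d) * G.natDegree ≤ N) :
    a • y ^ k ∈ WW b N := by
  have h1 : a • y ^ k = (a * G ^ (k / d)) • b ⟨k % d, Nat.mod_lt _ hd⟩ := by
    rw [hb]
    conv_lhs => rw [← Nat.div_add_mod k d, pow_add, pow_mul, hy, ← map_pow]
    rw [Algebra.smul_def, Algebra.smul_def, map_mul, mul_assoc]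
  rw [mem_WW, h1]
  intro i
  rw [map_smul, Module.Basis.repr_self, Finsupp.smul_single, smul_eq_mul, mul_one, Finsupp.single_apply]
  split_ifs
  · refine natDegree_mul_le.trans (le_trans ?_ h)
    gcongr
    exact natDegree_pow_le
  · simp

theorem WW_mul (hd : 0 < d) (b : Module.Basis (Fin d) F[X] B) (y : B) (G : F[X]) (hb : ∀ i, b i = y ^ (i : ℕ))
    (hy : y ^ d = algebraMap F[X] B G) (l m : ℕ) (u v : B) (hu : u ∈ WW b l) (hv : v ∈ WW b m) :
    u * v ∈ WW b (l + m + G.natDegree) := by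
  rw [mem_WW] at hu hv
  rw [← b.sum_repr u, ← b.sum_repr v, Finset.sum_mul_sum]
  refine sum_mem fun i _ => sum_mem fun j _ => ?_
  rw [smul_mul_smul_comm, hb, hb, ← pow_add]
  apply WW_monomial hd b y G hb hy
  have h1 : ((i:ℕ) + j) / d ≤ 1 := by
    have := i.2; have := j.2
    rw [Nat.div_le_iff_le_mul_add_pred hd]; omega
  have := natDegree_mul_le (p := b.repr u i) (q := b.repr v j)
  have := hu i; have := hv j
  nlinarith [Nat.zero_le G.natDegree]

theorem WW_pow (hd : 0 < d) (b : Module.Basis (Fin d) F[X] B) (y : B) (G : F[X]) (hb : ∀ i, b i = y ^ (i : ℕ))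
    (hy : y ^ d = algebraMap F[X] B G) (p μ r : ℕ) [Fact p.Prime] [CharP B p] (hr : r = p ^ μ)
    (l : ℕ) (u : B) (hu : u ∈ WW b l) :
    u ^ r ∈ WW b (r * l + r * G.natDegree) := by
  rw [mem_WW] at hu
  have : u ^ r = ∑ i, ((b.repr u i) ^ r) • y ^ ((i : ℕ) * r) := by
    conv_lhs => rw [← b.sum_repr u]
    rw [hr, sum_pow_char_pow]
    refine Finset.sum_congr rfl fun i _ => ?_
    rw [hb, _root_.smul_pow, ← pow_mul]
  rw [this]
  refine sum_mem fun i _ => ?_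
  apply WW_monomial hd b y G hb hy
  have h1 : (i:ℕ) * r / d ≤ r := by
    have := i.2
    apply Nat.div_le_of_le_mul
    exact Nat.mul_le_mul_right _ this.le
  have := natDegree_pow_le (p := b.repr u i) (n := r)
  have := Nat.mul_le_mul_left r (hu i)
  nlinarith [Nat.zero_le G.natDegree]
end

theorem curve_bound_core {F B : Type} [Field F] [Fintype F] [DecidableEq F] [CommRing B] [IsDomain B] [Algebra F[X] B] {d : ℕ}
    (hd : 0 < d) (hdF : (d : F) ≠ 0) (b : Module.Basis (Fin d) F[X] B) (y : B) (G : F[X]) (hb : ∀ i, b i = y ^ (i : ℕ))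
    (hy : y ^ d = algebraMap F[X] B G) (p μ r : ℕ) [Fact p.Prime] [CharP F p] (hr : r = p ^ μ)
    (hF : Fintype.card F = r ^ 2)
    (hlift : ∀ (R : Type) [CommRing R] (f : F[X] →+* R) (z : R), z ^ d = f G →
      ∃ φ : B →+* R, (∀ a, φ (algebraMap F[X] B a) = f a) ∧ φ y = z)
    (x0 y0 : F) (hy0 : y0 ≠ 0) (hxy0 : y0 ^ d = G.eval x0)
    (l m : ℕ) (hl : d * (l + G.natDegree) < r)
    (hm : r * l + r * G.natDegree + m + G.natDegree + 1 < d * (l + 1) * (m + 1)) :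
    Fintype.card {P : F × F // P.2 ^ d = G.eval P.1} ≤ d * (l + r * m + r * G.natDegree + 2 * G.natDegree) := by
  have hinj0 : Function.Injective (algebraMap F[X] B) := by
    have : Module.Free F[X] B := Module.Free.of_basis b
    exact FaithfulSMul.algebraMap_injective F[X] B
  have hcB : CharP B p := by
    have := charP_of_injective_ringHom (f := (algebraMap F[X] B).comp (C : F →+* F[X])) (hinj0.comp C_injective) p
    exact this
  have hq : 2 ≤ Fintype.card F := Fintype.one_lt_card
  -- ι
  obtain ⟨Y, hY1, hY2⟩ := exists_root_ps d hdF ((taylor x0 G : F[X]) : PowerSeries F) y0 hy0 (by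
    rw [hxy0]; simp [← PowerSeries.coeff_zero_eq_constantCoeff_apply])
  obtain ⟨ι, hι1, hι2⟩ := hlift (PowerSeries F)
    ((coeToPowerSeries.ringHom (R := F)).comp (taylorAlgHom x0 : F[X] →ₐ[F] F[X]).toRingHom) Y (by
      simpa using hY1)
  have hι1' : ∀ a, ι (algebraMap F[X] B a) = ((taylor x0 a : F[X]) : PowerSeries F) := by
    intro a; simpa using hι1 a
  have hιinj : Function.Injective ι := by
    have : Algebra.IsIntegral F[X] B := by
      have : Module.Finite F[X] B := Module.Finite.of_basis b
      infer_instance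
    rw [RingHom.injective_iff_ker_eq_bot]
    apply Ideal.eq_bot_of_comap_eq_bot (R := F[X])
    rw [eq_bot_iff]
    intro a ha
    rw [Ideal.mem_comap, RingHom.mem_ker, hι1'] at ha
    rw [Ideal.mem_bot]
    have h2 : (taylor x0 a : F[X]) = 0 := by exact_mod_cast ha
    exact (taylor_injective x0) (by simpa using h2)
  choose ev hev1 hev2 using fun P : {P : F × F // P.2 ^ d = G.eval P.1} =>
    hlift F (evalRingHom P.1.1) P.1.2 (by simpa using P.2)
  refine stepanov_core p μ r (Fintype.card F) d G.natDegree hr hF rfl hq (WW b) (card_WW b) (WW_mono b)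
    (WW_top b) (WW_mul hd b y G hb hy) (WW_pow hd b y G hb hy p μ r hr) ι hιinj ?_ _ ev ?_ l m hl hm
  · intro g N
    refine ⟨algebraMap F[X] B (taylor (-x0) (PowerSeries.trunc N g)), ?_⟩
    intro i hi
    rw [hι1', taylor_taylor]
    simp [PowerSeries.coeff_trunc, hi]
  · intro g
    set q := Fintype.card F
    have hq1 : q - 1 ≠ 0 := by omega
    have hpw : ∀ z : F, (1 - z ^ (q - 1)) = if z = 0 then 1 else 0 := by
      intro z
      split_ifs with h
      · rw [h, zero_pow hq1, sub_zero]
      · rw [FiniteField.pow_card_sub_one_eq_one z h, sub_self]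
    refine ⟨∑ P, algebraMap F[X] B (C (g P)) * ((1 - (algebraMap F[X] B (X - C P.1.1)) ^ (q - 1)) *
      (1 - (y - algebraMap F[X] B (C P.1.2)) ^ (q - 1))), ?_⟩
    intro P
    rw [map_sum, Finset.sum_eq_single P]
    · simp [hev1, hev2, hpw, zero_pow hq1]
    · intro P' _ hne
      simp only [map_mul, map_sub, map_one, map_pow, hev1, hev2]
      simp only [coe_evalRingHom, eval_C, eval_X, hpw, sub_eq_zero]
      by_cases h1 : P.1.1 = P'.1.1
      · by_cases h2 : P.1.2 = P'.1.2
        · exact absurd (Subtype.ext (Prod.ext h1 h2)).symm hne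
        · simp [h2]
      · simp [h1]
    · simp
theorem curve_params (d e r : ℕ) (hd : 0 < d) (h : (d * e + 2 * d + 1) ^ 2 ≤ r) :
    ∃ l m, d * (l + e) < r ∧ r * l + r * e + m + e + 1 < d * (l + 1) * (m + 1) ∧
      d * (l + r * m + r * e + 2 * e) ≤ r ^ 2 + r * (d * (3 * e + 2) + 1) := by
  have hr1 : 1 ≤ r := le_trans (Nat.one_le_pow _ _ (by omega)) h
  have hder : d * e ≤ r - 1 := by
    have : d * e + 1 ≤ (d * e + 2 * d + 1) ^ 2 := by nlinarith [Nat.zero_le (d*e)]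
    omega
  obtain ⟨s, hs⟩ : ∃ s, (r - 1) / d = s + e := by
    have : e ≤ (r - 1) / d := by
      rw [Nat.le_div_iff_mul_le hd]; linarith
    exact ⟨(r - 1) / d - e, by omega⟩
  have h1 : d * (s + e) ≤ r - 1 := by rw [← hs]; exact Nat.mul_div_le _ _
  have h2 : r - 1 < d * (s + e + 1) := by rw [← hs]; exact Nat.lt_mul_div_succ _ hd
  obtain ⟨t, ht⟩ : ∃ t, r / d = t := ⟨_, rfl⟩
  have h3 : d * t ≤ r := by rw [← ht]; exact Nat.mul_div_le _ _
  have h4 : r < d * (t + 1) := by rw [← ht]; exact Nat.lt_mul_div_succ _ hd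
  have h1' : d * (s + e) + 1 ≤ r := by omega
  have h2' : r ≤ d * (s + e + 1) := by omega
  refine ⟨s, t + e + 2, by omega, ?_, ?_⟩
  · clear hs ht h1 h2
    zify at *
    have hd1 : (1:ℤ) ≤ d := by omega
    have he0 : (0:ℤ) ≤ e := by positivity
    have hde : (0:ℤ) ≤ d * e := by positivity
    apply lt_of_mul_lt_mul_left (a := (d:ℤ)) _ (by positivity)
    have a1 : (r:ℤ) - d * e ≤ d * (s + 1) := by linarith
    have a2 : (r:ℤ) + d * e + 2 * d < d * (t + e + 2 + 1) := by linarith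
    have a3 : ((r:ℤ) - d * e - 1) * (r + d * e + 2 * d) ≤ (d * (s + 1) - 1) * (d * (t + e + 2 + 1)) := by
      apply mul_le_mul (by linarith) a2.le (by positivity)
      nlinarith
    have a4 : (r:ℤ) * (d * (s + e) + 1) ≤ r * r := by gcongr
    have a5 : ((d:ℤ) * e + 2 * d + 1) ^ 2 ≤ r * (2 * d - 0) := by nlinarith
    nlinarith
  · have b1 : r * (d * t) ≤ r * r := by gcongr
    have b3 : d * e ≤ r * (d * e) := Nat.le_mul_of_pos_left _ hr1
    nlinarith

theorem curve_bound {F : Type} [Field F] [Fintype F] [DecidableEq F] {d : ℕ}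
    (hd : 0 < d) (hdF : (d : F) ≠ 0) (G : F[X]) (hG : G ≠ 0)
    (hirr : Irreducible (X ^ d - C G : F[X][X])) (p μ r : ℕ) [Fact p.Prime] [CharP F p] (hr : r = p ^ μ)
    (hF : Fintype.card F = r ^ 2) (h : (d * G.natDegree + 2 * d + 1) ^ 2 ≤ r) :
    Fintype.card {P : F × F // P.2 ^ d = G.eval P.1} ≤ r ^ 2 + r * (d * (3 * G.natDegree + 2) + 1) := by
  obtain ⟨l, m, h1, h2, h3⟩ := curve_params d G.natDegree r hd h
  by_cases hex : ∃ x0 y0 : F, y0 ≠ 0 ∧ y0 ^ d = G.eval x0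
  · obtain ⟨x0, y0, hy0, hxy⟩ := hex
    refine le_trans ?_ h3
    have hmon : (X ^ d - C G : F[X][X]).Monic := monic_X_pow_sub_C G hd.ne'
    have hdeg : (X ^ d - C G : F[X][X]).natDegree = d := natDegree_X_pow_sub_C
    have : IsDomain (AdjoinRoot (X ^ d - C G : F[X][X])) :=
      AdjoinRoot.isDomain_of_prime hirr.prime
    let pb := AdjoinRoot.powerBasis' hmon
    have hpb : pb.dim = d := by simp [pb, hdeg]
    refine curve_bound_core hd hdF (pb.basis.reindex (finCongr hpb)) (AdjoinRoot.root _) G ?_ ?_ p μ r hr hF ?_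
      x0 y0 hy0 hxy l m h1 h2
    · intro i
      simp [pb]
    · have := AdjoinRoot.eval₂_root (X ^ d - C G : F[X][X])
      simpa [sub_eq_zero] using this
    · intro R _ f z hz
      refine ⟨AdjoinRoot.lift f z (by simp [hz]), ?_, ?_⟩
      · intro a
        exact AdjoinRoot.lift_of _
      · exact AdjoinRoot.lift_root _
  · push Not at hex
    have hP : ∀ P : {P : F × F // P.2 ^ d = G.eval P.1}, P.1.2 = 0 := by
      intro P; by_contra hne; exact hex _ _ hne P.2
    have : Fintype.card {P : F × F // P.2 ^ d = G.eval P.1} ≤ G.roots.toFinset.card := by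
      rw [← Fintype.card_coe]
      refine Fintype.card_le_of_injective (fun P => ⟨P.1.1, ?_⟩) ?_
      · have h1 := hP P
        have h2 := P.2
        rw [h1, zero_pow hd.ne'] at h2
        simp [hG, ← h2]
      · intro P P' h
        simp only [Subtype.mk.injEq] at h
        exact Subtype.ext (Prod.ext h ((hP P).trans (hP P').symm))
    have h4 := (Multiset.toFinset_card_le G.roots).trans (card_roots' G)
    have h5 : G.natDegree ≤ (d * G.natDegree + 2 * d + 1) ^ 2 := by
      have : G.natDegree ≤ d * G.natDegree := Nat.le_mul_of_pos_left _ hd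
      nlinarith
    have h6 : r ≤ r ^ 2 := Nat.le_self_pow (by norm_num) r
    have h7 := Nat.zero_le (r * (d * (3 * G.natDegree + 2) + 1))
    linarith
end S12
end

section
open Polynomial
namespace S12

theorem irr_kummer {K : Type*} [Field K] {n : ℕ} (hn : 0 < n) {ζ : K} (hζ : IsPrimitiveRoot ζ n) {a : K} (ha : a ≠ 0)
    (h : ∀ l : ℕ, l.Prime → l ∣ n → ∀ b : K, b ^ l ≠ a) : Irreducible (X ^ n - C a : K[X]) := by
  let E := AlgebraicClosure K
  obtain ⟨α, hα⟩ := IsAlgClosed.exists_pow_nat_eq (algebraMap K E a) hn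
  have hα0 : α ≠ 0 := by
    rintro rfl
    rw [zero_pow hn.ne'] at hα
    exact ha ((algebraMap K E).injective (by rw [← hα, map_zero]))
  have hIntg : IsIntegral K α := Algebra.IsIntegral.isIntegral α
  set f := minpoly K α
  have hf : f.Monic := minpoly.monic hIntg
  have hdvd : f ∣ X ^ n - C a := by
    apply minpoly.dvd; simp [hα]
  have hsplit : (f.map (algebraMap K E)).Splits := IsAlgClosed.splits _
  have hroot : ∀ z ∈ (f.map (algebraMap K E)).roots, ∃ c : K, z = algebraMap K E c * α := by
    intro z hz
    have hz1 : aeval z f = 0 := by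
      have := (mem_roots'.1 hz).2
      simpa [IsRoot, eval_map_algebraMap] using this
    have hz2 : z ^ n = algebraMap K E a := by
      obtain ⟨g, hg⟩ := hdvd
      have := congrArg (aeval z) hg
      rw [map_mul, hz1, zero_mul] at this
      simpa [sub_eq_zero] using this
    have h3 : (z / α) ^ n = 1 := by rw [div_pow, hz2, hα, div_self]; simpa using ha
    have hζ' : IsPrimitiveRoot (algebraMap K E ζ) n := hζ.map_of_injective (algebraMap K E).injective
    have : NeZero n := ⟨hn.ne'⟩
    obtain ⟨i, _, hi⟩ := hζ'.eq_pow_of_pow_eq_one h3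
    refine ⟨ζ ^ i, ?_⟩
    rw [map_pow, hi, div_mul_cancel₀ _ hα0]
  have hms : ∀ s : Multiset E, (∀ z ∈ s, ∃ c : K, z = algebraMap K E c * α) →
      ∃ c : K, s.prod = algebraMap K E c * α ^ s.card := by
    intro s
    induction s using Multiset.induction_on with
    | empty => intro _; exact ⟨1, by simp⟩
    | cons z s ih =>
      intro hs
      obtain ⟨c, hc⟩ := ih (fun z hz => hs z (Multiset.mem_cons_of_mem hz))
      obtain ⟨c', hc'⟩ := hs z (Multiset.mem_cons_self _ _)
      refine ⟨c' * c, ?_⟩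
      rw [Multiset.prod_cons, hc, hc', Multiset.card_cons, map_mul]; ring
  obtain ⟨c, hc⟩ := hms _ hroot
  have hcard : (f.map (algebraMap K E)).roots.card = f.natDegree := by
    rw [← hsplit.natDegree_eq_card_roots, natDegree_map]
  have hmon' : (f.map (algebraMap K E)).Monic := hf.map _
  have hcoef := hsplit.coeff_zero_eq_prod_roots_of_monic hmon'
  rw [hc, hcard, natDegree_map, coeff_map] at hcoef
  -- subgroup
  have hf0 : f.coeff 0 ≠ 0 := by
    exact minpoly.coeff_zero_ne_zero hIntg hα0
  set e := f.natDegree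
  have he : ∃ b : K, α ^ e = algebraMap K E b := by
    have hc0 : c ≠ 0 := by
      rintro rfl
      simp at hcoef; exact hf0 hcoef
    refine ⟨(-1) ^ e * f.coeff 0 / c, ?_⟩
    have hc0' : algebraMap K E c ≠ 0 := by simpa using hc0
    rw [map_div₀, map_mul, hcoef, map_pow, map_neg, map_one, ← mul_assoc, ← mul_pow]
    have h11 : ((-1:E) * -1) = 1 := by ring
    rw [eq_div_iff hc0', mul_comm, h11, one_pow, one_mul]
  obtain ⟨b, hb⟩ := he
  have hgcd : ∃ b' : K, α ^ (Nat.gcd e n) = algebraMap K E b' := by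
    refine ⟨b ^ (Nat.gcdA e n) * a ^ (Nat.gcdB e n), ?_⟩
    rw [← zpow_natCast, Nat.gcd_eq_gcd_ab, zpow_add₀ hα0, zpow_mul, zpow_mul, zpow_natCast, zpow_natCast,
      hb, hα, map_mul, map_zpow₀, map_zpow₀]
  obtain ⟨b', hb'⟩ := hgcd
  obtain ⟨k, hk⟩ := Nat.gcd_dvd_right e n
  have hak : b' ^ k = a := by
    apply (algebraMap K E).injective
    rw [map_pow, ← hb', ← pow_mul, ← hk, hα]
  have hk1 : k = 1 := by
    by_contra hk1
    obtain ⟨l, hl, j, hj⟩ := Nat.exists_prime_and_dvd hk1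
    refine h l hl ⟨Nat.gcd e n * j, (hk.trans (by rw [hj]; exact Nat.mul_left_comm _ _ _))⟩ (b' ^ j) ?_
    rw [← pow_mul, mul_comm, ← hj, hak]
  have hne : n ∣ e := by
    rw [hk1, mul_one] at hk
    rw [hk]; exact Nat.gcd_dvd_left e n
  have he0 : 0 < e := minpoly.natDegree_pos hIntg
  have hle : n ≤ e := Nat.le_of_dvd he0 hne
  have hmon2 : (X ^ n - C a : K[X]).Monic := monic_X_pow_sub_C a hn.ne'
  have : f = X ^ n - C a := by
    symm
    refine eq_of_monic_of_dvd_of_natDegree_le hf hmon2 hdvd ?_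
    rw [natDegree_X_pow_sub_C]; exact hle
  rw [← this]
  exact minpoly.irreducible hIntg

theorem irr_curve {F Ω : Type*} [Field F] [Field Ω] [Algebra F Ω] {d : ℕ} (hd : 0 < d) {ζ : F} (hζ : IsPrimitiveRoot ζ d)
    (G : F[X]) (hG : G ≠ 0)
    (h : ∀ l : ℕ, l.Prime → l ∣ d → ∃ β : Ω, ¬ l ∣ (G.map (algebraMap F Ω)).rootMultiplicity β) (c : F) (hc : c ≠ 0) :
    Irreducible (X ^ d - C (C c * G) : F[X][X]) := by
  have hmon : (X ^ d - C (C c * G) : F[X][X]).Monic := monic_X_pow_sub_C _ hd.ne'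
  rw [hmon.irreducible_iff_irreducible_map_fraction_map (K := RatFunc F)]
  have hcG : C c * G ≠ 0 := mul_ne_zero (by simpa using hc) hG
  have hinj : Function.Injective (algebraMap F[X] (RatFunc F)) := IsFractionRing.injective _ _
  have hmap : (X ^ d - C (C c * G) : F[X][X]).map (algebraMap F[X] (RatFunc F)) =
    X ^ d - C (algebraMap F[X] (RatFunc F) (C c * G)) := by simp
  rw [hmap]
  have hζ' : IsPrimitiveRoot (algebraMap F[X] (RatFunc F) (C ζ)) d :=
    (hζ.map_of_injective C_injective).map_of_injective hinj
  refine irr_kummer hd hζ' (by rwa [Ne, map_eq_zero_iff _ hinj]) ?_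
  intro l hl hld b hb
  obtain ⟨b', rfl⟩ : ∃ b' : F[X], algebraMap F[X] (RatFunc F) b' = b :=
    IsIntegrallyClosed.exists_algebraMap_eq_of_isIntegral_pow hl.pos (by
      rw [hb]; exact isIntegral_algebraMap)
  rw [← map_pow] at hb
  have hb := hinj hb
  obtain ⟨β, hβ⟩ := h l hl hld
  apply hβ
  classical
  have h1 := congrArg (fun g => (g.map (algebraMap F Ω)).roots.count β) hb
  simp only [Polynomial.map_mul, Polynomial.map_pow, roots_pow, map_C, Multiset.count_nsmul] at h1
  rw [roots_C_mul _ (by simpa using hc), count_roots, count_roots] at h1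
  exact ⟨_, h1.symm⟩
end S12
end

section
open Polynomial
namespace S12

theorem char_gen {E : Type} [Field E] [Fintype E] (η : MulChar E ℂ) (d : ℕ) (hd : orderOf η = d) (hd0 : 0 < d) :
    ∃ g : Eˣ, (∀ x, x ∈ Submonoid.powers g) ∧ IsPrimitiveRoot (η g) d ∧
      ∃ ζ : E, IsPrimitiveRoot ζ d := by
  classical
  obtain ⟨g, hg⟩ := IsCyclic.exists_generator (α := Eˣ)
  have h1 : ∀ x, x ∈ Submonoid.powers g := fun x => mem_powers_iff_mem_zpowers.2 (hg x)
  have h2 : orderOf (η g) = d := by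
    rw [← hd]
    apply orderOf_eq_orderOf_iff.2
    intro n
    rw [MulChar.eq_iff hg (η ^ n) 1, MulChar.pow_apply_coe, MulChar.one_apply_coe]
  have h3 : d ∣ Fintype.card Eˣ := by
    rw [← hd, orderOf_dvd_iff_pow_eq_one]
    rw [MulChar.eq_iff hg, MulChar.pow_apply_coe, ← map_pow, ← Units.val_pow_eq_pow_val, pow_card_eq_one]
    simp
  refine ⟨g, h1, h2 ▸ IsPrimitiveRoot.orderOf (η g), ?_⟩
  obtain ⟨k, hk⟩ := h3
  have h4 : orderOf g = d * k := by rw [← hk, ← Nat.card_eq_fintype_card]; exact orderOf_eq_card_of_forall_mem_zpowers hg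
  have hk0 : k ≠ 0 := by
    rintro rfl
    have := Fintype.card_pos (α := Eˣ)
    omega
  have h5 : orderOf (g ^ k) = d := by
    rw [orderOf_pow_of_dvd hk0 (by rw [h4]; exact dvd_mul_left _ _), h4]
    exact Nat.mul_div_cancel _ (Nat.pos_of_ne_zero hk0)
  refine ⟨((g ^ k : Eˣ) : E), ?_⟩
  rw [← h5, ← orderOf_units]
  exact IsPrimitiveRoot.orderOf _

theorem class_bound {E : Type} [Field E] [Fintype E] [DecidableEq E] (η : MulChar E ℂ) (d : ℕ) (hd : orderOf η = d) (hd0 : 0 < d)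
    {ζ : E} (hζ : IsPrimitiveRoot ζ d) (g : Eˣ) (hg : ∀ x, x ∈ Submonoid.powers g) (hη : IsPrimitiveRoot (η g) d)
    (G : E[X]) (M : ℕ) (hM : ∀ c : E, c ≠ 0 → Fintype.card {P : E × E // P.2 ^ d = (C c * G).eval P.1} ≤ M) (i : ℕ) :
    d * Fintype.card {z : E // η (G.eval z) = (η g) ^ i} ≤ M := by
  obtain ⟨j, hj⟩ : ∃ j, d ∣ i + j := by
    refine ⟨(d - 1) * i, i, ?_⟩
    obtain ⟨d', rfl⟩ : ∃ d', d = d' + 1 := ⟨d - 1, by omega⟩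
    simp; ring
  refine le_trans ?_ (hM ((g ^ j : Eˣ) : E) (Units.ne_zero _))
  have hroot : ∀ z : {z : E // η (G.eval z) = (η g) ^ i}, ∃ y : E, y ≠ 0 ∧ y ^ d = (C ((g ^ j : Eˣ) : E) * G).eval z.1 := by
    rintro ⟨z, hz⟩
    have hGz : IsUnit (G.eval z) := by
      by_contra h
      rw [MulChar.map_nonunit _ h] at hz
      exact pow_ne_zero i (hη.ne_zero hd0.ne') hz.symm
    obtain ⟨w, hw⟩ := hGz
    obtain ⟨k, hk⟩ := hg w
    simp only at hk
    have h1 : d ∣ k + j := by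
      apply (hη.pow_eq_one_iff_dvd _).1
      rw [← hw, ← hk] at hz
      simp only [Units.val_pow_eq_pow_val, map_pow] at hz
      rw [pow_add, hz, ← pow_add]
      exact (hη.pow_eq_one_iff_dvd _).2 hj
    obtain ⟨s, hs⟩ := h1
    refine ⟨((g ^ s : Eˣ) : E), Units.ne_zero _, ?_⟩
    simp only [eval_mul, eval_C]
    rw [← hw, ← hk, ← Units.val_mul, ← Units.val_pow_eq_pow_val, ← pow_mul, ← pow_add, add_comm j, hs, mul_comm s]
  choose y hy0 hy using hroot
  let f : Fin d × {z : E // η (G.eval z) = (η g) ^ i} → {P : E × E // P.2 ^ d = (C ((g ^ j : Eˣ) : E) * G).eval P.1} :=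
    fun P => ⟨(P.2.1, ζ ^ (P.1 : ℕ) * y P.2), by
      simp only [mul_pow, ← pow_mul]
      rw [mul_comm _ d, pow_mul, hζ.pow_eq_one, one_pow, one_mul, hy]⟩
  have hf : Function.Injective f := by
    rintro ⟨a, z⟩ ⟨a', z'⟩ h
    simp only [f, Subtype.mk.injEq, Prod.mk.injEq] at h
    obtain ⟨h1, h2⟩ := h
    have h1 := Subtype.ext h1
    subst h1
    have h2 := mul_right_cancel₀ (hy0 _) h2
    have h3 := hζ.pow_inj a.2 a'.2 h2
    exact Prod.ext (Fin.ext h3) rfl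
  have := Fintype.card_le_of_injective f hf
  simpa using this

theorem charsum_of_bound {E : Type} [Field E] [Fintype E] [DecidableEq E] (η : MulChar E ℂ) (d : ℕ) (hd : orderOf η = d) (hd0 : 1 < d)
    (G : E[X]) (hG : G ≠ 0) (M : ℕ)
    (hM : ∀ c : E, c ≠ 0 → Fintype.card {P : E × E // P.2 ^ d = (C c * G).eval P.1} ≤ M) :
    ‖∑ z, η (G.eval z)‖ ≤ (M : ℝ) - Fintype.card E + G.natDegree := by
  classical
  obtain ⟨g, hg, hη, ζ, hζ⟩ := char_gen η d hd (by omega)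
  have hcl := class_bound η d hd (by omega) hζ g hg hη G M hM
  set ω := η g
  have hmod : ∀ i j : ℕ, ω ^ i = ω ^ j ↔ i ≡ j [MOD d] := by
    intro i j
    rw [(hη.isOfFinOrder (by omega)).pow_eq_pow_iff_modEq, ← hη.eq_orderOf]
  have hpt : ∀ w : E, w ≠ 0 → ∃ i ∈ Finset.range d, η w = ω ^ i ∧ ∀ j ∈ Finset.range d, η w = ω ^ j → j = i := by
    intro w hw
    obtain ⟨k, hk⟩ := hg (Units.mk0 w hw)
    simp only at hk
    have h1 : η w = ω ^ k := by
      rw [← Units.val_mk0 hw, ← hk]; simp [ω]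
    refine ⟨k % d, by simp; exact Nat.mod_lt _ (by omega), ?_, ?_⟩
    · rw [h1]; exact (hmod _ _).2 (Nat.mod_modEq _ _).symm
    · intro j hj h2
      rw [h1] at h2
      have h3 := (hmod _ _).1 h2
      rw [Finset.mem_range] at hj
      rw [← Nat.mod_eq_of_lt hj]; exact h3.symm
  let n : ℕ → ℕ := fun i => Fintype.card {z : E // η (G.eval z) = ω ^ i}
  have hn : ∀ i, n i = ∑ z, if η (G.eval z) = ω ^ i then 1 else 0 := by
    intro i; simp [n, Fintype.card_subtype]
  have hsum : ∑ z, η (G.eval z) = ∑ i ∈ Finset.range d, (n i : ℂ) * ω ^ i := by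
    simp only [hn]
    push_cast
    simp only [Finset.sum_mul]
    rw [Finset.sum_comm]
    refine Finset.sum_congr rfl fun z _ => ?_
    by_cases hz : G.eval z = 0
    · rw [hz, MulChar.map_zero, Finset.sum_eq_zero]
      intro i _
      rw [if_neg (pow_ne_zero i (hη.ne_zero (by omega))).symm, zero_mul]
    · obtain ⟨i, hi, h1, h2⟩ := hpt _ hz
      rw [Finset.sum_eq_single_of_mem i hi]
      · rw [if_pos h1, h1, one_mul]
      · intro j hj hne
        rw [if_neg, zero_mul]
        intro h; exact hne (h2 j hj h)
  have htot : Fintype.card E ≤ ∑ i ∈ Finset.range d, n i + G.natDegree := by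
    have h1 : ∀ z : E, 1 ≤ (∑ i ∈ Finset.range d, if η (G.eval z) = ω ^ i then 1 else 0) + if G.eval z = 0 then 1 else 0 := by
      intro z
      by_cases hz : G.eval z = 0
      · simp [hz]
      · obtain ⟨i, hi, h1, h2⟩ := hpt _ hz
        rw [Finset.sum_eq_single_of_mem i hi]
        · simp [h1]
        · intro j hj hne
          rw [if_neg]
          intro h; exact hne (h2 j hj h)
    have h2 := Finset.sum_le_sum (s := (Finset.univ : Finset E)) fun z _ => h1 z
    rw [Finset.sum_add_distrib, Finset.sum_comm] at h2
    simp only [← hn] at h2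
    have h3 : (∑ z : E, if G.eval z = 0 then 1 else 0) ≤ G.natDegree := by
      rw [Finset.sum_boole]
      refine le_trans ?_ ((Multiset.toFinset_card_le G.roots).trans (card_roots' G))
      apply Finset.card_le_card
      intro z hz
      simp at hz
      simp [hG, hz]
    simp only [Finset.sum_const, Finset.card_univ, smul_eq_mul, mul_one] at h2
    linarith
  have hz0 : ∑ i ∈ Finset.range d, ω ^ i = 0 := hη.geom_sum_eq_zero hd0
  have hsum2 : ∑ z, η (G.eval z) = ∑ i ∈ Finset.range d, ((n i : ℂ) - (M:ℂ) / d) * ω ^ i := by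
    rw [hsum]
    simp only [sub_mul, Finset.sum_sub_distrib, ← Finset.mul_sum, hz0]; simp
  have hω : ‖ω‖ = 1 := hη.norm'_eq_one (by omega)
  have hdpos : (0:ℝ) < d := by positivity
  have hdM : (d:ℝ) * (M / d) = M := by field_simp
  rw [hsum2]
  calc _ ≤ ∑ i ∈ Finset.range d, ‖((n i : ℂ) - (M:ℂ) / d) * ω ^ i‖ := norm_sum_le _ _
    _ = ∑ i ∈ Finset.range d, ((M:ℝ) / d - n i) := by
      refine Finset.sum_congr rfl fun i _ => ?_
      rw [norm_mul, norm_pow, hω, one_pow, mul_one]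
      rw [show ((n i : ℂ) - (M:ℂ) / d) = (((n i : ℝ) - (M:ℝ) / d : ℝ) : ℂ) by push_cast; rfl]
      rw [Complex.norm_real, Real.norm_eq_abs, abs_sub_comm, abs_of_nonneg]
      rw [sub_nonneg, le_div_iff₀ hdpos, mul_comm]
      exact_mod_cast hcl i
    _ = M - ∑ i ∈ Finset.range d, (n i : ℝ) := by
      rw [Finset.sum_sub_distrib]; simp [hdM]
    _ ≤ _ := by
      have : (Fintype.card E : ℝ) ≤ ∑ i ∈ Finset.range d, (n i:ℝ) + G.natDegree := by exact_mod_cast htot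
      linarith

/-- The weak Weil bound for multiplicative character sums over fields of square order. -/
theorem charsum_weak {E Ω : Type} [Field E] [Fintype E] [Field Ω] [Algebra E Ω] (η : MulChar E ℂ) (d : ℕ) (hd : orderOf η = d) (hd0 : 1 < d)
    (G : E[X]) (hG : G ≠ 0)
    (h : ∀ l : ℕ, l.Prime → l ∣ d → ∃ β : Ω, ¬ l ∣ (G.map (algebraMap E Ω)).rootMultiplicity β)
    (p μ r : ℕ) [Fact p.Prime] [CharP E p] (hr : r = p ^ μ)
    (hF : Fintype.card E = r ^ 2) (hrd : (d * G.natDegree + 2 * d + 1) ^ 2 ≤ r) :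
    ‖∑ z, η (G.eval z)‖ ≤ r * (d * (3 * G.natDegree + 2) + 1) + G.natDegree := by
  classical
  obtain ⟨g, hg, hη, ζ, hζ⟩ := char_gen η d hd (by omega)
  have hdF : (d : E) ≠ 0 := by
    have : NeZero d := ⟨by omega⟩
    exact hζ.neZero'.ne
  have := charsum_of_bound η d hd hd0 G hG (r ^ 2 + r * (d * (3 * G.natDegree + 2) + 1)) (by
    intro c hc
    have hdeg : (C c * G).natDegree = G.natDegree := natDegree_C_mul hc
    have := curve_bound (by omega) hdF (C c * G) (mul_ne_zero (by simpa using hc) hG)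
      (irr_curve (by omega) hζ G hG h c hc) p μ r hr hF (by rwa [hdeg])
    rwa [hdeg] at this)
  rw [hF] at this
  push_cast at this
  linarith
end S12
end

section
open Polynomial UniqueFactorizationMonoid
namespace S12
set_option linter.unusedSectionVars false
section
variable {F : Type} [Field F] [Finite F]

theorem finite_monic (N : ℕ) : {h : F[X] | h.Monic ∧ h.natDegree = N}.Finite := by
  have : Finite (degreeLT F (N + 1)) := Finite.of_equiv _ (degreeLTEquiv F (N+1)).toEquiv.symm
  refine Set.Finite.subset (s := (degreeLT F (N+1) : Set F[X])) (Set.toFinite _) ?_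
  rintro h ⟨h1, h2⟩
  rw [SetLike.mem_coe, mem_degreeLT]
  refine lt_of_le_of_lt degree_le_natDegree ?_
  rw [h2]; exact_mod_cast Nat.lt_succ_self N

/-- The finset of monic polynomials of degree `N`. -/
noncomputable def mon (F : Type) [Field F] [Finite F] (N : ℕ) : Finset F[X] := (finite_monic (F := F) N).toFinset

theorem mem_mon (N : ℕ) (h : F[X]) : h ∈ mon F N ↔ h.Monic ∧ h.natDegree = N := by
  simp [mon]

/-- The characteristic polynomial of `x` over `F`, as a power of its minimal polynomial. -/
noncomputable def cp (F : Type) [Field F] {E : Type} [Field E] [Algebra F E] (x : E) : F[X] :=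
  minpoly F x ^ (Module.finrank F E / (minpoly F x).natDegree)

variable {E : Type} [Field E] [Finite E] [Algebra F E]

theorem cp_monic (x : E) : (cp F x).Monic := by
  have : FiniteDimensional F E := Module.Finite.of_finite
  exact (minpoly.monic (Algebra.IsIntegral.isIntegral x)).pow _

theorem minpoly_dvd_fr (x : E) : (minpoly F x).natDegree ∣ Module.finrank F E := by
  have : FiniteDimensional F E := Module.Finite.of_finite
  exact minpoly.degree_dvd (Algebra.IsIntegral.isIntegral x)

theorem cp_natDegree (x : E) : (cp F x).natDegree = Module.finrank F E := by
  rw [cp, natDegree_pow, Nat.div_mul_cancel (minpoly_dvd_fr x)]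

theorem card_minpoly_eq (P : F[X]) (hP : P.Monic) (hirr : Irreducible P) :
    Nat.card {x : E // minpoly F x = P} = if P.natDegree ∣ Module.finrank F E then P.natDegree else 0 := by
  classical
  have : FiniteDimensional F E := Module.Finite.of_finite
  have hIntg : ∀ x : E, IsIntegral F x := fun x => Algebra.IsIntegral.isIntegral x
  have hc : Nat.card E = Nat.card F ^ Module.finrank F E := Module.natCard_eq_pow_finrank
  split_ifs with hdvd
  · have h1 := (hirr.natDegree_dvd_iff_dvd_X_pow_card_pow_sub_X).1 hdvd
    rw [← hc] at h1
    have hsplit : (P.map (algebraMap F E)).Splits := by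
      have := Fintype.ofFinite E
      refine Splits.of_dvd ?_ ?_ (map_dvd (algebraMap F E) h1)
      · have := FiniteField.isSplittingField_sub E F
        rw [Fintype.card_eq_nat_card] at this
        exact this.splits
      · apply Polynomial.map_ne_zero
        exact FiniteField.X_pow_card_sub_X_ne_zero _ (Finite.one_lt_card)
    have h2 := card_rootSet_eq_natDegree (PerfectField.separable_of_irreducible hirr) hsplit
    rw [← h2, ← Nat.card_eq_fintype_card]
    apply Nat.card_congr
    refine Equiv.subtypeEquivRight fun x => ?_
    rw [mem_rootSet]
    constructor
    · rintro rfl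
      exact ⟨minpoly.ne_zero (hIntg x), minpoly.aeval _ _⟩
    · rintro ⟨_, h⟩
      exact (minpoly.eq_of_irreducible_of_monic hirr h hP).symm
  · rw [Nat.card_eq_zero]
    left
    constructor
    rintro ⟨x, rfl⟩
    exact hdvd (minpoly_dvd_fr x)

theorem card_cp_dvd (h : F[X]) (hm : h.Monic) [DecidableEq F] :
    Nat.card {x : E // cp F x ∣ h} = ∑ P ∈ (normalizedFactors h).toFinset,
      if P.natDegree ∣ Module.finrank F E ∧ Module.finrank F E ≤ (normalizedFactors h).count P * P.natDegree then
        P.natDegree else 0 := by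
  classical
  have : FiniteDimensional F E := Module.Finite.of_finite
  have hIntg : ∀ x : E, IsIntegral F x := fun x => Algebra.IsIntegral.isIntegral x
  have hfr : 0 < Module.finrank F E := Module.finrank_pos
  have := Fintype.ofFinite E
  have hfac : ∀ P, P ∈ (normalizedFactors h).toFinset ↔ Irreducible P ∧ P.Monic ∧ P ∣ h := by
    intro P
    rw [Multiset.mem_toFinset, Polynomial.mem_normalizedFactors_iff hm.ne_zero]
  have hkey : ∀ x : E, cp F x ∣ h ↔ minpoly F x ∈ (normalizedFactors h).toFinset ∧
      Module.finrank F E ≤ (normalizedFactors h).count (minpoly F x) * (minpoly F x).natDegree := by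
    intro x
    have hmon := minpoly.monic (hIntg x)
    have hirr := minpoly.irreducible (hIntg x)
    obtain ⟨j, hj⟩ := minpoly_dvd_fr (F := F) x
    have hd0 : 0 < (minpoly F x).natDegree := minpoly.natDegree_pos (hIntg x)
    have hcount : minpoly F x ^ j ∣ h ↔ j ≤ (normalizedFactors h).count (minpoly F x) := by
      rw [pow_dvd_iff_le_emultiplicity, emultiplicity_eq_count_normalizedFactors hirr hm.ne_zero,
        hmon.normalize_eq_self]
      exact_mod_cast Iff.rfl
    have hj0 : j ≠ 0 := by rintro rfl; omega
    rw [cp, hj, Nat.mul_div_cancel_left _ hd0, hcount, mul_comm _ j, mul_le_mul_iff_left₀ hd0, hfac]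
    constructor
    · intro hle
      refine ⟨⟨hirr, hmon, ?_⟩, hle⟩
      exact (dvd_pow_self _ hj0).trans (hcount.2 hle)
    · exact fun h => h.2
  rw [Nat.card_eq_fintype_card, Fintype.card_subtype]
  have h1 : (Finset.univ.filter fun x : E => cp F x ∣ h) =
      ((normalizedFactors h).toFinset.filter fun P => Module.finrank F E ≤ (normalizedFactors h).count P * P.natDegree).biUnion
        fun P => Finset.univ.filter fun x : E => minpoly F x = P := by
    ext x
    simp [hkey]
  rw [h1, Finset.card_biUnion, Finset.sum_filter]
  · refine Finset.sum_congr rfl fun P hP => ?_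
    obtain ⟨hi, hmo, _⟩ := (hfac P).1 hP
    have := card_minpoly_eq (E := E) P hmo hi
    rw [Nat.card_eq_fintype_card, Fintype.card_subtype] at this
    rw [this]
    split_ifs <;> simp_all
  · intro P _ P' _ hne
    rw [Function.onFun, Finset.disjoint_left]
    intro x hx hx'
    simp at hx hx'
    exact hne (hx.symm.trans hx')
end
section
variable {F : Type} [Field F] [Finite F] (p : ℕ) [Fact p.Prime] [CharP F p]

theorem count_cp (N : ℕ) (h : F[X]) (hh : h ∈ mon F N) :
    ∑ i ∈ Finset.range N, Nat.card {x : FiniteField.Extension F p (i + 1) // cp F x ∣ h} = N := by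
  classical
  obtain ⟨hm, hN⟩ := (mem_mon N h).1 hh
  simp only [card_cp_dvd h hm, FiniteField.finrank_extension]
  rw [Finset.sum_comm]
  have hprod : (normalizedFactors h).prod = h := by
    have := prod_normalizedFactors_eq (a := h) hm.ne_zero
    rwa [hm.normalize_eq_self] at this
  have hfac : ∀ P, P ∈ (normalizedFactors h) ↔ Irreducible P ∧ P.Monic ∧ P ∣ h := by
    intro P
    rw [Polynomial.mem_normalizedFactors_iff hm.ne_zero]
  have hdeg : N = ∑ P ∈ (normalizedFactors h).toFinset, (normalizedFactors h).count P * P.natDegree := by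
    rw [← hN]
    conv_lhs => rw [← hprod]
    rw [natDegree_multiset_prod_of_monic]
    · rw [Finset.sum_multiset_map_count]; simp
    · intro P hP; exact ((hfac P).1 hP).2.1
  conv_rhs => rw [hdeg]
  refine Finset.sum_congr rfl fun P hP => ?_
  have hP0 : 0 < P.natDegree := ((hfac P).1 (Multiset.mem_toFinset.1 hP)).1.natDegree_pos
  have hle : (normalizedFactors h).count P * P.natDegree ≤ N := by
    conv_rhs => rw [hdeg]
    exact Finset.single_le_sum (f := fun P => (normalizedFactors h).count P * P.natDegree) (fun _ _ => Nat.zero_le _) hP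
  set m := P.natDegree
  set v := (normalizedFactors h).count P
  rw [← Finset.sum_filter, Finset.sum_const, smul_eq_mul]
  congr 1
  have : (Finset.range N).filter (fun i => m ∣ i + 1 ∧ i + 1 ≤ v * m) = (Finset.range v).image (fun j => (j + 1) * m - 1) := by
    ext i
    simp only [Finset.mem_filter, Finset.mem_range, Finset.mem_image]
    constructor
    · rintro ⟨h1, ⟨j, hj⟩, h3⟩
      refine ⟨j - 1, ?_, ?_⟩
      · rw [hj, mul_comm] at h3
        have := le_of_mul_le_mul_right h3 hP0
        have : j ≠ 0 := by rintro rfl; simp at hj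
        omega
      · have : j ≠ 0 := by rintro rfl; simp at hj
        rw [Nat.sub_add_cancel (by omega), mul_comm, ← hj]; simp
    · rintro ⟨j, hj, rfl⟩
      have h1 : 0 < (j + 1) * m := by positivity
      rw [Nat.sub_add_cancel h1]
      have h2 : (j + 1) * m ≤ v * m := Nat.mul_le_mul_right _ hj
      exact ⟨by omega, dvd_mul_left _ _, h2⟩
  rw [this, Finset.card_image_of_injOn, Finset.card_range]
  intro a _ b _ hab
  simp only at hab
  have h1 : 0 < (a + 1) * m := by positivity
  have h2 : 0 < (b + 1) * m := by positivity
  have h3 : (a + 1) * m = (b + 1) * m := by omega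
  have := Nat.eq_of_mul_eq_mul_right hP0 h3
  omega

/-- Newton-type identity for a completely multiplicative function on monic polynomials. -/
theorem newton_id (lam : F[X] → ℂ) (hmul : ∀ g h : F[X], g.Monic → h.Monic → lam (g * h) = lam g * lam h) (N : ℕ) :
    (N : ℂ) * ∑ h ∈ mon F N, lam h = ∑ i ∈ Finset.range N,
      (∑ᶠ x : FiniteField.Extension F p (i + 1), lam (cp F x)) * ∑ h ∈ mon F (N - 1 - i), lam h := by
  classical
  have h1 : (N : ℂ) * ∑ h ∈ mon F N, lam h =
      ∑ h ∈ mon F N, ∑ i ∈ Finset.range N, (Nat.card {x : FiniteField.Extension F p (i + 1) // cp F x ∣ h} : ℂ) * lam h := by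
    rw [Finset.mul_sum]
    refine Finset.sum_congr rfl fun h hh => ?_
    rw [← Finset.sum_mul, ← Nat.cast_sum, count_cp p N h hh]
  rw [h1, Finset.sum_comm]
  refine Finset.sum_congr rfl fun i hi => ?_
  rw [Finset.mem_range] at hi
  have := Fintype.ofFinite (FiniteField.Extension F p (i + 1))
  rw [finsum_eq_sum_of_fintype, Finset.sum_mul]
  have h2 : ∀ h, (Nat.card {x : FiniteField.Extension F p (i + 1) // cp F x ∣ h} : ℂ) * lam h =
      ∑ x : FiniteField.Extension F p (i + 1), if cp F x ∣ h then lam h else 0 := by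
    intro h
    rw [Nat.card_eq_fintype_card, Fintype.card_subtype, ← Finset.sum_filter, Finset.sum_const, nsmul_eq_mul]
  simp only [h2]
  rw [Finset.sum_comm]
  refine Finset.sum_congr rfl fun x _ => ?_
  rw [← Finset.sum_filter, Finset.mul_sum]
  symm
  have hdeg : (cp F x).natDegree = i + 1 := by rw [cp_natDegree, FiniteField.finrank_extension]
  have hmon := cp_monic (F := F) x
  refine Finset.sum_bij (fun h _ => cp F x * h) ?_ ?_ ?_ ?_
  · intro h hh
    rw [mem_mon] at hh
    rw [Finset.mem_filter, mem_mon]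
    refine ⟨⟨hmon.mul hh.1, ?_⟩, dvd_mul_right _ _⟩
    rw [hmon.natDegree_mul hh.1, hdeg, hh.2]; omega
  · intro a _ b _ hab
    exact mul_left_cancel₀ hmon.ne_zero hab
  · intro h hh
    rw [Finset.mem_filter, mem_mon] at hh
    obtain ⟨⟨h1, h2⟩, g, hg⟩ := hh
    have hgm : g.Monic := hmon.of_mul_monic_left (hg ▸ h1)
    refine ⟨g, ?_, hg.symm⟩
    rw [mem_mon]
    refine ⟨hgm, ?_⟩
    rw [hg, hmon.natDegree_mul hgm, hdeg] at h2
    omega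
  · intro h hh
    rw [mem_mon] at hh
    rw [hmul _ _ hmon hh.1]
end
end S12
end

section
open Polynomial
namespace S12
set_option linter.unusedSectionVars false
section
variable {F : Type} [Field F] [Finite F]

theorem res_roots (h G : F[X]) : algebraMap F (AlgebraicClosure F) (resultant h G) =
    (-1)^(h.natDegree*G.natDegree) * (algebraMap F (AlgebraicClosure F) G.leadingCoeff)^h.natDegree *
      ((G.aroots (AlgebraicClosure F)).map (fun β => aeval β h)).prod := by
  rw [← resultant_map_map, resultant_comm]
  have := resultant_eq_prod_eval (G.map (algebraMap F (AlgebraicClosure F))) (h.map (algebraMap F (AlgebraicClosure F)))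
    h.natDegree (by simp) (IsAlgClosed.splits _)
  rw [natDegree_map] at this
  rw [this, leadingCoeff_map, ← mul_assoc]
  simp [aroots, aeval_def, eval_map]

theorem res_mul (g h G : F[X]) (hg : g.Monic) (hh : h.Monic) : resultant (g*h) G = resultant g G * resultant h G := by
  rw [hg.natDegree_mul hh]
  exact resultant_mul_left g h G _ le_rfl

theorem res_pow (g : F[X]) (hg : g.Monic) (G : F[X]) (k : ℕ) : resultant (g^k) G = resultant g G ^ k := by
  induction k with
  | zero => simp
  | succ k ih => rw [pow_succ, res_mul _ _ _ (hg.pow k) hg, ih, pow_succ]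

variable {E : Type} [Field E] [Finite E] [Algebra F E]

theorem res_cp (x : E) (G : F[X]) : resultant (cp F x) G = Algebra.norm F (aeval x G) := by
  classical
  have : FiniteDimensional F E := Module.Finite.of_finite
  set K := IntermediateField.adjoin F {x} with hK
  have hx : IsIntegral F x := Algebra.IsIntegral.isIntegral x
  set y : K := aeval (IntermediateField.AdjoinSimple.gen F x) G with hy
  have hyx : algebraMap K E y = aeval x G := by
    rw [hy, ← aeval_algebraMap_apply, IntermediateField.AdjoinSimple.algebraMap_gen]
  rw [← hyx, ← Algebra.norm_norm (R := F) (S := K), Algebra.norm_algebraMap, map_pow]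
  have hfin : Module.finrank F E / (minpoly F x).natDegree = Module.finrank K E := by
    rw [← IntermediateField.adjoin.finrank hx, ← Module.finrank_mul_finrank F K E]
    exact Nat.mul_div_cancel_left _ Module.finrank_pos
  have h1 : resultant (minpoly F x) G = Algebra.norm F y := by
    apply (algebraMap F (AlgebraicClosure F)).injective
    rw [Algebra.norm_eq_prod_embeddings, ← resultant_map_map]
    have := resultant_eq_prod_eval ((minpoly F x).map (algebraMap F (AlgebraicClosure F))) (G.map (algebraMap F (AlgebraicClosure F)))
      G.natDegree (by simp) (IsAlgClosed.splits _)
    rw [natDegree_map] at this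
    rw [this, leadingCoeff_map, (minpoly.monic hx).leadingCoeff, map_one, one_pow, one_mul]
    have e := IntermediateField.algHomAdjoinIntegralEquiv (K := AlgebraicClosure F) F hx
    have hnd : ((minpoly F x).aroots (AlgebraicClosure F)).Nodup := by
      apply nodup_roots
      apply Separable.map
      exact Algebra.IsSeparable.isSeparable F x
    have h2 : ∀ σ : K →ₐ[F] AlgebraicClosure F, σ y = aeval (σ (IntermediateField.AdjoinSimple.gen F x)) G := by
      intro σ; rw [hy, aeval_algHom_apply]
    simp_rw [h2]
    have h3 := Fintype.prod_equiv (IntermediateField.algHomAdjoinIntegralEquiv (K := AlgebraicClosure F) F hx)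
      (fun σ => aeval (σ (IntermediateField.AdjoinSimple.gen F x)) G) (fun z => aeval z.1 G) (by
        intro σ
        obtain ⟨z, rfl⟩ := (IntermediateField.algHomAdjoinIntegralEquiv (K := AlgebraicClosure F) F hx).symm.surjective σ
        rw [Equiv.apply_symm_apply, IntermediateField.algHomAdjoinIntegralEquiv_symm_apply_gen])
    rw [h3, Finset.prod_mem_multiset (g := fun z => aeval z G) _ _ (fun _ => rfl), Finset.prod_eq_multiset_prod, Multiset.toFinset_val,
      Multiset.dedup_eq_self.mpr hnd]
    simp [aroots, aeval_def, eval_map]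
  rw [← h1, ← hfin, cp]
  exact res_pow _ (minpoly.monic hx) _ _
end
end S12
end

section
open Polynomial
namespace S12
set_option linter.unusedSectionVars false
section
variable {F : Type} [Field F] [Finite F]

/-- The multiplicative function on monic polynomials attached to the two characters. -/
noncomputable def lam (η : MulChar F ℂ) (ψ : AddChar F ℂ) (G h : F[X]) : ℂ :=
  η (resultant h G) * ψ (-h.nextCoeff)

theorem lam_mul (η : MulChar F ℂ) (ψ : AddChar F ℂ) (G g h : F[X]) (hg : g.Monic) (hh : h.Monic) :
    lam η ψ G (g * h) = lam η ψ G g * lam η ψ G h := by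
  rw [lam, lam, lam, res_mul g h G hg hh, hg.nextCoeff_mul hh, neg_add, map_mul, AddChar.map_add_eq_mul]
  ring

variable {E : Type} [Field E] [Finite E] [Algebra F E]

theorem lam_cp (η : MulChar F ℂ) (ψ : AddChar F ℂ) (G : F[X]) (x : E) :
    lam η ψ G (cp F x) = η (Algebra.norm F (aeval x G)) * ψ (Algebra.trace F E x) := by
  have : FiniteDimensional F E := Module.Finite.of_finite
  have hx : IsIntegral F x := Algebra.IsIntegral.isIntegral x
  rw [lam, res_cp, trace_eq_finrank_mul_minpoly_nextCoeff, cp, (minpoly.monic hx).nextCoeff_pow]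
  have hfin : Module.finrank F E / (minpoly F x).natDegree = Module.finrank (IntermediateField.adjoin F {x}) E := by
    rw [← IntermediateField.adjoin.finrank hx, ← Module.finrank_mul_finrank F (IntermediateField.adjoin F {x}) E]
    exact Nat.mul_div_cancel_left _ Module.finrank_pos
  rw [hfin, nsmul_eq_mul, mul_neg]

theorem res_congr (G D h1 h2 : F[X]) 
    (hr : ∀ β : AlgebraicClosure F, aeval β G = 0 → aeval β D = 0) (h : D ∣ h1 - h2)
    (e1 e2 : ℕ) (he1 : h1.natDegree = e1) (he2 : h2.natDegree = e2) :
    resultant h1 G * ((-1)^G.natDegree * G.leadingCoeff)^e2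
      = resultant h2 G * ((-1)^G.natDegree * G.leadingCoeff)^e1 := by
  rw [← he1, ← he2]
  apply (algebraMap F (AlgebraicClosure F)).injective
  have key : (G.aroots (AlgebraicClosure F)).map (fun β => aeval β h1) = (G.aroots (AlgebraicClosure F)).map (fun β => aeval β h2) := by
    apply Multiset.map_congr rfl
    intro β hβ
    have := hr β (by simp at hβ; exact hβ.2)
    obtain ⟨w, hw⟩ := h
    rw [← sub_eq_zero, ← map_sub, hw, map_mul, this, zero_mul]
  rw [map_mul, map_mul, res_roots, res_roots, key]
  simp only [map_pow, map_mul, map_neg, map_one, mul_pow, mul_comm h1.natDegree, mul_comm h2.natDegree, pow_mul]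
  ring

theorem vanish_add (η : MulChar F ℂ) (ψ : AddChar F ℂ) (G D : F[X]) (hG : G ≠ 0) (hD : D.Monic)
    (hr : ∀ β : AlgebraicClosure F, aeval β G = 0 → aeval β D = 0) (hψ : ψ ≠ 1) (N : ℕ) (hN : D.natDegree + 1 ≤ N) :
    ∑ h ∈ mon F N, lam η ψ G h = 0 := by
  obtain ⟨c, hc⟩ := AddChar.ne_one_iff.mp hψ
  have hdeg : (X^(N-1-D.natDegree) * D).natDegree = N - 1 := by
    rw [(monic_X_pow _).natDegree_mul hD, natDegree_X_pow]; omega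
  have hmon : (X^(N-1-D.natDegree) * D).Monic := (monic_X_pow _).mul hD
  have hdeg2 : ∀ c : F, (C c * (X^(N-1-D.natDegree) * D)).natDegree < N := by
    intro c
    refine lt_of_le_of_lt (natDegree_C_mul_le _ _) (by omega)
  have hmem : ∀ c : F, ∀ h ∈ mon F N, h + C c * (X^(N-1-D.natDegree) * D) ∈ mon F N := by
    intro c h hh
    rw [mem_mon] at hh ⊢
    have hlt : (C c * (X^(N-1-D.natDegree) * D)).natDegree < h.natDegree := by rw [hh.2]; exact hdeg2 c
    have hlt' := degree_lt_degree hlt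
    exact ⟨hh.1.add_of_left hlt', by rw [natDegree_add_eq_left_of_natDegree_lt hlt]; exact hh.2⟩
  have hκ : ((-1)^G.natDegree * G.leadingCoeff)^N ≠ 0 := by
    apply pow_ne_zero; apply mul_ne_zero
    · exact pow_ne_zero _ (by simp)
    · simpa using hG
  have hval : ∀ h ∈ mon F N, lam η ψ G (h + C (-c) * (X^(N-1-D.natDegree) * D)) = ψ c * lam η ψ G h := by
    intro h hh
    have h1 := hmem (-c) h hh
    rw [mem_mon] at h1 hh
    have h2 := res_congr G D (h + C (-c) * (X^(N-1-D.natDegree) * D)) h hr ⟨C (-c) * X^(N-1-D.natDegree), by ring⟩ N N h1.2 hh.2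
    have h3 := mul_right_cancel₀ hκ h2
    have h4 : (h + C (-c) * (X^(N-1-D.natDegree) * D)).nextCoeff = h.nextCoeff - c := by
      rw [nextCoeff_of_natDegree_pos (by omega), nextCoeff_of_natDegree_pos (by omega), h1.2, hh.2, coeff_add, coeff_C_mul]
      have := hmon.coeff_natDegree
      rw [hdeg] at this
      rw [this]; ring
    rw [lam, lam, h3, h4, neg_sub, sub_eq_add_neg, AddChar.map_add_eq_mul]
    ring
  have hsum : ∑ h ∈ mon F N, lam η ψ G (h + C (-c) * (X^(N-1-D.natDegree) * D)) = ∑ h ∈ mon F N, lam η ψ G h := by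
    refine Finset.sum_nbij' (fun h => h + C (-c) * (X^(N-1-D.natDegree) * D)) (fun h => h + C (c) * (X^(N-1-D.natDegree) * D)) (hmem _) (hmem _) ?_ ?_ ?_
    · intro h _; simp
    · intro h _; simp
    · intro h _; rfl
  rw [Finset.sum_congr rfl hval, ← Finset.mul_sum] at hsum
  have : (ψ c - 1) * ∑ h ∈ mon F N, lam η ψ G h = 0 := by rw [sub_mul, hsum]; ring
  exact (mul_eq_zero.mp this).resolve_left (sub_ne_zero.mpr hc)

theorem vanish_mul (η : MulChar F ℂ) (G D : F[X]) (hG : G ≠ 0) (hD : D.Monic)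
    (hr : ∀ β : AlgebraicClosure F, aeval β G = 0 → aeval β D = 0) 
    (h0 : F[X]) (hm0 : h0.Monic) (hc : IsCoprime h0 D)
    (hne : η (resultant h0 G) ≠ η ((-1)^G.natDegree * G.leadingCoeff) ^ h0.natDegree)
    (N : ℕ) (hN : D.natDegree ≤ N) :
    ∑ h ∈ mon F N, lam η 1 G h = 0 := by
  obtain ⟨v, w, hvw⟩ := hc
  set κ := ((-1)^G.natDegree * G.leadingCoeff) with hκd
  have hκ : κ ≠ 0 := by
    apply mul_ne_zero
    · exact pow_ne_zero _ (by simp)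
    · simpa using hG
  set T : F[X] → F[X] → F[X] := fun u h => h + ((u * h) %ₘ D - h %ₘ D) with hT
  have hTd : ∀ u h, D ∣ T u h - u * h := by
    intro u h
    have e1 := modByMonic_add_div (u*h) D
    have e2 := modByMonic_add_div h D
    refine ⟨h /ₘ D - (u*h) /ₘ D, ?_⟩
    rw [hT]
    linear_combination e1 - e2
  have hTT : ∀ u v h, D ∣ u * v - 1 → T u (T v h) = h := by
    intro u v h huv
    have e1 : (u * T v h) %ₘ D = h %ₘ D := by
      rw [← sub_eq_zero, ← sub_modByMonic, modByMonic_eq_zero_iff_dvd hD]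
      have := (hTd v h).mul_left u
      have h2 := huv.mul_right h
      have h3 := dvd_add this h2
      convert h3 using 1; ring
    have e2 : (T v h) %ₘ D = (v * h) %ₘ D := by
      rw [← sub_eq_zero, ← sub_modByMonic, modByMonic_eq_zero_iff_dvd hD]
      exact hTd v h
    change T v h + ((u * T v h) %ₘ D - (T v h) %ₘ D) = h
    rw [e1, e2]
    simp only [hT]; ring
  have hmem : ∀ u, ∀ h ∈ mon F N, T u h ∈ mon F N := by
    intro u h hh
    rw [mem_mon] at hh ⊢
    have hlt : ((u * h) %ₘ D - h %ₘ D).degree < h.degree := by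
      have hDN : D.degree ≤ h.degree := by
        rw [degree_eq_natDegree hh.1.ne_zero, degree_eq_natDegree hD.ne_zero, hh.2]; exact_mod_cast hN
      refine lt_of_lt_of_le (lt_of_le_of_lt (degree_sub_le _ _) ?_) hDN
      exact max_lt (degree_modByMonic_lt _ hD) (degree_modByMonic_lt _ hD)
    exact ⟨hh.1.add_of_left hlt, by rw [hT]; rw [natDegree_add_eq_left_of_degree_lt hlt]; exact hh.2⟩
  have hval : ∀ h ∈ mon F N, η κ ^ h0.natDegree * lam η 1 G (T h0 h) = η (resultant h0 G) * lam η 1 G h := by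
    intro h hh
    have h1 := hmem h0 h hh
    rw [mem_mon] at h1 hh
    have h2 := res_congr G D _ _ hr (hTd h0 h) N (h0.natDegree + N) h1.2 (by rw [hm0.natDegree_mul hh.1, hh.2])
    rw [res_mul _ _ _ hm0 hh.1, pow_add, ← mul_assoc] at h2
    have h3 := mul_right_cancel₀ (pow_ne_zero _ hκ) h2
    simp only [lam, AddChar.one_apply, mul_one]
    rw [← map_pow, ← map_mul, ← map_mul, ← h3, mul_comm]
  have hsum : ∑ h ∈ mon F N, lam η 1 G (T h0 h) = ∑ h ∈ mon F N, lam η 1 G h := by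
    refine Finset.sum_nbij' (fun h => T h0 h) (fun h => T v h) (hmem _) (hmem _) ?_ ?_ ?_
    · intro h _; exact hTT _ _ _ ⟨-w, by linear_combination hvw⟩
    · intro h _; exact hTT _ _ _ ⟨-w, by linear_combination hvw⟩
    · intro h _; rfl
  have h5 := Finset.sum_congr rfl hval
  rw [← Finset.mul_sum, ← Finset.mul_sum, hsum] at h5
  have : (η (resultant h0 G) - η κ ^ h0.natDegree) * ∑ h ∈ mon F N, lam η 1 G h = 0 := by rw [sub_mul, h5]; ring
  exact (mul_eq_zero.mp this).resolve_left (sub_ne_zero.mpr hne)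
end
end S12
end

section
open Polynomial
namespace S12
section

/-- Product of the linear factors `1 - w X`. -/
noncomputable def pw (ω : Multiset ℂ) : PowerSeries ℂ :=
  (ω.map (fun w => 1 - PowerSeries.C w * PowerSeries.X)).prod

/-- The power sum series. -/
noncomputable def tw (ω : Multiset ℂ) : PowerSeries ℂ :=
  PowerSeries.mk (fun k => - (ω.map (fun w => w^(k+1))).sum)

theorem pw_deriv (ω : Multiset ℂ) : PowerSeries.derivative ℂ (pw ω) = tw ω * pw ω := by
  induction ω using Multiset.induction with
  | empty => 
    have : tw 0 = 0 := by ext; simp [tw]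
    simp [pw, this]
  | cons a ω ih => 
    have h1 : pw (a ::ₘ ω) = (1 - PowerSeries.C a * PowerSeries.X) * pw ω := by simp [pw]
    have h2 : tw (a ::ₘ ω) = tw {a} + tw ω := by ext; simp [tw]; ring
    have h3 : tw {a} * (1 - PowerSeries.C a * PowerSeries.X) = - PowerSeries.C a := by
      ext n
      rw [mul_sub, mul_one, ← mul_assoc]
      cases n with
      | zero => simp [tw]
      | succ n => 
        rw [map_sub, PowerSeries.coeff_succ_mul_X, PowerSeries.coeff_mul_C]
        simp [tw]; ring
    have h4 : PowerSeries.derivative ℂ (1 - PowerSeries.C a * PowerSeries.X) = - PowerSeries.C a := by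
      rw [map_sub, Derivation.leibniz]
      simp
    rw [h1, h2, Derivation.leibniz, ih, h4, smul_eq_mul, smul_eq_mul, ← h3]
    ring

theorem powersum_repr (m : ℕ) (s S : ℕ → ℂ) (h0 : s 0 = 1) (h7 : ∀ N, m < N → s N = 0)
    (hrec : ∀ N : ℕ, (N : ℂ) * s N = ∑ i ∈ Finset.range N, S (i+1) * s (N-1-i)) :
    ∃ ω : Multiset ℂ, Multiset.card ω ≤ m ∧ ∀ k, 1 ≤ k → S k = - (ω.map (fun w => w^k)).sum := by
  classical
  set P : ℂ[X] := ∑ i ∈ Finset.range (m+1), C (s i) * X^i with hP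
  have hcoef : ∀ N, P.coeff N = s N := by
    intro N
    rw [hP, finsetSum_coeff]
    simp only [coeff_C_mul, coeff_X_pow]
    by_cases hN : m < N
    · rw [h7 N hN]
      apply Finset.sum_eq_zero
      intro i hi
      rw [Finset.mem_range] at hi
      rw [if_neg (by omega), mul_zero]
    · rw [Finset.sum_eq_single N]
      · simp
      · intro b _ hb; rw [if_neg (Ne.symm hb), mul_zero]
      · intro h; exact absurd (Finset.mem_range.mpr (by omega)) h
  have hdeg : P.natDegree ≤ m := by
    rw [natDegree_le_iff_coeff_eq_zero]
    intro N hN; rw [hcoef]; exact h7 N hN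
  have hP0 : P ≠ 0 := by
    intro h; have := hcoef 0; rw [h, h0] at this; simp at this
  have hsplit := (IsAlgClosed.splits P).eq_prod_roots
  have hr0 : ∀ ρ ∈ P.roots, ρ ≠ 0 := by
    intro ρ hρ h
    rw [mem_roots hP0, IsRoot, h, ← coeff_zero_eq_eval_zero, hcoef, h0] at hρ
    exact one_ne_zero hρ
  refine ⟨P.roots.map (fun ρ => ρ⁻¹), by rw [Multiset.card_map]; exact (card_roots' P).trans hdeg, ?_⟩
  set ω := P.roots.map (fun ρ => ρ⁻¹) with hω
  have hprod : P = (ω.map (fun w => 1 - C w * X)).prod := by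
    have e1 : 1 = P.leadingCoeff * (P.roots.map (fun ρ => -ρ)).prod := by
      have := congrArg (eval 0) hsplit
      rw [← coeff_zero_eq_eval_zero, hcoef, h0, eval_mul, eval_C, eval_multiset_prod, Multiset.map_map] at this
      simpa using this
    have e2 : (P.roots.map (fun ρ => X - C ρ)).prod = C ((P.roots.map (fun ρ => -ρ)).prod) * (ω.map (fun w => 1 - C w * X)).prod := by
      rw [hω, Multiset.map_map, ← Multiset.prod_hom _ (C : ℂ →+* ℂ[X]), Multiset.map_map, ← Multiset.prod_map_mul]
      congr 1
      apply Multiset.map_congr rfl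
      intro ρ hρ
      have : C ρ * C ρ⁻¹ = (1 : ℂ[X]) := by rw [← C_mul, mul_inv_cancel₀ (hr0 ρ hρ), C_1]
      simp only [Function.comp, C_neg]
      linear_combination (- X) * this
    conv_lhs => rw [hsplit, e2, ← mul_assoc, ← C_mul, ← e1, C_1, one_mul]
  have hps : (P : PowerSeries ℂ) = pw ω := by
    rw [hprod, pw, ← Polynomial.coeToPowerSeries.ringHom_apply, map_multiset_prod, Multiset.map_map]
    congr 1
    apply Multiset.map_congr rfl
    intro w _
    simp
  have hd := pw_deriv ω
  rw [← hps] at hd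
  have hd' : ∀ n : ℕ, s (n+1) * (n+1) = ∑ i ∈ Finset.range (n+1), (- (ω.map (fun w => w^(i+1))).sum) * s (n-i) := by
    intro n
    have := congrArg (PowerSeries.coeff n) hd
    rw [PowerSeries.coeff_mul, Finset.Nat.sum_antidiagonal_eq_sum_range_succ_mk] at this
    simp only [PowerSeries.derivative_coe, Polynomial.coeff_coe, coeff_derivative, hcoef, tw, PowerSeries.coeff_mk] at this
    exact this
  intro k
  induction k using Nat.strong_induction_on with
  | _ k ih =>
  intro hk
  obtain ⟨n, rfl⟩ : ∃ n, k = n+1 := ⟨k-1, by omega⟩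
  have a1 := hd' n
  have a2 := hrec (n+1)
  push_cast at a2
  rw [mul_comm, a1, Finset.sum_range_succ, Finset.sum_range_succ] at a2
  simp only [Nat.sub_self, h0, mul_one] at a2
  have a3 : ∑ i ∈ Finset.range n, (- (ω.map (fun w => w^(i+1))).sum) * s (n-i) = ∑ i ∈ Finset.range n, S (i+1) * s (n-i) := by
    apply Finset.sum_congr rfl
    intro i hi
    rw [Finset.mem_range] at hi
    rw [ih (i+1) (by omega) (by omega)]
  rw [a3] at a2
  exact (add_left_cancel a2).symm

theorem powersum_bound (ω : Multiset ℂ) (R C : ℝ) (hR : 0 < R) (J : ℕ)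
    (h : ∀ j, J ≤ j → ‖(ω.map (fun w => w^(2*j))).sum‖ ≤ C * (R^2)^j) : ∀ w ∈ ω, ‖w‖ ≤ R := by
  by_contra hcon
  push Not at hcon
  obtain ⟨w0, hw0, hgt⟩ := hcon
  set l := ω.toList with hl
  have hωl : ω = (l : Multiset ℂ) := by simp [hl]
  have hsum : ∀ j, (ω.map (fun w => w^j)).sum = ∑ i : Fin l.length, (l.get i)^j := by
    intro j
    rw [hωl, Multiset.map_coe, Multiset.sum_coe, ← List.sum_ofFn]
    congr 1
    apply List.ext_get <;> simp
  obtain ⟨i0, hi0⟩ : ∃ i, l.get i = w0 := by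
    rw [hωl, Multiset.mem_coe] at hw0
    exact List.get_of_mem hw0
  -- the arguments
  have hu : ∀ w : ℂ, ∃ u : Circle, w = ‖w‖ * (u : ℂ) := by
    intro w
    refine ⟨Circle.exp w.arg, ?_⟩
    rw [Circle.coe_exp]; exact (Complex.norm_mul_exp_arg_mul_I w).symm
  choose u hu using hu
  have hcl := mapClusterPt_one_atTop_pow (fun i : Fin l.length => u (l.get i))
  have hnhds : {v : Fin l.length → Circle | ∀ i, 1/2 < ((v i)^2 : ℂ).re} ∈ nhds (1 : Fin l.length → Circle) := by
    apply IsOpen.mem_nhds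
    · rw [Set.ofPred_forall]
      apply isOpen_iInter_of_finite
      intro i
      apply isOpen_lt continuous_const
      fun_prop
    · intro i; simp; norm_num
  have hfreq := hcl.frequently hnhds
  have hgrow : ∃ J2, ∀ j, J2 ≤ j → C * (R^2)^j < 1/2 * (‖w0‖^2)^j := by
    have hlt : 1 < ‖w0‖^2 / R^2 := by
      rw [one_lt_div (by positivity)]; gcongr
    obtain ⟨J2, hJ2⟩ := pow_unbounded_of_one_lt (2*C) hlt
    refine ⟨J2, fun j hj => ?_⟩
    have h3 : 2*C < (‖w0‖^2/R^2)^j := lt_of_lt_of_le hJ2 (pow_le_pow_right₀ hlt.le hj)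
    rw [div_pow, lt_div_iff₀ (by positivity)] at h3
    linarith
  obtain ⟨J2, hJ2⟩ := hgrow
  obtain ⟨j, hj, hv⟩ := (Filter.frequently_atTop.mp hfreq) (max J J2)
  have hb := h j (le_trans (le_max_left _ _) hj)
  have hb2 := hJ2 j (le_trans (le_max_right _ _) hj)
  have hre : 1/2 * (‖w0‖^2)^j ≤ ((ω.map (fun w => w^(2*j))).sum).re := by
    rw [hsum, Complex.re_sum]
    have hterm : ∀ i, 1/2 * (‖l.get i‖^2)^j ≤ ((l.get i)^(2*j)).re := by
      intro i
      have e1 : (l.get i)^(2*j) = ((‖l.get i‖^(2*j) : ℝ) : ℂ) * (((u (l.get i) : ℂ)^j)^2) := by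
        conv_lhs => rw [hu (l.get i)]
        rw [mul_pow]; push_cast; ring
      rw [e1, Complex.re_ofReal_mul, ← pow_mul, mul_comm]
      have := hv i
      simp at this
      gcongr
      have h9 := this.le
      norm_num at h9 ⊢
      exact h9
    rw [← hi0]
    refine (hterm i0).trans (Finset.single_le_sum (f := fun i => ((l.get i)^(2*j)).re) (fun i _ => ?_) (Finset.mem_univ i0))
    exact le_trans (by positivity) (hterm i)
  have := (Complex.re_le_norm ((ω.map (fun w => w^(2*j))).sum))
  linarith
end
end S12
end

section
open Polynomial
namespace S12
set_option linter.unusedSectionVars false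
section

theorem as_sum {E : Type} [Field E] [Fintype E] (p : ℕ) [Fact p.Prime] [CharP E p] (Ψ : AddChar E ℂ) (hΨ : Ψ ≠ 1) :
    ∃ u : E, u ≠ 0 ∧ ∀ g : E → ℂ, ∑ z, g (u * (z^p - z)) = ∑ x, g x * ∑ c ∈ Finset.range p, Ψ x ^ c := by
  classical
  have hp := (Fact.out : p.Prime)
  let f : E →+ E := 
    { toFun := fun z => z^p - z
      map_zero' := by simp [hp.ne_zero]
      map_add' := by intro a b; rw [add_pow_char]; ring }
  have hf : ∀ z, f z = z^p - z := fun z => rfl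
  have hns : ¬ Function.Surjective f := by
    intro h
    have := Finite.injective_iff_surjective.mpr h
    exact zero_ne_one (this (a₁ := 0) (a₂ := 1) (by simp [hf, hp.ne_zero]))
  obtain ⟨y0, hy0⟩ : ∃ y, y ∉ f.range := by
    by_contra h; push Not at h
    exact hns (fun y => by simpa using h y)
  obtain ⟨Ψ0, hΨ0⟩ := (AddChar.exists_apply_ne_zero (a := (QuotientAddGroup.mk y0 : E ⧸ f.range))).mpr
    (by rwa [Ne, QuotientAddGroup.eq_zero_iff])
  let Ψ1 : AddChar E ℂ := Ψ0.compAddMonoidHom (QuotientAddGroup.mk' f.range)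
  have h1 : ∀ z, Ψ1 (f z) = 1 := by
    intro z
    change Ψ0 (QuotientAddGroup.mk (f z)) = 1
    rw [(QuotientAddGroup.eq_zero_iff (N := f.range) (f z)).mpr (AddMonoidHom.mem_range.mpr ⟨z, rfl⟩), AddChar.map_zero_eq_one]
  have hΨ1 : Ψ1 ≠ 1 := AddChar.ne_one_iff.mpr ⟨y0, hΨ0⟩
  have hprim := AddChar.IsPrimitive.of_ne_one hΨ1
  have hroot : ∀ y, Ψ1 y ^ p = 1 := by
    intro y
    rw [← AddChar.map_nsmul_eq_pow]; simp
  -- the shift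
  have hinj := AddChar.to_mulShift_inj_of_isPrimitive hprim
  have hbij : Function.Bijective (Ψ1.mulShift) := by
    rw [Fintype.bijective_iff_injective_and_card]
    exact ⟨hinj, AddChar.card_eq.symm⟩
  obtain ⟨v, hv⟩ := hbij.2 Ψ
  have hv0 : v ≠ 0 := by
    rintro rfl
    apply hΨ; rw [← hv]; ext; simp
  -- counting
  set a : E → ℕ := fun y => (Finset.univ.filter (fun z => f z = y)).card with ha
  set b : E → ℕ := fun y => if Ψ1 y = 1 then p else 0 with hb
  have hbs : ∀ y, (b y : ℂ) = ∑ c ∈ Finset.range p, Ψ1 y ^ c := by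
    intro y
    by_cases h : Ψ1 y = 1
    · simp [hb, h]
    · rw [hb]; simp only [h, if_false]
      rw [geom_sum_eq h, hroot]; simp
  have hab : ∀ y ∈ Finset.univ, a y ≤ b y := by
    intro y _
    by_cases h : Ψ1 y = 1
    · simp only [hb, h, if_true, ha]
      have hne : (X^p - X - C y : E[X]) ≠ 0 := by
        intro h
        have := congrArg (fun q => q.coeff p) h
        simp [coeff_X, coeff_C, hp.one_lt.ne, hp.ne_zero] at this
      have hd : (X^p - X - C y : E[X]).natDegree ≤ p := by
        refine (natDegree_sub_le _ _).trans (max_le ((natDegree_sub_le _ _).trans (max_le (natDegree_X_pow_le p) (natDegree_X_le.trans hp.one_lt.le))) (by simp))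
      have : (Finset.univ.filter (fun z => f z = y)) ⊆ (X^p - X - C y : E[X]).roots.toFinset := by
        intro z hz
        simp only [Finset.mem_filter, hf] at hz
        rw [Multiset.mem_toFinset, mem_roots hne]
        simp [hz.2]
      exact (Finset.card_le_card this).trans ((Multiset.toFinset_card_le _).trans ((card_roots' _).trans hd))
    · simp only [hb, h, if_false, ha]
      rw [Nat.le_zero, Finset.card_eq_zero, Finset.filter_eq_empty_iff]
      rintro z _ rfl
      exact h (h1 z)
  have hsa : ∑ y, a y = Fintype.card E := by
    simp only [ha]
    exact (Finset.card_eq_sum_card_fiberwise (fun _ _ => Finset.mem_coe.mpr (Finset.mem_univ _))).symm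
  have hsb : ∑ y, b y = Fintype.card E := by
    have : ((∑ y, b y : ℕ) : ℂ) = Fintype.card E := by
      push_cast
      simp_rw [hbs]
      rw [Finset.sum_comm, Finset.sum_eq_single 0]
      · simp
      · intro c hc hc0
        have : ∀ y, Ψ1 y ^ c = (Ψ1.mulShift (c : E)) y := by
          intro y; rw [AddChar.mulShift_apply, ← AddChar.map_nsmul_eq_pow, nsmul_eq_mul]
        simp_rw [this]
        apply AddChar.sum_eq_zero_of_ne_one
        apply hprim
        intro h
        rw [CharP.cast_eq_zero_iff E p] at h
        exact hc0 (Nat.eq_zero_of_dvd_of_lt h (Finset.mem_range.mp hc))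
      · intro h; exact absurd (Finset.mem_range.mpr hp.pos) h
    exact_mod_cast this
  have heq := (Finset.sum_eq_sum_iff_of_le hab).mp (hsa.trans hsb.symm)
  refine ⟨v⁻¹, inv_ne_zero hv0, fun g => ?_⟩
  have e1 : ∑ z, g (v⁻¹ * (z^p - z)) = ∑ y, (a y : ℂ) * g (v⁻¹ * y) := by
    rw [← Finset.sum_fiberwise_of_maps_to (g := f) (t := Finset.univ) (fun _ _ => Finset.mem_univ _)]
    apply Finset.sum_congr rfl
    intro y _
    rw [Finset.sum_congr rfl (g := fun _ => g (v⁻¹ * y)), Finset.sum_const, nsmul_eq_mul]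
    intro z hz
    rw [← (Finset.mem_filter.mp hz).2, hf]
  rw [e1, ← Equiv.sum_comp (Equiv.mulLeft₀ v hv0)]
  apply Finset.sum_congr rfl
  intro x _
  change (a (v * x) : ℂ) * g (v⁻¹ * (v * x)) = _
  rw [inv_mul_cancel_left₀ hv0]
  rw [heq _ (Finset.mem_univ _), hbs, ← hv, mul_comm]
  rfl

theorem rootMult_comp {K : Type} [Field K] (G L : K[X]) (hG : G ≠ 0) (v z : K) (hv : v ≠ 0) (hL : derivative L = C v) :
    (G.comp L).rootMultiplicity z = G.rootMultiplicity (L.eval z) := by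
  obtain ⟨H, hH, hnd⟩ := G.exists_eq_pow_rootMultiplicity_mul_and_not_dvd hG (L.eval z)
  set m := G.rootMultiplicity (L.eval z) with hm
  obtain ⟨w, hw⟩ : X - C z ∣ L - C (L.eval z) := by rw [dvd_iff_isRoot]; simp
  have hwz : w.eval z ≠ 0 := by
    have := congrArg (fun q => eval z (derivative q)) hw
    simp [hL] at this
    rwa [← this]
  have hHz : (H.comp L).eval z ≠ 0 := by
    rw [eval_comp]
    rwa [dvd_iff_isRoot, IsRoot] at hnd
  have e : G.comp L = (X - C z)^m * (w^m * H.comp L) := by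
    conv_lhs => rw [hH]
    rw [mul_comp, pow_comp, sub_comp, X_comp, C_comp, hw, mul_pow]; ring
  have hnz : (w^m * H.comp L).eval z ≠ 0 := by
    rw [eval_mul, eval_pow]; exact mul_ne_zero (pow_ne_zero _ hwz) hHz
  have hnz' : w^m * H.comp L ≠ 0 := by rintro h; rw [h] at hnz; simp at hnz
  rw [e, rootMultiplicity_mul (mul_ne_zero (pow_ne_zero _ (X_sub_C_ne_zero z)) hnz'), rootMultiplicity_X_sub_C_pow,
    rootMultiplicity_eq_zero hnz, add_zero]

/-- The lift of a multiplicative character through the norm. -/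
noncomputable def liftChar {F : Type} [Field F] (E : Type) [Field E] [Finite E] [Algebra F E] (η : MulChar F ℂ) : MulChar E ℂ where
  toFun x := η (Algebra.norm F x)
  map_one' := by simp
  map_mul' := by intro a b; simp
  map_nonunit' := by
    intro a ha
    have : a = 0 := by rwa [isUnit_iff_ne_zero, not_not] at ha
    have : FiniteDimensional F E := Module.Finite.of_finite
    subst a
    rw [Algebra.norm_zero, MulChar.map_zero]

theorem liftChar_apply {F : Type} [Field F] (E : Type) [Field E] [Finite E] [Algebra F E] (η : MulChar F ℂ) (x : E) :
    liftChar E η x = η (Algebra.norm F x) := rfl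

theorem liftChar_order {F : Type} [Field F] (E : Type) [Field E] [Finite E] [Algebra F E] (η : MulChar F ℂ) :
    orderOf (liftChar E η) = orderOf η := by
  rw [orderOf_eq_orderOf_iff]
  intro n
  rw [MulChar.eq_one_iff, MulChar.eq_one_iff]
  have hs := FiniteField.unitsMap_norm_surjective F E
  constructor
  · intro h a
    obtain ⟨b, rfl⟩ := hs a
    have := h b
    rw [MulChar.pow_apply_coe, liftChar_apply] at this
    rw [MulChar.pow_apply_coe]; exact this
  · intro h a
    have := h (Units.map (Algebra.norm F) a)
    rw [MulChar.pow_apply_coe] at this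
    rw [MulChar.pow_apply_coe, liftChar_apply]; exact this
end
end S12
end

section
open Polynomial
namespace S12
set_option linter.unusedSectionVars false
section
variable {F : Type} [Field F] [Finite F]

theorem weakE (p : ℕ) [Fact p.Prime] [CharP F p] (η : MulChar F ℂ) (d : ℕ) (hd : orderOf η = d) (hd1 : 1 < d)
    (G : F[X]) (hG : G ≠ 0)
    (hm : ∀ l : ℕ, l.Prime → l ∣ d → ∃ β : AlgebraicClosure F, ¬ l ∣ (G.map (algebraMap F (AlgebraicClosure F))).rootMultiplicity β)
    (E : Type) [Field E] [Fintype E] [Algebra F E] (j M : ℕ) (hE : Fintype.card E = (Nat.card F ^ j)^2)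
    (hJ : (d*M+2*d+1)^2 ≤ j) (L : E[X]) (v : E) (hv : v ≠ 0) (hL : derivative L = C v) (hM : G.natDegree * L.natDegree ≤ M) :
    ‖∑ z : E, η (Algebra.norm F (aeval (L.eval z) G))‖ ≤ (d*(3*M+2)+1+M : ℕ) * (Nat.card F : ℝ)^j := by
  have : CharP E p := charP_of_injective_algebraMap (algebraMap F E).injective p
  set G' := (G.map (algebraMap F E)).comp L with hG'
  have hGE : G.map (algebraMap F E) ≠ 0 := by simpa using hG
  have hLd : L.natDegree ≠ 0 := by
    intro h
    rw [natDegree_eq_zero] at h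
    obtain ⟨x, rfl⟩ := h
    rw [derivative_C] at hL
    exact hv (by simpa using hL.symm)
  have hG'0 : G' ≠ 0 := by
    rw [hG', Ne, comp_eq_zero_iff]
    rintro (h | ⟨_, h⟩)
    · exact hGE h
    · rw [h] at hLd; simp at hLd
  have hdeg : G'.natDegree ≤ M := by
    rw [hG', natDegree_comp, natDegree_map]; exact hM
  obtain ⟨f, hfp⟩ : ∃ f : ℕ, Nat.card F = p^f := by
    have := Fintype.ofFinite F
    obtain ⟨n, _, h⟩ := FiniteField.card F p
    exact ⟨n, by rw [Nat.card_eq_fintype_card, h]⟩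
  have hQ : 2 ≤ Nat.card F := Finite.one_lt_card
  have hjQ : j ≤ Nat.card F ^ j := (Nat.lt_pow_self (by omega)).le
  have hmul : ∀ l : ℕ, l.Prime → l ∣ d → ∃ β : AlgebraicClosure E, ¬ l ∣ (G'.map (algebraMap E (AlgebraicClosure E))).rootMultiplicity β := by
    intro l hl hld
    obtain ⟨β, hβ⟩ := hm l hl hld
    let φ : AlgebraicClosure F →ₐ[F] AlgebraicClosure E := IsAlgClosed.lift
    set L' := L.map (algebraMap E (AlgebraicClosure E)) with hL'
    obtain ⟨z, hz⟩ : ∃ z, L'.eval z = φ β := by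
      obtain ⟨z, hz⟩ := IsAlgClosed.exists_root (L' - C (φ β)) (by
        rw [degree_sub_C]
        · rw [hL', degree_map, degree_eq_natDegree (by rintro rfl; simp at hLd)]
          exact_mod_cast hLd
        · rw [hL', degree_map]; exact natDegree_pos_iff_degree_pos.mp (Nat.pos_of_ne_zero hLd))
      exact ⟨z, by simpa [IsRoot, sub_eq_zero] using hz⟩
    refine ⟨z, ?_⟩
    have e1 : G'.map (algebraMap E (AlgebraicClosure E)) = (G.map (algebraMap F (AlgebraicClosure E))).comp L' := by
      rw [hG', map_comp, Polynomial.map_map, ← IsScalarTower.algebraMap_eq]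
    have e2 : G.map (algebraMap F (AlgebraicClosure E)) = (G.map (algebraMap F (AlgebraicClosure F))).map (φ : AlgebraicClosure F →+* AlgebraicClosure E) := by
      rw [Polynomial.map_map, AlgHom.comp_algebraMap]
    rw [e1, rootMult_comp _ _ (by simpa using hG) (algebraMap E _ v) _ (by simpa using hv) (by rw [hL', derivative_map, hL, map_C]),
      hz, e2, show φ β = (φ : AlgebraicClosure F →+* AlgebraicClosure E) β from rfl, ← eq_rootMultiplicity_map (RingHom.injective _)]
    exact hβ
  have hw := charsum_weak (liftChar E η) d (by rw [liftChar_order, hd]) hd1 G' hG'0 hmul p (f*j) (Nat.card F ^ j)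
    (by rw [hfp, pow_mul]) hE (by
      refine le_trans ?_ (hJ.trans hjQ)
      gcongr)
  have e3 : ∀ z, liftChar E η (G'.eval z) = η (Algebra.norm F (aeval (L.eval z) G)) := by
    intro z
    rw [liftChar_apply, hG', eval_comp, eval_map, aeval_def]
  simp_rw [e3] at hw
  refine hw.trans ?_
  have hQ1 : (1:ℝ) ≤ (Nat.card F : ℝ)^j := one_le_pow₀ (by exact_mod_cast (by omega : 1 ≤ Nat.card F))
  have hdr : (G'.natDegree : ℝ) ≤ M := by exact_mod_cast hdeg
  push_cast
  have : (Nat.card F : ℝ)^j * (d*(3*G'.natDegree+2)+1) ≤ (Nat.card F : ℝ)^j * (d*(3*M+2)+1) := by gcongr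
  have h4 : (G'.natDegree : ℝ) ≤ M * (Nat.card F : ℝ)^j := by nlinarith [(Nat.cast_nonneg M : (0:ℝ) ≤ M)]
  nlinarith

/-- character sum over the degree `k+1` extension -/
noncomputable def SS (p : ℕ) [Fact p.Prime] [CharP F p] (η : MulChar F ℂ) (ψ : AddChar F ℂ) (G : F[X]) (k : ℕ) : ℂ :=
  ∑ᶠ x : FiniteField.Extension F p (k+1), lam η ψ G (cp F x)

theorem weak1 (p : ℕ) [Fact p.Prime] [CharP F p] (η : MulChar F ℂ) (d : ℕ) (hd : orderOf η = d) (hd1 : 1 < d)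
    (G : F[X]) (hG : G ≠ 0)
    (hm : ∀ l : ℕ, l.Prime → l ∣ d → ∃ β : AlgebraicClosure F, ¬ l ∣ (G.map (algebraMap F (AlgebraicClosure F))).rootMultiplicity β) :
    ∃ (Cc : ℝ) (J : ℕ), ∀ j, J ≤ j → ‖SS p η 1 G (2*j+1)‖ ≤ Cc * (Nat.card F : ℝ)^(j+1) := by
  refine ⟨(d*(3*G.natDegree+2)+1+G.natDegree : ℕ), (d*G.natDegree+2*d+1)^2, fun j hj => ?_⟩
  have := Fintype.ofFinite (FiniteField.Extension F p (2*j+1+1))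
  have h := weakE p η d hd hd1 G hG hm (FiniteField.Extension F p (2*j+1+1)) (j+1) G.natDegree (by
    rw [← Nat.card_eq_fintype_card, FiniteField.natCard_extension]; ring) (by omega) X 1 one_ne_zero (by simp) (by simp)
  rw [SS, finsum_eq_sum_of_fintype]
  simp_rw [lam_cp]
  simpa using h

theorem weak2 (p : ℕ) [Fact p.Prime] [CharP F p] (η : MulChar F ℂ) (d : ℕ) (hd : orderOf η = d) (hd1 : 1 < d)
    (G : F[X]) (hG : G ≠ 0) (ψ : AddChar F ℂ) (hψ : ψ ≠ 1)
    (hm : ∀ l : ℕ, l.Prime → l ∣ d → ∃ β : AlgebraicClosure F, ¬ l ∣ (G.map (algebraMap F (AlgebraicClosure F))).rootMultiplicity β) :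
    ∃ (Cc : ℝ) (J : ℕ), ∀ j, J ≤ j → ‖∑ c ∈ Finset.range p, SS p η (ψ^c) G (2*j+1)‖ ≤ Cc * (Nat.card F : ℝ)^(j+1) := by
  set M := G.natDegree * p with hM
  refine ⟨(d*(3*M+2)+1+M : ℕ), (d*M+2*d+1)^2, fun j hj => ?_⟩
  have := Fintype.ofFinite (FiniteField.Extension F p (2*j+1+1))
  have hchar : CharP (FiniteField.Extension F p (2*j+1+1)) p := charP_of_injective_algebraMap (algebraMap F _).injective p
  let Ψ : AddChar (FiniteField.Extension F p (2*j+1+1)) ℂ := ψ.compAddMonoidHom (Algebra.trace F (FiniteField.Extension F p (2*j+1+1))).toAddMonoidHom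
  have hΨa : ∀ x, Ψ x = ψ (Algebra.trace F _ x) := fun x => rfl
  have hΨ : Ψ ≠ 1 := by
    obtain ⟨y, hy⟩ := AddChar.ne_one_iff.mp hψ
    have hperf : PerfectField F := inferInstance
    have hfd : FiniteDimensional F (FiniteField.Extension F p (2*j+1+1)) := Module.Finite.of_finite
    have hsep : Algebra.IsSeparable F (FiniteField.Extension F p (2*j+1+1)) := Algebra.IsAlgebraic.isSeparable_of_perfectField
    obtain ⟨x, rfl⟩ := Algebra.trace_surjective F (FiniteField.Extension F p (2*j+1+1)) y
    exact AddChar.ne_one_iff.mpr ⟨x, hy⟩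
  obtain ⟨u, hu, hsum⟩ := as_sum p Ψ hΨ
  have hp := (Fact.out : p.Prime)
  have h := weakE p η d hd hd1 G hG hm (FiniteField.Extension F p (2*j+1+1)) (j+1) M (by
    rw [← Nat.card_eq_fintype_card, FiniteField.natCard_extension]; ring) (by omega) (C u * (X^p - X)) (-u) (neg_ne_zero.mpr hu) 
    (by simp [derivative_X_pow, CharP.cast_eq_zero]) (by
      rw [hM]; gcongr
      refine (natDegree_C_mul_le _ _).trans ((natDegree_sub_le _ _).trans (max_le (natDegree_X_pow_le p) (natDegree_X_le.trans hp.one_lt.le))))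
  have e : ∑ c ∈ Finset.range p, SS p η (ψ^c) G (2*j+1) = ∑ z, η (Algebra.norm F (aeval (u * (z^p-z)) G)) := by
    rw [hsum (fun y => η (Algebra.norm F (aeval y G)))]
    simp_rw [SS, finsum_eq_sum_of_fintype, lam_cp]
    rw [Finset.sum_comm]
    apply Finset.sum_congr rfl
    intro x _
    rw [Finset.mul_sum]
    apply Finset.sum_congr rfl
    intro c _
    rw [hΨa, AddChar.pow_apply]
  rw [e]
  simpa using h
end
end S12
end

section
open Polynomial
namespace S12
set_option linter.unusedSectionVars false
section
variable {F : Type} [Field F] [Finite F]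

theorem sum_mon_zero (η : MulChar F ℂ) (ψ : AddChar F ℂ) (G : F[X]) : ∑ h ∈ mon F 0, lam η ψ G h = 1 := by
  have : mon F 0 = {1} := by
    ext h
    rw [mem_mon, Finset.mem_singleton]
    constructor
    · rintro ⟨h1, h2⟩; exact (h1.natDegree_eq_zero.mp h2)
    · rintro rfl; simp [monic_one]
  rw [this, Finset.sum_singleton, lam]
  simp [nextCoeff]

theorem sum_mon_one [Fintype F] (η : MulChar F ℂ) (ψ : AddChar F ℂ) (G : F[X]) :
    ∑ h ∈ mon F 1, lam η ψ G h = ∑ x : F, η (G.eval x) * ψ x := by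
  symm
  refine Finset.sum_bij (fun x _ => X - C x) ?_ ?_ ?_ ?_
  · intro x _; rw [mem_mon]; exact ⟨monic_X_sub_C x, natDegree_X_sub_C x⟩
  · intro x _ y _ h; simpa using h
  · intro h hh
    rw [mem_mon] at hh
    refine ⟨-h.coeff 0, Finset.mem_univ _, ?_⟩
    have := hh.1.eq_X_add_C hh.2
    rw [this]; simp
  · intro x _
    rw [lam, nextCoeff_X_sub_C, neg_neg, natDegree_X_sub_C, resultant_X_sub_C_left _ _ _ le_rfl]

theorem vanish_one (p : ℕ) [Fact p.Prime] [CharP F p] (η : MulChar F ℂ) (d : ℕ) (hd : orderOf η = d) (hd1 : 1 < d)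
    (G D : F[X]) (hG : G ≠ 0) (hD : D.Monic) (K : ℕ) (hGD : G ∣ D^K) (hDG : D ∣ G^K)
    (hm : ∀ l : ℕ, l.Prime → l ∣ d → ∃ β : AlgebraicClosure F, ¬ l ∣ (G.map (algebraMap F (AlgebraicClosure F))).rootMultiplicity β)
    (hr : ∀ β : AlgebraicClosure F, aeval β G = 0 → aeval β D = 0) 
    (N : ℕ) (hN : D.natDegree ≤ N) : ∑ h ∈ mon F N, lam η 1 G h = 0 := by
  classical
  by_contra hcon
  set κ := ((-1)^G.natDegree * G.leadingCoeff) with hκd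
  have hκ : κ ≠ 0 := by
    apply mul_ne_zero
    · exact pow_ne_zero _ (by simp)
    · simpa using hG
  have hall : ∀ h0 : F[X], h0.Monic → IsCoprime h0 D → η (resultant h0 G) = η κ ^ h0.natDegree := by
    intro h0 h1 h2
    by_contra h3
    exact hcon (vanish_mul η G D hG hD hr h0 h1 h2 h3 N hN)
  obtain ⟨Cc, J, hb⟩ := weak1 p η d hd hd1 G hG hm
  have hlow : ∀ j, (Nat.card F : ℝ)^(2*j+1+1) - G.natDegree ≤ ‖SS p η 1 G (2*j+1)‖ := by
    intro j
    have := Fintype.ofFinite (FiniteField.Extension F p (2*j+1+1))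
    rw [SS, finsum_eq_sum_of_fintype]
    have hval : ∀ x : FiniteField.Extension F p (2*j+1+1), lam η 1 G (cp F x) = if aeval x G = 0 then 0 else η κ ^ (2*j+1+1) := by
      intro x
      have hfd : FiniteDimensional F (FiniteField.Extension F p (2*j+1+1)) := Module.Finite.of_finite
      by_cases hx : aeval x G = 0
      · rw [if_pos hx, lam_cp, hx, Algebra.norm_zero, MulChar.map_zero, zero_mul]
      · rw [if_neg hx, lam, AddChar.one_apply, mul_one, hall _ (cp_monic x), cp_natDegree, FiniteField.finrank_extension]
        by_contra hnc
        have hres : resultant (cp F x) D = 0 := by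
          rw [resultant_eq_zero_iff]
          exact ⟨Or.inl (cp_monic x).ne_zero, hnc⟩
        rw [res_cp, Algebra.norm_eq_zero_iff] at hres
        obtain ⟨w, hw⟩ := hDG
        have h5 := congrArg (aeval x) hw
        rw [map_pow, map_mul, hres, zero_mul] at h5
        exact hx (eq_zero_of_pow_eq_zero h5)
    simp_rw [hval]
    rw [Finset.sum_ite, Finset.sum_const_zero, zero_add, Finset.sum_const, nsmul_eq_mul, norm_mul, norm_pow]
    have hn1 : ‖η κ‖ = 1 := by

      have h6 : η κ ^ orderOf η = 1 := by
        rw [← MulChar.pow_apply' _ (by omega), pow_orderOf_eq_one, MulChar.one_apply (isUnit_iff_ne_zero.mpr hκ)]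
      exact Complex.norm_eq_one_of_pow_eq_one h6 (by omega)
    rw [hn1, one_pow, mul_one]
    have hcard := Finset.card_filter_add_card_filter_not (s := (Finset.univ : Finset (FiniteField.Extension F p (2*j+1+1)))) (fun x => aeval x G = 0)
    have hle : (Finset.univ.filter (fun x : FiniteField.Extension F p (2*j+1+1) => aeval x G = 0)).card ≤ G.natDegree := by
      have : (Finset.univ.filter (fun x : FiniteField.Extension F p (2*j+1+1) => aeval x G = 0)) ⊆ (G.aroots (FiniteField.Extension F p (2*j+1+1))).toFinset := by
        intro x hx
        rw [Multiset.mem_toFinset, mem_aroots]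
        exact ⟨hG, (Finset.mem_filter.mp hx).2⟩
      refine (Finset.card_le_card this).trans ((Multiset.toFinset_card_le _).trans ((card_roots' _).trans ?_))
      rw [natDegree_map]
    rw [Finset.card_univ, ← Nat.card_eq_fintype_card, FiniteField.natCard_extension] at hcard
    rw [Complex.norm_natCast, ← Nat.cast_pow, ← hcard, Nat.cast_add]
    have : ((Finset.univ.filter (fun x : FiniteField.Extension F p (2*j+1+1) => aeval x G = 0)).card : ℝ) ≤ G.natDegree := by exact_mod_cast hle
    linarith
  have hQ : (2:ℝ) ≤ Nat.card F := by exact_mod_cast (Finite.one_lt_card : 1 < Nat.card F)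
  obtain ⟨j0, hj0⟩ := pow_unbounded_of_one_lt (|Cc| + G.natDegree + 1) (lt_of_lt_of_le one_lt_two hQ)
  have h1 := (hlow (max J j0)).trans (hb (max J j0) (le_max_left _ _))
  set t := (Nat.card F : ℝ)^(max J j0+1) with ht
  have h2 : |Cc| + G.natDegree + 1 < t := lt_of_lt_of_le hj0 (pow_le_pow_right₀ (by linarith) ((le_max_right J j0).trans (Nat.le_succ _)))
  have h3 : (Nat.card F : ℝ)^(2*(max J j0)+1+1) = t*t := by rw [ht]; ring
  rw [h3] at h1
  have h4 := le_abs_self Cc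
  have h5 : (0:ℝ) ≤ G.natDegree := Nat.cast_nonneg _
  have h6 := abs_nonneg Cc
  nlinarith

theorem weil_core [Fintype F] (p : ℕ) [Fact p.Prime] [CharP F p] (η : MulChar F ℂ) (d : ℕ) (hd : orderOf η = d) (hd1 : 1 < d)
    (G D : F[X]) (hG : G ≠ 0) (hD : D.Monic) (hD6 : D.natDegree ≤ 6) (K : ℕ) (hGD : G ∣ D^K) (hDG : D ∣ G^K)
    (hm : ∀ l : ℕ, l.Prime → l ∣ d → ∃ β : AlgebraicClosure F, ¬ l ∣ (G.map (algebraMap F (AlgebraicClosure F))).rootMultiplicity β)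
    (ψ : AddChar F ℂ) :
    ‖∑ x : F, η (G.eval x) * ψ x‖ ≤ 6 * √(Fintype.card F) := by
  classical
  have hr : ∀ β : AlgebraicClosure F, aeval β G = 0 → aeval β D = 0 := by
    intro β hβ
    obtain ⟨w, hw⟩ := hGD
    have h5 := congrArg (aeval β) hw
    rw [map_pow, map_mul, hβ, zero_mul] at h5
    exact (eq_zero_of_pow_eq_zero h5)
  have hvan : ∀ ψ : AddChar F ℂ, ∀ N, 6 < N → ∑ h ∈ mon F N, lam η ψ G h = 0 := by
    intro ψ N hN
    by_cases h : ψ = 1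
    · subst h; exact vanish_one p η d hd hd1 G D hG hD K hGD hDG hm hr N (by omega)
    · exact vanish_add η ψ G D hG hD hr h N (by omega)
  have hrep : ∀ ψ : AddChar F ℂ, ∃ ω : Multiset ℂ, Multiset.card ω ≤ 6 ∧ ∀ k, SS p η ψ G k = - (ω.map (fun w => w^(k+1))).sum := by
    intro ψ
    obtain ⟨ω, h1, h2⟩ := powersum_repr 6 (fun N => ∑ h ∈ mon F N, lam η ψ G h) (fun k => SS p η ψ G (k-1)) (sum_mon_zero η ψ G)
      (hvan ψ) (fun N => newton_id p (lam η ψ G) (fun g h hg hh => lam_mul η ψ G g h hg hh) N)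
    exact ⟨ω, h1, fun k => h2 (k+1) (by omega)⟩
  choose ω hω6 hω using hrep
  have hRpos : (0:ℝ) < √(Fintype.card F) := Real.sqrt_pos.mpr (by exact_mod_cast Fintype.card_pos)
  have hR2 : √(Fintype.card F)^2 = (Nat.card F : ℝ) := by
    rw [Real.sq_sqrt (by positivity), Nat.card_eq_fintype_card]
  have hbd : ∀ w ∈ ω ψ, ‖w‖ ≤ √(Fintype.card F) := by
    by_cases hψ : ψ = 1
    · obtain ⟨Cc, J, hb⟩ := weak1 p η d hd hd1 G hG hm
      refine powersum_bound (ω ψ) _ Cc hRpos (J+1) ?_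
      intro j hj
      obtain ⟨i, rfl⟩ : ∃ i, j = i+1 := ⟨j-1, by omega⟩
      have h1 := hb i (by omega)
      rw [← hψ, hω, norm_neg] at h1
      rw [hR2]; exact h1
    · obtain ⟨Cc, J, hb⟩ := weak2 p η d hd hd1 G hG ψ hψ hm
      have hmem : ∀ w ∈ ω ψ, w ∈ ∑ c ∈ Finset.range p, ω (ψ^c) := by
        intro w hw
        rw [Multiset.mem_sum]
        exact ⟨1, Finset.mem_range.mpr (Fact.out : p.Prime).one_lt, by rwa [pow_one]⟩
      have hms : ∀ (s : Finset ℕ) (g : ℕ → Multiset ℂ) (f : ℂ → ℂ), ((∑ c ∈ s, g c).map f).sum = ∑ c ∈ s, ((g c).map f).sum := by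
        intro s g f
        induction s using Finset.induction_on with
        | empty => simp
        | insert a s ha ih => rw [Finset.sum_insert ha, Finset.sum_insert ha, Multiset.map_add, Multiset.sum_add, ih]
      intro w hw
      refine powersum_bound (∑ c ∈ Finset.range p, ω (ψ^c)) _ Cc hRpos (J+1) ?_ w (hmem w hw)
      intro j hj
      obtain ⟨i, rfl⟩ : ∃ i, j = i+1 := ⟨j-1, by omega⟩
      have h1 := hb i (by omega)
      simp_rw [hω] at h1
      rw [Finset.sum_neg_distrib, norm_neg] at h1
      rw [hR2, hms]; exact h1
  have h1 : ∑ x : F, η (G.eval x) * ψ x = SS p η ψ G 0 := by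
    have := newton_id p (lam η ψ G) (fun g h hg hh => lam_mul η ψ G g h hg hh) 1
    rw [Finset.sum_range_one, Nat.cast_one, one_mul, sum_mon_one, sum_mon_zero, mul_one] at this
    exact this
  rw [h1, hω, norm_neg]
  have h2 : ∀ s : Multiset ℂ, (∀ w ∈ s, ‖w‖ ≤ √(Fintype.card F)) → ‖(s.map (fun w => w^(0+1))).sum‖ ≤ Multiset.card s * √(Fintype.card F) := by
    intro s
    induction s using Multiset.induction with
    | empty => simp
    | cons a s ih =>
      intro h
      rw [Multiset.map_cons, Multiset.sum_cons, Multiset.card_cons]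
      have h3 := ih (fun w hw => h w (Multiset.mem_cons_of_mem hw))
      have h4 := h a (Multiset.mem_cons_self a s)
      refine (norm_add_le _ _).trans ?_
      push_cast
      simp only [zero_add, pow_one] at h3 ⊢
      linarith
  refine (h2 _ hbd).trans ?_
  gcongr
  exact_mod_cast hω6 ψ
end
end S12
end

section
open Polynomial
namespace S12
set_option linter.unusedSectionVars false

theorem cyc_pair {M : Type} [CommGroup M] [Finite M] [IsCyclic M] (x y : M) (h : ¬ (x = 1 ∧ y = 1)) :
    ∃ (η : M) (a b : ℕ), 0 < a ∧ 0 < b ∧ x = η ^ a ∧ y = η ^ b ∧ 1 < orderOf η ∧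
      ∀ l : ℕ, l.Prime → l ∣ orderOf η → ¬ (l ∣ a ∧ l ∣ b) := by
  let H : Subgroup M := Subgroup.closure {x, y}
  have hx : x ∈ H := Subgroup.subset_closure (by simp)
  have hy : y ∈ H := Subgroup.subset_closure (by simp)
  obtain ⟨g, hg⟩ := IsCyclic.exists_generator (α := H)
  have hgen : ∀ z ∈ H, z ∈ Submonoid.powers (g : M) := by
    intro z hz
    have h1 := hg ⟨z, hz⟩
    rw [← mem_powers_iff_mem_zpowers] at h1
    obtain ⟨k, hk⟩ := h1
    exact ⟨k, by simpa using congrArg Subtype.val hk⟩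
  obtain ⟨a, ha⟩ := hgen x hx
  obtain ⟨b, hb⟩ := hgen y hy
  have hpos : 0 < orderOf (g : M) := orderOf_pos _
  simp only at ha hb
  refine ⟨g, a + orderOf (g : M), b + orderOf (g : M), by omega, by omega, ?_, ?_, ?_, ?_⟩
  · rw [pow_add, pow_orderOf_eq_one, mul_one, ha]
  · rw [pow_add, pow_orderOf_eq_one, mul_one, hb]
  · by_contra h1
    have : orderOf (g : M) = 1 := by omega
    rw [orderOf_eq_one_iff] at this
    rw [this, one_pow] at ha hb
    exact h ⟨ha.symm, hb.symm⟩
  · rintro l hl hld ⟨h1, h2⟩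
    rw [Nat.dvd_add_left hld] at h1 h2
    have hle : H ≤ Subgroup.zpowers ((g : M) ^ l) := by
      rw [Subgroup.closure_le]
      rintro z (rfl | rfl)
      · obtain ⟨c, rfl⟩ := h1
        rw [pow_mul] at ha
        rw [← ha]; exact Subgroup.npow_mem_zpowers _ _
      · obtain ⟨c, rfl⟩ := h2
        rw [pow_mul] at hb
        rw [← hb]; exact Subgroup.npow_mem_zpowers _ _
    have h3 := hle g.2
    have h4 := orderOf_dvd_of_mem_zpowers h3
    rw [orderOf_pow_of_dvd hl.ne_zero hld] at h4
    have h5 := Nat.le_of_dvd (Nat.div_pos (Nat.le_of_dvd hpos hld) hl.pos) h4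
    have := Nat.div_lt_self hpos hl.one_lt
    omega

theorem rm_pow {K : Type} [Field K] (p : K[X]) (n : ℕ) (x : K) :
    (p ^ n).rootMultiplicity x = n * p.rootMultiplicity x := by
  classical
  rw [← count_roots, ← count_roots, roots_pow, Multiset.count_nsmul]

/-- multiplicity of the roots of `g` -/
theorem rm_of_irr {F : Type} [Field F] [Finite F] (g P : F[X]) (hg : Irreducible g) (k : ℕ)
    (h1 : g ^ k ∣ P) (h2 : ¬ g ^ (k+1) ∣ P) (β : AlgebraicClosure F) (hβ : aeval β g = 0) :
    (P.map (algebraMap F (AlgebraicClosure F))).rootMultiplicity β = k := by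
  obtain ⟨w, rfl⟩ := h1
  have hw : ¬ g ∣ w := by
    rintro ⟨v, rfl⟩; exact h2 ⟨v, by ring⟩
  have hw0 : w ≠ 0 := by rintro rfl; simp at hw
  have hcop : IsCoprime g w := (hg.coprime_iff_not_dvd).mpr hw
  have hwb : aeval β w ≠ 0 := by
    intro h0
    obtain ⟨u, v, huv⟩ := hcop
    have := congrArg (aeval β) huv
    simp [hβ, h0] at this
  rw [Polynomial.map_mul, Polynomial.map_pow, rootMultiplicity_mul, rm_pow]
  · have e1 : (w.map (algebraMap F (AlgebraicClosure F))).rootMultiplicity β = 0 := by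
      apply rootMultiplicity_eq_zero
      rwa [IsRoot.def, eval_map_algebraMap]
    have e2 : (g.map (algebraMap F (AlgebraicClosure F))).rootMultiplicity β = 1 := by
      have hsep : g.Separable := PerfectField.separable_of_irreducible hg
      have hsep' := hsep.map (f := algebraMap F (AlgebraicClosure F))
      have h3 := rootMultiplicity_le_one_of_separable hsep' β
      have h4 : 0 < (g.map (algebraMap F (AlgebraicClosure F))).rootMultiplicity β := by
        rw [rootMultiplicity_pos ((Polynomial.map_ne_zero_iff (algebraMap F (AlgebraicClosure F)).injective).mpr hg.ne_zero)]
        rwa [IsRoot.def, eval_map_algebraMap]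
      omega
    rw [e1, e2]; ring
  · rw [← Polynomial.map_pow, ← Polynomial.map_mul]
    rw [Polynomial.map_ne_zero_iff (algebraMap F (AlgebraicClosure F)).injective]
    exact mul_ne_zero (pow_ne_zero _ hg.ne_zero) hw0
end S12
end

section
open Polynomial
namespace S12
set_option linter.unusedSectionVars false

instance mulChar_cyc (F : Type) [Field F] [Finite F] : IsCyclic (MulChar F ℂ) :=
  isCyclic_of_surjective (MulChar.mulEquiv_units F ℂ).some.symm (MulEquiv.surjective _)

theorem G_mult {F : Type} [Field F] [Finite F] (f1 f2 : F[X]) (h1 : f1 ≠ 0) (h2 : f2 ≠ 0) (a b c : ℕ) (β : AlgebraicClosure F) :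
    ((X ^ a * f1 ^ b * f2 ^ c).map (algebraMap F (AlgebraicClosure F))).rootMultiplicity β =
      a * (X : (AlgebraicClosure F)[X]).rootMultiplicity β + b * (f1.map (algebraMap F (AlgebraicClosure F))).rootMultiplicity β
       + c * (f2.map (algebraMap F (AlgebraicClosure F))).rootMultiplicity β := by
  have i := (algebraMap F (AlgebraicClosure F)).injective
  have h1' := (Polynomial.map_ne_zero_iff i).mpr h1
  have h2' := (Polynomial.map_ne_zero_iff i).mpr h2
  rw [Polynomial.map_mul, Polynomial.map_mul, Polynomial.map_pow, Polynomial.map_pow, Polynomial.map_pow, map_X,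
    rootMultiplicity_mul, rootMultiplicity_mul, rm_pow, rm_pow, rm_pow]
  · exact mul_ne_zero (pow_ne_zero _ X_ne_zero) (pow_ne_zero _ h1')
  · exact mul_ne_zero (mul_ne_zero (pow_ne_zero _ X_ne_zero) (pow_ne_zero _ h1')) (pow_ne_zero _ h2')

theorem mixed_mul {F : Type} [Field F] [Fintype F] (f1 f2 : F[X]) (h1 : f1 ≠ 0) (h2 : f2 ≠ 0)
    (hd1 : f1.natDegree ≤ 3) (hd2 : f2.natDegree ≤ 2) (hc : IsCoprime f1 f2) (k : ℕ) (g : F[X])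
    (hgm : g.Monic) (hgi : Irreducible g) (hgX : g ≠ X) (hk : Nat.gcd k (Fintype.card F - 1) = 1)
    (hg1 : g ^ k ∣ f1 * f2) (hg2 : ¬ g ^ (k+1) ∣ f1 * f2)
    (χ1 χ2 : MulChar F ℂ) (ψ : AddChar F ℂ) (hχ : ¬ (χ1 = 1 ∧ χ2 = 1)) :
    ‖∑ x : F, χ1 x * χ2 (f1.eval x / f2.eval x) * ψ x‖ ≤ 6 * √(Fintype.card F) := by
  classical
  obtain ⟨η, a, b, ha, hb, rfl, rfl, hd, hl⟩ := cyc_pair χ1 χ2 hχ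
  have hdQ : orderOf η ∣ Fintype.card F - 1 := by
    rw [← Fintype.card_units]; exact orderOf_dvd_of_pow_eq_one (MulChar.pow_card_eq_one η)
  set d := orderOf η with hdd
  obtain ⟨p, hp⟩ := CharP.exists F
  have hpp : Fact p.Prime := ⟨CharP.char_is_prime F p⟩
  set G : F[X] := X ^ a * f1 ^ b * f2 ^ (b * (d-1)) with hGdef
  have hb' : 0 < b * (d-1) := Nat.mul_pos hb (by omega)
  have hG0 : G ≠ 0 := mul_ne_zero (mul_ne_zero (pow_ne_zero _ X_ne_zero) (pow_ne_zero _ h1)) (pow_ne_zero _ h2)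
  set D0 : F[X] := X * f1 * f2 with hD0
  have hD00 : D0 ≠ 0 := mul_ne_zero (mul_ne_zero X_ne_zero h1) h2
  have hassoc : Associated D0 (normalize D0) := associated_normalize D0
  have key : ∑ x : F, (η ^ a) x * (η ^ b) (f1.eval x / f2.eval x) * ψ x = ∑ x : F, η (G.eval x) * ψ x := by
    apply Finset.sum_congr rfl
    intro x _
    congr 1
    rw [MulChar.pow_apply' _ ha.ne', MulChar.pow_apply' _ hb.ne']
    simp only [hGdef, eval_mul, eval_pow, eval_X, map_mul, map_pow]
    rw [mul_assoc]
    congr 1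
    by_cases hz : f2.eval x = 0
    · rw [hz, div_zero, MulChar.map_zero, zero_pow hb.ne', zero_pow hb'.ne', mul_zero]
    · rw [pow_mul, pow_right_comm, ← mul_pow]
      congr 1
      have e1 : η (f2.eval x) ^ d = 1 := by
        rw [← MulChar.pow_apply' _ (by omega), hdd, pow_orderOf_eq_one, MulChar.one_apply (isUnit_iff_ne_zero.mpr hz)]
      have e2 : η (f1.eval x / f2.eval x) * η (f2.eval x) = η (f1.eval x) := by
        rw [← map_mul, div_mul_cancel₀ _ hz]
      rw [← e2, mul_assoc, ← pow_succ', Nat.sub_add_cancel hd.le, e1, mul_one]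
  rw [key]
  have hGD0 : G ∣ D0 ^ (a + b + b * (d-1)) := by
    rw [hGdef, hD0, mul_pow, mul_pow]
    exact mul_dvd_mul (mul_dvd_mul (pow_dvd_pow _ (by omega)) (pow_dvd_pow _ (by omega))) (pow_dvd_pow _ (by omega))
  have hDG0 : D0 ∣ G := 
    mul_dvd_mul (mul_dvd_mul (dvd_pow_self _ ha.ne') (dvd_pow_self _ hb.ne')) (dvd_pow_self _ hb'.ne')
  refine weil_core p η d rfl hd G (normalize D0) hG0 (monic_normalize hD00) ?_ (a + b + b * (d-1)) ?_ ?_ ?_ ψ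
  · rw [natDegree_eq_of_degree_eq (degree_normalize (p := D0)), hD0, natDegree_mul (mul_ne_zero X_ne_zero h1) h2, natDegree_mul X_ne_zero h1, natDegree_X]
    omega
  · exact hGD0.trans (hassoc.pow_pow.dvd)
  · exact (hassoc.symm.dvd.trans hDG0).trans (dvd_pow_self _ (by omega))
  · intro l hlp hld
    by_contra hcon
    push Not at hcon
    apply hl l hlp hld
    obtain ⟨β, hβ⟩ : ∃ β : AlgebraicClosure F, aeval β g = 0 :=
      IsAlgClosed.exists_aeval_eq_zero _ g (by
        have := hgi.degree_pos; exact this.ne')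
    have hβ0 : β ≠ 0 := by
      rintro rfl
      have h3 : g.coeff 0 = 0 := by
        rw [← coeff_zero_eq_aeval_zero'] at hβ
        exact (algebraMap F (AlgebraicClosure F)).injective (by rw [hβ, map_zero])
      rw [← X_dvd_iff] at h3
      exact hgX (eq_of_monic_of_associated hgm monic_X
        ((irreducible_X.associated_of_dvd hgi h3).symm))
    have hm := rm_of_irr g (f1 * f2) hgi k hg1 hg2 β hβ
    have i := (algebraMap F (AlgebraicClosure F)).injective
    have h1' := (Polynomial.map_ne_zero_iff i).mpr h1
    have h2' := (Polynomial.map_ne_zero_iff i).mpr h2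
    rw [Polynomial.map_mul, rootMultiplicity_mul (mul_ne_zero h1' h2')] at hm
    have hG1 := hcon β
    have hG2 := hcon 0
    rw [hGdef, G_mult _ _ h1 h2] at hG1 hG2
    have hX0 : (X : (AlgebraicClosure F)[X]).rootMultiplicity β = 0 := by
      apply rootMultiplicity_eq_zero; simpa using hβ0
    have hX1 : (X : (AlgebraicClosure F)[X]).rootMultiplicity 0 = 1 := by
      have := rootMultiplicity_X_sub_C_self (x := (0 : AlgebraicClosure F))
      simpa using this
    rw [hX0] at hG1
    rw [hX1] at hG2
    have hone : (f1.map (algebraMap F (AlgebraicClosure F))).rootMultiplicity β = 0 ∨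
       (f2.map (algebraMap F (AlgebraicClosure F))).rootMultiplicity β = 0 := by
      by_contra h5
      push Not at h5
      have r1 := (rootMultiplicity_pos h1').mp (Nat.pos_of_ne_zero h5.1)
      have r2 := (rootMultiplicity_pos h2').mp (Nat.pos_of_ne_zero h5.2)
      rw [IsRoot.def, eval_map_algebraMap] at r1 r2
      obtain ⟨u, v, huv⟩ := hc
      have := congrArg (aeval β) huv
      simp [r1, r2] at this
    have hlk : ¬ l ∣ k := by
      intro h6
      have := Nat.dvd_gcd h6 (hld.trans hdQ)
      rw [hk] at this
      exact hlp.one_lt.ne' (Nat.dvd_one.mp this)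
    have hld1 : ¬ l ∣ d - 1 := by
      intro h6
      have := (Nat.dvd_sub hld h6)
      rw [Nat.sub_sub_self hd.le] at this
      exact hlp.one_lt.ne' (Nat.dvd_one.mp this)
    have hlb : l ∣ b := by
      rcases hone with h0 | h0
      · rw [h0] at hG1 hm
        rw [zero_add] at hm
        rw [hm, mul_zero, mul_zero, zero_add, zero_add] at hG1
        rcases hlp.dvd_mul.mp hG1 with h7 | h7
        · rcases hlp.dvd_mul.mp h7 with h8 | h8
          · exact h8
          · exact absurd h8 hld1
        · exact absurd h7 hlk
      · rw [h0] at hG1 hm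
        rw [add_zero] at hm
        rw [hm, mul_zero, mul_zero, zero_add, add_zero] at hG1
        rcases hlp.dvd_mul.mp hG1 with h7 | h7
        · exact h7
        · exact absurd h7 hlk
    refine ⟨?_, hlb⟩
    rw [add_assoc, mul_one] at hG2
    refine (Nat.dvd_add_left ?_).mp hG2
    exact dvd_add (dvd_mul_of_dvd_left hlb _) (dvd_mul_of_dvd_left (dvd_mul_of_dvd_left hlb _) _)

theorem mixed {F : Type} [Field F] [Fintype F] (f1 f2 : F[X]) (h1 : f1 ≠ 0) (h2 : f2 ≠ 0)
    (hd1 : f1.natDegree ≤ 3) (hd2 : f2.natDegree ≤ 2) (hc : IsCoprime f1 f2) (k : ℕ) (g : F[X])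
    (hgm : g.Monic) (hgi : Irreducible g) (hgX : g ≠ X) (hk : Nat.gcd k (Fintype.card F - 1) = 1)
    (hg1 : g ^ k ∣ f1 * f2) (hg2 : ¬ g ^ (k+1) ∣ f1 * f2)
    (χ1 χ2 : MulChar F ℂ) (ψ : AddChar F ℂ) (hχ : ¬ (χ1 = 1 ∧ χ2 = 1 ∧ ψ = 1)) :
    ‖∑ x : F, χ1 x * χ2 (f1.eval x / f2.eval x) * ψ x‖ ≤ 6 * √(Fintype.card F) := by
  classical
  by_cases h : χ1 = 1 ∧ χ2 = 1
  · obtain ⟨rfl, rfl⟩ := h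
    have hψ : ψ ≠ 1 := fun h => hχ ⟨rfl, rfl, h⟩
    set D : F[X] := X * f1 * f2 with hD
    have hD0 : D ≠ 0 := mul_ne_zero (mul_ne_zero X_ne_zero h1) h2
    have hsum : ∑ x : F, (1 : MulChar F ℂ) x * (1 : MulChar F ℂ) (f1.eval x / f2.eval x) * ψ x
        = - ∑ x ∈ D.roots.toFinset, ψ x := by
      have e0 : ∑ x : F, ψ x = 0 := AddChar.sum_eq_zero_of_ne_one hψ
      rw [eq_neg_iff_add_eq_zero, ← e0]
      rw [← Finset.sum_filter_add_sum_filter_not (Finset.univ : Finset F) (fun x => D.eval x = 0) (fun x => ψ x), add_comm]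
      congr 1
      · apply Finset.sum_congr
        · ext x; simp [hD0]
        · intros; rfl
      · rw [Finset.sum_filter]
        apply Finset.sum_congr rfl
        intro x _
        have hone : ∀ y : F, (1 : MulChar F ℂ) y = if y = 0 then 0 else 1 := by
          intro y
          split_ifs with hy
          · rw [hy, MulChar.map_zero]
          · exact MulChar.one_apply (isUnit_iff_ne_zero.mpr hy)
        simp only [hD, eval_mul, eval_X, mul_eq_zero, hone, div_eq_zero_iff]
        by_cases c1 : x = 0 <;> by_cases c2 : f1.eval x = 0 <;> by_cases c3 : f2.eval x = 0 <;> simp [c1, c2, c3]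
    rw [hsum, norm_neg]
    have hcard : D.roots.toFinset.card ≤ 6 := by
      refine (Multiset.toFinset_card_le _).trans ((card_roots' D).trans ?_)
      rw [hD, natDegree_mul (mul_ne_zero X_ne_zero h1) h2, natDegree_mul X_ne_zero h1, natDegree_X]
      omega
    have h6 : ‖∑ x ∈ D.roots.toFinset, ψ x‖ ≤ 6 := by
      refine (norm_sum_le _ _).trans ?_
      refine (Finset.sum_le_card_nsmul _ _ 1 (fun x _ => (AddChar.norm_apply ψ x).le)).trans ?_
      rw [nsmul_eq_mul, mul_one]; exact_mod_cast hcard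
    have hQ : 1 ≤ √(Fintype.card F : ℝ) := by
      rw [Real.one_le_sqrt]; exact_mod_cast Fintype.card_pos
    linarith
  · exact mixed_mul f1 f2 h1 h2 hd1 hd2 hc k g hgm hgi hgX hk hg1 hg2 χ1 χ2 ψ h
end S12
end

section
open Polynomial
namespace S12

theorem sieve {α ι : Type} [DecidableEq ι] (P : Finset α) (S T : Finset ι) (hST : Disjoint S T)
    (N : ι → ℝ) (hN : ∀ j, 1 < N j) (bad : ι → α → Prop) (φ : ι → α → ℝ)
    (hφ1 : ∀ j, ∀ x ∈ P, bad j x → φ j x = -1)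
    (hφ2 : ∀ j, ∀ x ∈ P, ¬ bad j x → φ j x = 1 / (N j - 1))
    (E : ℝ) (hE0 : 0 ≤ E)
    (hE : ∀ J ⊆ S ∪ T, J.Nonempty → |∑ x ∈ P, ∏ j ∈ J, φ j x| ≤ E)
    (δ : ℝ) (hδ0 : 0 < δ) (hδ : δ ≤ 1 - ∑ t ∈ T, 1 / N t)
    (hcond : 2 ^ S.card * E * (T.card + 2 * δ) < δ * (P.card + E)) :
    ∃ x ∈ P, ∀ j ∈ S ∪ T, ¬ bad j x := by
  classical
  by_contra hcon
  push Not at hcon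
  set w : α → ℝ := fun x => ∏ j ∈ S, (1 + φ j x) with hw
  have hexp : ∀ x, w x = ∑ J ∈ S.powerset, ∏ j ∈ J, φ j x := by
    intro x; rw [hw]; exact Finset.prod_one_add S
  have hpos : ∀ j, ∀ x ∈ P, 0 ≤ 1 + φ j x := by
    intro j x hx
    by_cases hb : bad j x
    · rw [hφ1 j x hx hb]; norm_num
    · rw [hφ2 j x hx hb]; have := hN j; have : 0 < N j - 1 := by linarith
      positivity
  have hw0 : ∀ x ∈ P, 0 ≤ w x := fun x hx => Finset.prod_nonneg (fun j _ => hpos j x hx)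
  set W := ∑ x ∈ P, w x with hW
  have hWlow : (P.card : ℝ) + E - 2 ^ S.card * E ≤ W := by
    have e1 : W = ∑ J ∈ S.powerset, ∑ x ∈ P, ∏ j ∈ J, φ j x := by
      rw [hW, Finset.sum_comm]; exact Finset.sum_congr rfl (fun x _ => hexp x)
    rw [e1, ← Finset.sum_erase_add _ _ (Finset.empty_mem_powerset S)]
    have e2 : |∑ J ∈ S.powerset.erase ∅, ∑ x ∈ P, ∏ j ∈ J, φ j x| ≤ (2 ^ S.card - 1) * E := by
      refine (Finset.abs_sum_le_sum_abs _ _).trans ?_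
      refine (Finset.sum_le_card_nsmul _ _ E ?_).trans ?_
      · intro J hJ
        rw [Finset.mem_erase, Finset.mem_powerset] at hJ
        exact hE J (hJ.2.trans Finset.subset_union_left) (Finset.nonempty_iff_ne_empty.mpr hJ.1)
      · rw [nsmul_eq_mul, Finset.card_erase_of_mem (Finset.empty_mem_powerset S), Finset.card_powerset,
          Nat.cast_sub Nat.one_le_two_pow]
        push_cast; rfl
    have e3 := (abs_le.mp e2).1
    simp only [Finset.prod_empty, Finset.sum_const, nsmul_eq_mul, mul_one]
    linarith
  have hwt : ∀ t ∈ T, |∑ x ∈ P, w x * φ t x| ≤ 2 ^ S.card * E := by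
    intro t ht
    have htS : t ∉ S := fun h => Finset.disjoint_left.mp hST h ht
    have e1 : ∑ x ∈ P, w x * φ t x = ∑ J ∈ S.powerset, ∑ x ∈ P, ∏ j ∈ insert t J, φ j x := by
      rw [Finset.sum_comm]
      apply Finset.sum_congr rfl
      intro x _
      rw [hexp, Finset.sum_mul]
      apply Finset.sum_congr rfl
      intro J hJ
      rw [Finset.prod_insert (fun h => htS (Finset.mem_powerset.mp hJ h)), mul_comm]
    rw [e1]
    refine (Finset.abs_sum_le_sum_abs _ _).trans ?_
    refine (Finset.sum_le_card_nsmul _ _ E ?_).trans ?_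
    · intro J hJ
      rw [Finset.mem_powerset] at hJ
      refine hE _ ?_ (Finset.insert_nonempty _ _)
      intro y hy
      rw [Finset.mem_insert] at hy
      rw [Finset.mem_union]
      rcases hy with rfl | hy
      · exact Or.inr ht
      · exact Or.inl (hJ hy)
    · rw [nsmul_eq_mul, Finset.card_powerset]; push_cast; rfl
  have hpt : ∀ x ∈ P, w x ≤ ∑ t ∈ T, w x * (1 / N t - (1 - 1 / N t) * φ t x) := by
    intro x hx
    have hind : ∀ t ∈ T, w x * (1 / N t - (1 - 1 / N t) * φ t x) = if bad t x then w x else 0 := by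
      intro t _
      have h1 := hN t
      have h2 : N t - 1 ≠ 0 := by linarith
      have h3 : N t ≠ 0 := by linarith
      split_ifs with hb
      · rw [hφ1 t x hx hb]; ring
      · rw [hφ2 t x hx hb]; field_simp; ring
    rw [Finset.sum_congr rfl hind]
    have hnn : ∀ t ∈ T, 0 ≤ (if bad t x then w x else 0) := by
      intro t _; split_ifs; exacts [hw0 x hx, le_rfl]
    obtain ⟨j, hj, hbj⟩ := hcon x hx
    rw [Finset.mem_union] at hj
    rcases hj with hj | hj
    · have : w x = 0 := by
        apply Finset.prod_eq_zero hj
        rw [hφ1 j x hx hbj]; norm_num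
      rw [this]; rw [this] at hnn; exact Finset.sum_nonneg hnn
    · have := Finset.single_le_sum hnn hj
      rwa [if_pos hbj] at this
  have hsum := Finset.sum_le_sum hpt
  rw [Finset.sum_comm, ← hW] at hsum
  have hterm : ∀ t ∈ T, ∑ x ∈ P, w x * (1 / N t - (1 - 1 / N t) * φ t x) ≤ W * (1 / N t) + (1 - 1 / N t) * (2 ^ S.card * E) := by
    intro t ht
    have e1 : ∑ x ∈ P, w x * (1 / N t - (1 - 1 / N t) * φ t x) = W * (1 / N t) - (1 - 1 / N t) * ∑ x ∈ P, w x * φ t x := by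
      rw [hW, Finset.sum_mul, Finset.mul_sum, ← Finset.sum_sub_distrib]
      apply Finset.sum_congr rfl; intros; ring
    rw [e1]
    have e2 := (abs_le.mp (hwt t ht)).1
    have h1 := hN t
    have e3 : 0 ≤ 1 - 1 / N t := by
      rw [sub_nonneg, div_le_one (by linarith)]; exact h1.le
    nlinarith
  have hsum2 := hsum.trans (Finset.sum_le_sum hterm)
  rw [Finset.sum_add_distrib, ← Finset.mul_sum, ← Finset.sum_mul, Finset.sum_sub_distrib] at hsum2
  simp only [Finset.sum_const, nsmul_eq_mul, mul_one] at hsum2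
  set σ := ∑ t ∈ T, 1 / N t with hσ
  set R := (2 : ℝ) ^ S.card * E with hR
  have hR0 : 0 ≤ R := by positivity
  have hc1 : δ * (W - R) > T.card * R := by nlinarith
  have hWR : 0 < W - R := by
    have : 0 ≤ (T.card : ℝ) * R := by positivity
    by_contra h
    push Not at h
    nlinarith
  have hc2 : δ * (W - R) ≤ (1 - σ) * (W - R) := mul_le_mul_of_nonneg_right hδ hWR.le
  nlinarith
end S12
end

section
open Polynomial
namespace S12

theorem char_sieve {α ι M : Type} [DecidableEq ι] [CommGroup M] (P : Finset α) (S T : Finset ι) (hST : Disjoint S T)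
    (N : ι → ℕ) (hN : ∀ j, 1 < N j) (bad : ι → α → Prop) (C : ι → Finset M) (ev : α → M → ℂ)
    (hev1 : ∀ x ∈ P, ev x 1 = 1) (hevm : ∀ x ∈ P, ∀ m m', ev x (m * m') = ev x m * ev x m')
    (hC : ∀ j, (C j).card = N j - 1)
    (hbad : ∀ j, ∀ x ∈ P, bad j x → ∑ c ∈ C j, ev x c = N j - 1)
    (hgood : ∀ j, ∀ x ∈ P, ¬ bad j x → ∑ c ∈ C j, ev x c = -1)
    (hind : ∀ J ⊆ S ∪ T, J.Nonempty → ∀ c : ι → M, (∀ j ∈ J, c j ∈ C j) → ∏ j ∈ J, c j ≠ 1)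
    (E : ℝ) (hE0 : 0 ≤ E)
    (hE : ∀ m : M, m ≠ 1 → ‖∑ x ∈ P, ev x m‖ ≤ E)
    (δ : ℝ) (hδ0 : 0 < δ) (hδ : δ ≤ 1 - ∑ t ∈ T, 1 / (N t : ℝ))
    (hcond : 2 ^ S.card * E * (T.card + 2 * δ) < δ * (P.card + E)) :
    ∃ x ∈ P, ∀ j ∈ S ∪ T, ¬ bad j x := by
  classical
  have hN1 : ∀ j, (1 : ℝ) < N j := fun j => by exact_mod_cast hN j
  let φ : ι → α → ℝ := fun j x => if bad j x then -1 else 1 / ((N j : ℝ) - 1)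
  have hφ : ∀ j, ∀ x ∈ P, ((φ j x : ℝ) : ℂ) = (-1 / ((N j : ℂ) - 1)) * ∑ c ∈ C j, ev x c := by
    intro j x hx
    have h0 : (N j : ℂ) - 1 ≠ 0 := by
      have h1 := hN1 j
      have : ((N j : ℝ) : ℂ) - 1 ≠ 0 := by
        rw [← Complex.ofReal_one, ← Complex.ofReal_sub, Complex.ofReal_ne_zero]; linarith
      simpa using this
    by_cases hb : bad j x
    · simp only [φ, if_pos hb]; rw [hbad j x hx hb]; push_cast; field_simp
    · simp only [φ, if_neg hb]; rw [hgood j x hx hb]; push_cast; field_simp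
  have evprod : ∀ x ∈ P, ∀ (s : Finset ι) (c : ι → M), ∏ j ∈ s, ev x (c j) = ev x (∏ j ∈ s, c j) := by
    intro x hx s c
    induction s using Finset.induction_on with
    | empty => simp [hev1 x hx]
    | insert a s ha ih => rw [Finset.prod_insert ha, Finset.prod_insert ha, hevm x hx, ih]
  refine sieve P S T hST (fun j => (N j : ℝ)) hN1 bad φ (fun j x _ hb => if_pos hb) (fun j x _ hb => if_neg hb) E hE0 ?_ δ hδ0 hδ hcond
  intro J hJ hJn
  have e1 : ((∑ x ∈ P, ∏ j ∈ J, φ j x : ℝ) : ℂ) = (∏ j ∈ J, (-1 / ((N j : ℂ) - 1))) *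
      ∑ c ∈ J.pi C, ∑ x ∈ P, ∏ j ∈ J.attach, ev x (c j.1 j.2) := by
    push_cast
    rw [Finset.sum_comm, Finset.mul_sum]
    apply Finset.sum_congr rfl
    intro x hx
    rw [← Finset.prod_sum J C (fun _ m => ev x m), ← Finset.prod_mul_distrib]
    exact Finset.prod_congr rfl (fun j _ => hφ j x hx)
  have e2 : ‖((∑ x ∈ P, ∏ j ∈ J, φ j x : ℝ) : ℂ)‖ = |∑ x ∈ P, ∏ j ∈ J, φ j x| := by
    rw [Complex.norm_real, Real.norm_eq_abs]
  rw [← e2, e1, norm_mul, norm_prod]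
  have e3 : ∀ j ∈ J, ‖(-1 / ((N j : ℂ) - 1))‖ = 1 / ((N j : ℝ) - 1) := by
    intro j _
    have : (-1 / ((N j : ℂ) - 1)) = (((-1 / ((N j : ℝ) - 1) : ℝ)) : ℂ) := by push_cast; rfl
    rw [this, Complex.norm_real, Real.norm_eq_abs, abs_div, abs_neg, abs_one, abs_of_pos]
    have := hN1 j; linarith
  rw [Finset.prod_congr rfl e3]
  have e4 : ‖∑ c ∈ J.pi C, ∑ x ∈ P, ∏ j ∈ J.attach, ev x (c j.1 j.2)‖ ≤ (∏ j ∈ J, ((N j : ℝ) - 1)) * E := by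
    refine (norm_sum_le _ _).trans ?_
    refine (Finset.sum_le_card_nsmul _ _ E ?_).trans ?_
    · intro c hc
      rw [Finset.mem_pi] at hc
      let c' : ι → M := fun j => if h : j ∈ J then c j h else 1
      have hc' : ∀ j (h : j ∈ J), c' j = c j h := fun j h => dif_pos h
      have e5 : ∀ x ∈ P, ∏ j ∈ J.attach, ev x (c j.1 j.2) = ev x (∏ j ∈ J, c' j) := by
        intro x hx
        rw [← evprod x hx, ← Finset.prod_attach J]
        exact Finset.prod_congr rfl (fun j _ => by rw [hc' j.1 j.2])
      rw [Finset.sum_congr rfl e5]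
      apply hE
      exact hind J hJ hJn c' (fun j hj => by rw [hc' j hj]; exact hc j hj)
    · rw [nsmul_eq_mul, Finset.card_pi]
      push_cast
      apply le_of_eq
      congr 1
      apply Finset.prod_congr rfl
      intro j _
      rw [hC, Nat.cast_sub (hN j).le, Nat.cast_one]
  have e6 : 0 ≤ ∏ j ∈ J, 1 / ((N j : ℝ) - 1) := by
    apply Finset.prod_nonneg; intro j _; have := hN1 j
    have : 0 < (N j : ℝ) - 1 := by linarith
    positivity
  refine (mul_le_mul_of_nonneg_left e4 e6).trans ?_
  rw [← mul_assoc, ← Finset.prod_mul_distrib]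
  have e7 : ∏ j ∈ J, 1 / ((N j : ℝ) - 1) * ((N j : ℝ) - 1) = 1 := by
    apply Finset.prod_eq_one
    intro j _
    have h1 := hN1 j
    have : (N j : ℝ) - 1 ≠ 0 := by linarith
    field_simp
  rw [e7, one_mul]
end S12
end

section
open Polynomial
namespace S12
set_option linter.unusedSectionVars false
section
variable (K L : Type) [Field K] [Fintype K] [Field L] [Fintype L] [Algebra K L]

/-- the Frobenius as a linear map -/
noncomputable def frob : Module.End K L := (FiniteField.frobeniusAlgHom K L).toLinearMap

theorem frob_apply (x : L) : frob K L x = x ^ Fintype.card K := rfl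

theorem frob_pow_apply (i : ℕ) (x : L) : (frob K L ^ i) x = x ^ Fintype.card K ^ i := by
  induction i generalizing x with
  | zero => simp
  | succ i ih => rw [pow_succ', Module.End.mul_apply, ih, frob_apply, ← pow_mul, pow_succ]

variable {K L}
theorem act_apply (h : K[X]) (x : L) :
    aeval (frob K L) h x = ∑ i ∈ Finset.range (h.natDegree + 1), algebraMap K L (h.coeff i) * x ^ Fintype.card K ^ i := by
  rw [aeval_eq_sum_range, LinearMap.sum_apply]
  apply Finset.sum_congr rfl
  intro i _
  rw [LinearMap.smul_apply, frob_pow_apply, Algebra.smul_def]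

theorem ker_le (h : K[X]) (hh : h ≠ 0) : Module.finrank K (LinearMap.ker (aeval (frob K L) h)) ≤ h.natDegree := by
  classical
  set q := Fintype.card K with hq
  have hq1 : 1 < q := Fintype.one_lt_card
  set P : L[X] := ∑ i ∈ Finset.range (h.natDegree + 1), C (algebraMap K L (h.coeff i)) * X ^ q ^ i with hP
  have hcoeff : P.coeff (q ^ h.natDegree) = algebraMap K L h.leadingCoeff := by
    rw [hP, finsetSum_coeff, Finset.sum_eq_single h.natDegree]
    · rw [coeff_C_mul, coeff_X_pow, if_pos rfl, mul_one]; rfl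
    · intro i _ hi
      rw [coeff_C_mul, coeff_X_pow, if_neg, mul_zero]
      intro h2; exact hi (Nat.pow_right_injective hq1 h2).symm
    · intro h2; exact absurd (Finset.self_mem_range_succ _) h2
  have hP0 : P ≠ 0 := by
    intro h0
    rw [h0, coeff_zero] at hcoeff
    have := (algebraMap K L).injective (hcoeff.symm.trans (map_zero _).symm)
    exact hh (leadingCoeff_eq_zero.mp this)
  have hdeg : P.natDegree ≤ q ^ h.natDegree := by
    apply natDegree_sum_le_of_forall_le
    intro i hi
    refine (natDegree_C_mul_X_pow_le _ _).trans (Nat.pow_le_pow_right (by omega) ?_)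
    rw [Finset.mem_range] at hi; omega
  have hev : ∀ x : L, P.eval x = aeval (frob K L) h x := by
    intro x; rw [act_apply, hP, eval_finsetSum]; simp [hq]
  have hsub : ((LinearMap.ker (aeval (frob K L) h) : Submodule K L) : Set L).toFinset ⊆ P.roots.toFinset := by
    intro x hx
    simp only [Set.mem_toFinset, SetLike.mem_coe, LinearMap.mem_ker] at hx
    rw [Multiset.mem_toFinset, mem_roots hP0, IsRoot.def, hev, hx]
  have hcard := (Finset.card_le_card hsub).trans ((Multiset.toFinset_card_le _).trans ((card_roots' P).trans hdeg))
  have h2 := Module.card_eq_pow_finrank (K := K) (V := LinearMap.ker (aeval (frob K L) h))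
  rw [Set.toFinset_card] at hcard
  have h3 : Fintype.card (LinearMap.ker (aeval (frob K L) h)) ≤ q ^ h.natDegree := by
    refine le_trans (le_of_eq ?_) hcard
    exact Fintype.card_congr (Equiv.refl _)
  rw [h2] at h3
  exact (Nat.pow_le_pow_iff_right hq1).mp h3

theorem act_top (n : ℕ) (hL : Fintype.card L = Fintype.card K ^ n) : aeval (frob K L) (X ^ n - 1 : K[X]) = 0 := by
  ext x
  rw [map_sub, map_pow, aeval_X, map_one, LinearMap.sub_apply, frob_pow_apply, ← hL, FiniteField.pow_card]
  simp

theorem finrank_KL (n : ℕ) (hL : Fintype.card L = Fintype.card K ^ n) : Module.finrank K L = n := by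
  rw [Module.card_eq_pow_finrank (K := K) (V := L)] at hL
  exact Nat.pow_right_injective Fintype.one_lt_card hL

theorem act_split (n : ℕ) (hn : 0 < n) (hL : Fintype.card L = Fintype.card K ^ n) (h g : K[X]) (hg : X ^ n - 1 = h * g) :
    LinearMap.range (aeval (frob K L) h) = LinearMap.ker (aeval (frob K L) g) ∧
    Nat.card (L ⧸ LinearMap.range (aeval (frob K L) h)) = Fintype.card K ^ h.natDegree := by
  have hne : (X ^ n - 1 : K[X]) ≠ 0 := (monic_X_pow_sub_C (1 : K) hn.ne').ne_zero
  have hh0 : h ≠ 0 := by rintro rfl; exact hne (by simpa using hg)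
  have hg0 : g ≠ 0 := by rintro rfl; exact hne (by simpa using hg)
  have hdeg : h.natDegree + g.natDegree = n := by
    rw [← natDegree_mul hh0 hg0, ← hg]; exact natDegree_X_pow_sub_C
  have hfr := finrank_KL (K := K) (L := L) n hL
  have h1 := ker_le (L := L) h hh0
  have h2 := ker_le (L := L) g hg0
  have h3 := LinearMap.finrank_range_add_finrank_ker (aeval (frob K L) h)
  have hle : LinearMap.range (aeval (frob K L) h) ≤ LinearMap.ker (aeval (frob K L) g) := by
    rintro _ ⟨y, rfl⟩
    rw [LinearMap.mem_ker, ← Module.End.mul_apply, ← map_mul, mul_comm g h, ← hg, act_top n hL]; rfl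
  have h4 := Submodule.finrank_mono hle
  constructor
  · apply Submodule.eq_of_le_of_finrank_le hle
    omega
  · have h5 := Submodule.finrank_quotient_add_finrank (LinearMap.range (aeval (frob K L) h))
    have h6 : Module.finrank K (L ⧸ LinearMap.range (aeval (frob K L) h)) = h.natDegree := by omega
    rw [Module.natCard_eq_pow_finrank (K := K), h6, Nat.card_eq_fintype_card]

theorem normal_of (n : ℕ) (hn : 0 < n) (hL : Fintype.card L = Fintype.card K ^ n) (α : L)
    (hα : ∀ h : K[X], h.Monic → Irreducible h → h ∣ X ^ n - 1 → α ∉ LinearMap.range (aeval (frob K L) h)) :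
    LinearIndependent K (fun i : Fin n => α ^ Fintype.card K ^ (i : ℕ)) ∧
    Submodule.span K (Set.range fun i : Fin n => α ^ Fintype.card K ^ (i : ℕ)) = ⊤ := by
  classical
  have hne : (X ^ n - 1 : K[X]) ≠ 0 := (monic_X_pow_sub_C (1 : K) hn.ne').ne_zero
  have hli : LinearIndependent K (fun i : Fin n => α ^ Fintype.card K ^ (i : ℕ)) := by
    rw [Fintype.linearIndependent_iff]
    intro c hc
    set u : K[X] := ∑ i : Fin n, C (c i) * X ^ (i : ℕ) with hu
    have hua : aeval (frob K L) u α = 0 := by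
      rw [hu, map_sum, LinearMap.sum_apply, ← hc]
      apply Finset.sum_congr rfl
      intro i _
      rw [map_mul, aeval_C, map_pow, aeval_X, Module.End.mul_apply, frob_pow_apply]; rfl
    have hud : u.degree < n := by
      rw [hu]
      refine (degree_sum_le _ _).trans_lt ?_
      refine (Finset.sup_lt_iff (WithBot.bot_lt_coe n)).mpr ?_
      intro i _
      exact (degree_C_mul_X_pow_le _ _).trans_lt (WithBot.coe_lt_coe.mpr i.2)
    have hu0 : u = 0 := by
      by_contra hu0
      obtain ⟨w, hw⟩ := EuclideanDomain.gcd_dvd_right u (X ^ n - 1)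
      set m := EuclideanDomain.gcd u (X ^ n - 1) with hm
      have hma : aeval (frob K L) m α = 0 := by
        rw [hm, EuclideanDomain.gcd_eq_gcd_ab, map_add, mul_comm u, map_mul, map_mul, act_top n hL, zero_mul, add_zero,
          Module.End.mul_apply, hua, map_zero]
      have hmd : m.natDegree < n := by
        have h1 : m.natDegree ≤ u.natDegree := natDegree_le_of_dvd (EuclideanDomain.gcd_dvd_left u (X ^ n - 1)) hu0
        have h2 := (natDegree_lt_iff_degree_lt hu0).mpr hud
        omega
      have hw0 : w ≠ 0 := by rintro rfl; rw [mul_zero] at hw; exact hne hw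
      have hm0 : m ≠ 0 := by intro h; rw [h, zero_mul] at hw; exact hne hw
      have hwd : ¬ IsUnit w := by
        intro hwu
        have h3 : (X ^ n - 1 : K[X]).natDegree = n := natDegree_X_pow_sub_C
        rw [hw, natDegree_mul hm0 hw0, natDegree_eq_zero_of_isUnit hwu] at h3
        omega
      obtain ⟨h, hhm, hhi, w', rfl⟩ := exists_monic_irreducible_factor w hwd
      refine hα h hhm hhi ⟨m * w', by rw [hw]; ring⟩ ?_
      rw [(act_split n hn hL h (m * w') (by rw [hw]; ring)).1, LinearMap.mem_ker, mul_comm m, map_mul, Module.End.mul_apply, hma, map_zero]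
    intro i
    have h5 : u.coeff (i : ℕ) = c i := by
      rw [hu, finsetSum_coeff, Finset.sum_eq_single i]
      · simp
      · intro j _ hj
        rw [coeff_C_mul, coeff_X_pow, if_neg, mul_zero]
        intro h; exact hj (Fin.ext h.symm)
      · simp
    rw [← h5, hu0, coeff_zero]
  refine ⟨hli, hli.span_eq_top_of_card_eq_finrank' ?_⟩
  rw [Fintype.card_fin, finrank_KL n hL]
end

theorem prim_of {L : Type} [Field L] [Fintype L] (α : L) (h0 : α ≠ 0)
    (h : ∀ p : ℕ, p.Prime → p ∣ Fintype.card L - 1 → ∃ χ : MulChar L ℂ, χ ^ p = 1 ∧ χ α ≠ 1) :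
    orderOf α = Fintype.card L - 1 := by
  classical
  have hc : 0 < Fintype.card L - 1 := by have := Fintype.one_lt_card (α := L); omega
  refine orderOf_eq_of_pow_and_pow_div_prime hc (FiniteField.pow_card_sub_one_eq_one α h0) ?_
  intro p hp hpd h1
  obtain ⟨χ, hχ, hχα⟩ := h p hp hpd
  apply hχα
  obtain ⟨γ, hγ⟩ := IsCyclic.exists_generator (α := Lˣ)
  have hγo : orderOf γ = Fintype.card L - 1 := by
    rw [orderOf_eq_card_of_forall_mem_zpowers hγ, Nat.card_eq_fintype_card, Fintype.card_units]
  have h2 := hγ (Units.mk0 α h0)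
  rw [← mem_powers_iff_mem_zpowers] at h2
  obtain ⟨k, hk⟩ := h2
  simp only at hk
  have h3 : γ ^ (k * ((Fintype.card L - 1) / p)) = 1 := by
    rw [pow_mul, hk]; ext; simpa using h1
  have h4 := orderOf_dvd_of_pow_eq_one h3
  rw [hγo] at h4
  obtain ⟨c, hc'⟩ := hpd
  rw [hc', Nat.mul_div_cancel_left _ hp.pos, mul_comm p c, mul_comm k c] at h4
  have hc0 : 0 < c := by by_contra h; have : c = 0 := by omega
                         rw [this] at hc'; omega
  obtain ⟨e, rfl⟩ := Nat.dvd_of_mul_dvd_mul_left hc0 h4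
  have h5 : α = ((γ : L) ^ e) ^ p := by
    rw [← pow_mul, mul_comm e p]
    have := congrArg Units.val hk
    simpa using this.symm
  rw [h5, map_pow, ← MulChar.pow_apply' _ hp.ne_zero, hχ, MulChar.one_apply]
  exact (γ.isUnit).pow e
end S12
end

section
open Polynomial
namespace S12
set_option linter.unusedSectionVars false

theorem hind_of {ι M : Type} [DecidableEq ι] [CommGroup M] (C : ι → Finset M)
    (h : ∀ j0, ∃ (M' : Type) (_ : CommGroup M') (e : M →* M'), (∀ j, j ≠ j0 → ∀ c ∈ C j, e c = 1) ∧ ∀ c ∈ C j0, e c ≠ 1)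
    (J : Finset ι) (hJ : J.Nonempty) (c : ι → M) (hc : ∀ j ∈ J, c j ∈ C j) : ∏ j ∈ J, c j ≠ 1 := by
  obtain ⟨j0, hj0⟩ := hJ
  obtain ⟨M', _, e, h1, h2⟩ := h j0
  intro h3
  apply h2 (c j0) (hc j0 hj0)
  have h4 := congrArg e h3
  rw [map_prod, map_one, Finset.prod_eq_single j0] at h4
  · exact h4
  · intro j hj hne; exact h1 j hne _ (hc j hj)
  · intro h; exact absurd hj0 h

theorem exists_ord {L : Type} [Field L] [Fintype L] (p : ℕ) (hp : p.Prime) (hd : p ∣ Fintype.card L - 1) :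
    ∃ χ : MulChar L ℂ, orderOf χ = p := by
  classical
  have := Fact.mk hp
  apply exists_prime_orderOf_dvd_card' p
  rw [MulChar.card_eq_card_units_of_hasEnoughRootsOfUnity, Nat.card_eq_fintype_card, Fintype.card_units]
  exact hd

theorem geom_char (p : ℕ) (hp : p.Prime) (z : ℂ) (hz : z ^ p = 1) :
    ∑ i ∈ Finset.range (p-1), z ^ (i+1) = if z = 1 then (p : ℂ) - 1 else -1 := by
  have h1 : ∑ i ∈ Finset.range p, z ^ i = 1 + ∑ i ∈ Finset.range (p-1), z ^ (i+1) := by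
    obtain ⟨m, rfl⟩ : ∃ m, p = m + 1 := ⟨p-1, by have := hp.pos; omega⟩
    rw [Finset.sum_range_succ', Nat.add_sub_cancel, pow_zero, add_comm]
  split_ifs with h
  · subst h
    simp [Nat.cast_sub hp.one_le]
  · have h2 := geom_sum_eq h p
    rw [hz, sub_self, zero_div, h1] at h2
    linear_combination h2

/-- the nontrivial powers of a character -/
noncomputable def powSet {M : Type} [CommGroup M] [DecidableEq M] (χ : M) (p : ℕ) : Finset M :=
  (Finset.range (p-1)).image (fun i => χ ^ (i+1))

theorem powSet_inj {M : Type} [CommGroup M] (χ : M) (p : ℕ) (h : orderOf χ = p) :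
    Set.InjOn (fun i => χ ^ (i+1)) (Finset.range (p-1) : Set ℕ) := by
  intro i hi j hj hij
  simp only [Finset.coe_range, Set.mem_Iio] at hi hj
  have := pow_injOn_Iio_orderOf (x := χ) (by simp; omega) (by simp; omega) hij
  omega

theorem powSet_card {M : Type} [CommGroup M] [DecidableEq M] (χ : M) (p : ℕ) (h : orderOf χ = p) :
    (powSet χ p).card = p - 1 := by
  rw [powSet, Finset.card_image_of_injOn (powSet_inj χ p h), Finset.card_range]

theorem powSet_pow {M : Type} [CommGroup M] [DecidableEq M] (χ : M) (p : ℕ) (hp : p.Prime) (h : orderOf χ = p) (r : ℕ)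
    (hr : ¬ p ∣ r) (c : M) (hc : c ∈ powSet χ p) : c ^ r ≠ 1 := by
  rw [powSet, Finset.mem_image] at hc
  obtain ⟨i, hi, rfl⟩ := hc
  rw [Finset.mem_range] at hi
  rw [← pow_mul]
  intro h1
  have h2 := orderOf_dvd_of_pow_eq_one h1
  rw [h] at h2
  rcases hp.dvd_mul.mp h2 with h3 | h3
  · have := Nat.le_of_dvd (by omega) h3; omega
  · exact hr h3

theorem powSet_pow_one {M : Type} [CommGroup M] [DecidableEq M] (χ : M) (p : ℕ) (h : orderOf χ = p) (r : ℕ)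
    (hr : p ∣ r) (c : M) (hc : c ∈ powSet χ p) : c ^ r = 1 := by
  rw [powSet, Finset.mem_image] at hc
  obtain ⟨i, hi, rfl⟩ := hc
  obtain ⟨s, rfl⟩ := hr
  rw [← pow_mul, mul_comm, mul_assoc, pow_mul, ← h, pow_orderOf_eq_one, one_pow]

instance quoFin {K L : Type} [Field K] [Field L] [Finite L] [Algebra K L] (R : Submodule K L) : Finite (L ⧸ R) :=
  Finite.of_surjective _ (Submodule.mkQ_surjective R)

/-- nontrivial characters of the quotient -/
noncomputable def quoSet {K L : Type} [Field K] [Field L] [Finite L] [Algebra K L] (R : Submodule K L) : Finset (AddChar L ℂ) := by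
  classical
  exact (Finset.univ.erase (1 : AddChar (L ⧸ R) ℂ)).image (fun ψ => ψ.compAddMonoidHom R.mkQ.toAddMonoidHom)

section
variable {K L : Type} [Field K] [Field L] [Finite L] [Algebra K L] (R : Submodule K L)
theorem quoSet_inj : Function.Injective (fun ψ : AddChar (L ⧸ R) ℂ => ψ.compAddMonoidHom R.mkQ.toAddMonoidHom) :=
  AddChar.compAddMonoidHom_injective_left _ (Submodule.mkQ_surjective R)

theorem quoSet_card : (quoSet R).card = Nat.card (L ⧸ R) - 1 := by
  classical
  have : Fintype (L ⧸ R) := Fintype.ofFinite _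
  rw [quoSet, Finset.card_image_of_injective _ (quoSet_inj R), Finset.card_erase_of_mem (Finset.mem_univ _), Finset.card_univ,
    AddChar.card_eq, Nat.card_eq_fintype_card]

theorem quoSet_sum (x : L) [Decidable (x ∈ R)] : ∑ c ∈ quoSet R, c x = if x ∈ R then (Nat.card (L ⧸ R) : ℂ) - 1 else -1 := by
  classical
  have : Fintype (L ⧸ R) := Fintype.ofFinite _
  rw [quoSet, Finset.sum_image (fun a _ b _ h => quoSet_inj R h)]
  have h1 := AddChar.sum_apply_eq_ite (Submodule.Quotient.mk (p := R) x)
  rw [← Finset.sum_erase_add _ _ (Finset.mem_univ (1 : AddChar (L ⧸ R) ℂ)), Submodule.Quotient.mk_eq_zero, AddChar.one_apply] at h1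
  rw [← eq_sub_iff_add_eq] at h1
  refine Eq.trans ?_ (h1.trans ?_)
  · rfl
  · rw [Nat.card_eq_fintype_card]; split_ifs <;> simp

theorem quoSet_ne_one (c : AddChar L ℂ) (hc : c ∈ quoSet R) : c ≠ 1 := by
  classical
  rw [quoSet, Finset.mem_image] at hc
  obtain ⟨ψ, hψ, rfl⟩ := hc
  rw [Finset.mem_erase] at hψ
  intro h
  apply hψ.1
  apply quoSet_inj R
  refine h.trans ?_
  ext x; rfl

theorem quoSet_triv (c : AddChar L ℂ) (hc : c ∈ quoSet R) (x : L) (hx : x ∈ R) : c x = 1 := by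
  classical
  rw [quoSet, Finset.mem_image] at hc
  obtain ⟨ψ, hψ, rfl⟩ := hc
  have : R.mkQ.toAddMonoidHom x = 0 := by
    simpa using hx
  rw [AddChar.compAddMonoidHom_apply, this, AddChar.map_zero_eq_one]
end

/-- composition with an additive endomorphism, as a homomorphism of character groups -/
noncomputable def compHom {L : Type} [Field L] (u : L →+ L) : AddChar L ℂ →* AddChar L ℂ where
  toFun c := c.compAddMonoidHom u
  map_one' := by ext x; rfl
  map_mul' a b := by ext x; rfl
end S12
end

section
open Polynomial
namespace S12
set_option linter.unusedSectionVars false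

theorem idx_card {α β : Type} [DecidableEq α] [DecidableEq β] (A : Finset α) (B : Finset β) (S1 : Finset α) (S2 : Finset β)
    (h1 : ∀ x ∈ S1, x ∈ A) (h2 : ∀ x ∈ S2, x ∈ B) :
    (((S1.subtype (· ∈ A)).disjSum (S1.subtype (· ∈ A))).disjSum (S2.subtype (· ∈ B))).card = 2 * S1.card + S2.card := by
  rw [Finset.card_disjSum, Finset.card_disjSum, Finset.card_subtype, Finset.card_subtype, Finset.filter_true_of_mem h1, Finset.filter_true_of_mem h2]
  ring

theorem idx_sum {α β : Type} [DecidableEq α] [DecidableEq β] (A : Finset α) (B : Finset β) (S1 : Finset α) (S2 : Finset β)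
    (h1 : ∀ x ∈ S1, x ∈ A) (h2 : ∀ x ∈ S2, x ∈ B) (u : α → ℝ) (v : β → ℝ) (w : (A ⊕ A) ⊕ B → ℝ)
    (hw1 : ∀ p, w (Sum.inl (Sum.inl p)) = u p) (hw2 : ∀ p, w (Sum.inl (Sum.inr p)) = u p) (hw3 : ∀ p, w (Sum.inr p) = v p) :
    ∑ t ∈ (((S1.subtype (· ∈ A)).disjSum (S1.subtype (· ∈ A))).disjSum (S2.subtype (· ∈ B))), w t = 2 * ∑ x ∈ S1, u x + ∑ x ∈ S2, v x := by
  rw [Finset.sum_disjSum, Finset.sum_disjSum]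
  simp only [hw1, hw2, hw3]
  rw [Finset.sum_subtype_of_mem u h1, Finset.sum_subtype_of_mem v h2]
  ring

theorem idx_disj {α β : Type} [DecidableEq α] [DecidableEq β] (A : Finset α) (B : Finset β) (S1 T1 : Finset α) (S2 T2 : Finset β)
    (h1 : Disjoint S1 T1) (h2 : Disjoint S2 T2) :
    Disjoint (((S1.subtype (· ∈ A)).disjSum (S1.subtype (· ∈ A))).disjSum (S2.subtype (· ∈ B)))
     (((T1.subtype (· ∈ A)).disjSum (T1.subtype (· ∈ A))).disjSum (T2.subtype (· ∈ B))) := by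
  rw [Finset.disjoint_left]
  rintro ((p | p) | h) hs ht
  · simp at hs ht; exact Finset.disjoint_left.mp h1 hs ht
  · simp at hs ht; exact Finset.disjoint_left.mp h1 hs ht
  · simp at hs ht; exact Finset.disjoint_left.mp h2 hs ht

theorem idx_all {α β : Type} [DecidableEq α] [DecidableEq β] (A : Finset α) (B : Finset β) (S1 T1 : Finset α) (S2 T2 : Finset β)
    (h1 : ∀ p ∈ A, p ∈ S1 ∨ p ∈ T1) (h2 : ∀ p ∈ B, p ∈ S2 ∨ p ∈ T2) (j : (A ⊕ A) ⊕ B) :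
    j ∈ (((S1.subtype (· ∈ A)).disjSum (S1.subtype (· ∈ A))).disjSum (S2.subtype (· ∈ B))) ∪
     (((T1.subtype (· ∈ A)).disjSum (T1.subtype (· ∈ A))).disjSum (T2.subtype (· ∈ B))) := by
  rcases j with ((p | p) | h)
  · have := h1 p p.2; simpa using this
  · have := h1 p p.2; simpa using this
  · have := h2 h h.2; simpa using this

theorem nonroot_card {L : Type} [Field L] [Fintype L] (f1 f2 : L[X]) (hf1 : f1 ≠ 0) (hf2 : f2 ≠ 0)
    (hd1 : f1.natDegree ≤ 3) (hd2 : f2.natDegree ≤ 2) (P : Finset L)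
    (hP : ∀ x, x ≠ 0 → f1.eval x ≠ 0 → f2.eval x ≠ 0 → x ∈ P) : (Fintype.card L : ℝ) - 6 ≤ P.card := by
  classical
  have hD0 : X * f1 * f2 ≠ 0 := mul_ne_zero (mul_ne_zero X_ne_zero hf1) hf2
  have hcard : (X * f1 * f2).roots.toFinset.card ≤ 6 := by
    refine (Multiset.toFinset_card_le _).trans ((card_roots' _).trans ?_)
    rw [natDegree_mul (mul_ne_zero X_ne_zero hf1) hf2, natDegree_mul X_ne_zero hf1, natDegree_X]
    omega
  have h3 : (Finset.univ : Finset L) ⊆ P ∪ (X * f1 * f2).roots.toFinset := by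
    intro x _
    rw [Finset.mem_union, Multiset.mem_toFinset, mem_roots hD0, IsRoot.def, eval_mul, eval_mul, eval_X]
    by_cases h0 : x = 0
    · right; rw [h0]; simp
    by_cases h1 : f1.eval x = 0
    · right; rw [h1]; simp
    by_cases h2 : f2.eval x = 0
    · right; rw [h2]; simp
    exact Or.inl (hP x h0 h1 h2)
  have h4 := (Finset.card_le_card h3).trans (Finset.card_union_le _ _)
  rw [Finset.card_univ] at h4
  have h5 : (Fintype.card L : ℝ) ≤ P.card + (X * f1 * f2).roots.toFinset.card := by exact_mod_cast h4
  have h6 : ((X * f1 * f2).roots.toFinset.card : ℝ) ≤ 6 := by exact_mod_cast hcard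
  linarith

section
variable {K L : Type} [Field K] [Fintype K] [Field L] [Fintype L] [Algebra K L]

theorem add_indep (h r : K[X]) (hc : IsCoprime h r) (c : AddChar L ℂ)
    (h1 : ∀ x ∈ LinearMap.range (aeval (frob K L) h), c x = 1) (h2 : ∀ y, c (aeval (frob K L) r y) = 1) : c = 1 := by
  ext y
  obtain ⟨u, v, huv⟩ := hc
  have e : y = aeval (frob K L) h (aeval (frob K L) u y) + aeval (frob K L) r (aeval (frob K L) v y) := by
    rw [← Module.End.mul_apply, ← Module.End.mul_apply, ← LinearMap.add_apply, ← map_mul, ← map_mul, ← map_add, mul_comm h, mul_comm r, huv,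
      map_one, Module.End.one_apply]
  rw [e, AddChar.map_add_eq_mul, h1 _ ⟨_, rfl⟩, h2, AddChar.one_apply, one_mul]

set_option maxHeartbeats 2000000 in
theorem criterion (n : ℕ) (hn : 0 < n) (hL : Fintype.card L = Fintype.card K ^ n)
    (f1 f2 : L[X]) (hf1 : f1 ≠ 0) (hf2 : f2 ≠ 0)
    (hd1 : f1.natDegree ≤ 3) (hd2 : f2.natDegree ≤ 2) (hc : IsCoprime f1 f2) (k : ℕ) (g : L[X])
    (hgm : g.Monic) (hgi : Irreducible g) (hgX : g ≠ X) (hk : Nat.gcd k (Fintype.card L - 1) = 1)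
    (hg1 : g ^ k ∣ f1 * f2) (hg2 : ¬ g ^ (k+1) ∣ f1 * f2)
    (A : Finset ℕ) (hA : A = (Fintype.card L - 1).primeFactors)
    (B : Finset K[X]) (hB : ∀ h, h ∈ B ↔ (h.Monic ∧ Irreducible h ∧ h ∣ X ^ n - 1))
    (S1 T1 : Finset ℕ) (S2 T2 : Finset K[X]) (h1d : Disjoint S1 T1) (h1u : S1 ∪ T1 = A)
    (h2d : Disjoint S2 T2) (hS2B : ∀ h ∈ S2, h ∈ B) (hT2B : ∀ h ∈ T2, h ∈ B) (h2u : ∀ h ∈ B, h ∈ S2 ∨ h ∈ T2)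
    (δ : ℝ) (hδ0 : 0 < δ) (hδ : δ ≤ 1 - (2 * ∑ p ∈ T1, 1 / (p : ℝ) + ∑ h ∈ T2, 1 / (Fintype.card K : ℝ) ^ h.natDegree))
    (hcond : 2 ^ (2 * S1.card + S2.card) * 6 * (2 * T1.card + T2.card + 2 * δ) < δ * √(Fintype.card L)) :
    ∃ α : L, f2.eval α ≠ 0 ∧ orderOf α = Fintype.card L - 1 ∧
     (LinearIndependent K (fun i : Fin n => α ^ Fintype.card K ^ (i : ℕ)) ∧
    Submodule.span K (Set.range fun i : Fin n => α ^ Fintype.card K ^ (i : ℕ)) = ⊤) ∧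
    orderOf (f1.eval α / f2.eval α) = Fintype.card L - 1 := by
  classical
  have hAp : ∀ p : A, (p : ℕ).Prime := by
    rintro ⟨p, hp⟩; rw [hA] at hp; exact Nat.prime_of_mem_primeFactors hp
  have hAd : ∀ p : A, (p : ℕ) ∣ Fintype.card L - 1 := by
    rintro ⟨p, hp⟩; rw [hA] at hp; exact Nat.dvd_of_mem_primeFactors hp
  choose χ hχ using fun p : A => exists_ord (L := L) p.1 (hAp p) (hAd p)
  let R : K[X] → Submodule K L := fun h => LinearMap.range (aeval (frob K L) h)
  have hRN : ∀ h : B, Nat.card (L ⧸ R h) = Fintype.card K ^ (h : K[X]).natDegree := by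
    intro h
    obtain ⟨_, _, g', hg'⟩ := (hB h).mp h.2
    exact (act_split n hn hL h g' hg').2
  let M := MulChar L ℂ × MulChar L ℂ × AddChar L ℂ
  let ι := (A ⊕ A) ⊕ B
  let i1 : MulChar L ℂ → M := fun c => (c, 1, 1)
  let i2 : MulChar L ℂ → M := fun c => (1, c, 1)
  let i3 : AddChar L ℂ → M := fun c => (1, 1, c)
  have i1i : Function.Injective i1 := fun a b h => congrArg Prod.fst h
  have i2i : Function.Injective i2 := fun a b h => congrArg (fun m : M => m.2.1) h
  have i3i : Function.Injective i3 := fun a b h => congrArg (fun m : M => m.2.2) h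
  let fr : L → L := fun x => f1.eval x / f2.eval x
  let ev : L → M → ℂ := fun x m => m.1 x * m.2.1 (fr x) * m.2.2 x
  let P : Finset L := Finset.univ.filter (fun x => x ≠ 0 ∧ f1.eval x ≠ 0 ∧ f2.eval x ≠ 0)
  have hfr0 : ∀ x ∈ P, fr x ≠ 0 := fun x hx => by
    simp only [P, Finset.mem_filter] at hx
    exact div_ne_zero hx.2.2.1 hx.2.2.2
  have hx0 : ∀ x ∈ P, x ≠ 0 := fun x hx => by
    simp only [P, Finset.mem_filter] at hx
    exact hx.2.1
  have hone : ∀ y : L, y ≠ 0 → (1 : MulChar L ℂ) y = 1 := fun y hy => MulChar.one_apply (isUnit_iff_ne_zero.mpr hy)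
  let N : ι → ℕ := Sum.elim (Sum.elim (fun p => p.1) (fun p => p.1)) (fun h => Fintype.card K ^ (h : K[X]).natDegree)
  let C : ι → Finset M := Sum.elim (Sum.elim (fun p => (powSet (χ p) p).image i1) (fun p => (powSet (χ p) p).image i2))
    (fun h => (quoSet (R h)).image i3)
  let bad : ι → L → Prop := Sum.elim (Sum.elim (fun p x => χ p x = 1) (fun p x => χ p (fr x) = 1)) (fun h x => x ∈ R h)
  have hsumpow : ∀ (p : A) (y : L), y ≠ 0 → ∑ c ∈ powSet (χ p) p, c y = if χ p y = 1 then ((p : ℕ) : ℂ) - 1 else -1 := by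
    intro p y hy
    rw [powSet, Finset.sum_image (powSet_inj _ _ (hχ p)), ← geom_char p (hAp p)]
    · exact Finset.sum_congr rfl (fun i _ => MulChar.pow_apply' _ (by omega) _)
    · rw [← MulChar.pow_apply' _ (hAp p).ne_zero]
      conv_lhs => rw [← hχ p]
      rw [pow_orderOf_eq_one, hone y hy]
  have hsum : ∀ j, ∀ x ∈ P, ∑ c ∈ C j, ev x c = if bad j x then ((N j : ℕ) : ℂ) - 1 else -1 := by
    rintro ((p | p) | h) x hx
    · simp only [C, bad, N, Sum.elim_inl]
      rw [Finset.sum_image (fun a _ b _ h => i1i h)]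
      have hh := hsumpow p x (hx0 x hx)
      refine Eq.trans ?_ (hh.trans (by congr))
      apply Finset.sum_congr rfl
      intro c _
      simp only [ev, i1, hone _ (hfr0 x hx), AddChar.one_apply, mul_one]
    · simp only [C, bad, N, Sum.elim_inl, Sum.elim_inr]
      rw [Finset.sum_image (fun a _ b _ h => i2i h)]
      have hh := hsumpow p (fr x) (hfr0 x hx)
      refine Eq.trans ?_ (hh.trans (by congr))
      apply Finset.sum_congr rfl
      intro c _
      simp only [ev, i2, hone _ (hx0 x hx), AddChar.one_apply, mul_one, one_mul]
    · simp only [C, bad, N, Sum.elim_inr]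
      rw [Finset.sum_image (fun a _ b _ h => i3i h), ← hRN h]
      have := quoSet_sum (R h) x
      refine Eq.trans ?_ (this.trans (by congr))
      apply Finset.sum_congr rfl
      intro c _
      simp only [ev, i3, hone _ (hx0 x hx), hone _ (hfr0 x hx), one_mul]
  have hind : ∀ j0, ∃ (M' : Type) (_ : CommGroup M') (e : M →* M'), (∀ j, j ≠ j0 → ∀ c ∈ C j, e c = 1) ∧ ∀ c ∈ C j0, e c ≠ 1 := by
    have hr1 : ∀ p : A, ¬ (p : ℕ) ∣ ∏ q ∈ A.erase p, q := by
      intro p hd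
      rw [Prime.dvd_finsetProd_iff (hAp p).prime] at hd
      obtain ⟨q, hq, hpq⟩ := hd
      rw [Finset.mem_erase] at hq
      exact hq.1 ((Nat.prime_dvd_prime_iff_eq (hAp p) (hAp ⟨q, hq.2⟩)).mp hpq).symm
    have hr2 : ∀ p q : A, q ≠ p → (q : ℕ) ∣ ∏ q ∈ A.erase p, q := by
      intro p q hq
      exact Finset.dvd_prod_of_mem (fun q => q) (Finset.mem_erase.mpr ⟨fun h => hq (Subtype.ext h), q.2⟩)
    rintro ((p | p) | h)
    · refine ⟨MulChar L ℂ, inferInstance, (powMonoidHom (∏ q ∈ A.erase p, q)).comp (MonoidHom.fst _ _), ?_, ?_⟩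
      · rintro ((q | q) | h) hj c hc
        · obtain ⟨c', hc', rfl⟩ := Finset.mem_image.mp hc
          exact powSet_pow_one (χ q) q (hχ q) _ (hr2 p q (fun h => hj (by rw [h]))) c' hc'
        · obtain ⟨c', hc', rfl⟩ := Finset.mem_image.mp hc
          exact one_pow _
        · obtain ⟨c', hc', rfl⟩ := Finset.mem_image.mp hc
          exact one_pow _
      · intro c hc
        obtain ⟨c', hc', rfl⟩ := Finset.mem_image.mp hc
        exact powSet_pow (χ p) p (hAp p) (hχ p) _ (hr1 p) c' hc'
    · refine ⟨MulChar L ℂ, inferInstance, ((powMonoidHom (∏ q ∈ A.erase p, q)).comp (MonoidHom.fst _ _)).comp (MonoidHom.snd _ _), ?_, ?_⟩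
      · rintro ((q | q) | h) hj c hc
        · obtain ⟨c', hc', rfl⟩ := Finset.mem_image.mp hc
          exact one_pow _
        · obtain ⟨c', hc', rfl⟩ := Finset.mem_image.mp hc
          exact powSet_pow_one (χ q) q (hχ q) _ (hr2 p q (fun h => hj (by rw [h]))) c' hc'
        · obtain ⟨c', hc', rfl⟩ := Finset.mem_image.mp hc
          exact one_pow _
      · intro c hc
        obtain ⟨c', hc', rfl⟩ := Finset.mem_image.mp hc
        exact powSet_pow (χ p) p (hAp p) (hχ p) _ (hr1 p) c' hc'
    · refine ⟨AddChar L ℂ, inferInstance, ((compHom (aeval (frob K L) (∏ q ∈ B.erase h, q)).toAddMonoidHom).comp (MonoidHom.snd _ _)).comp (MonoidHom.snd _ _), ?_, ?_⟩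
      · rintro ((q | q) | h') hj c hc
        · obtain ⟨c', hc', rfl⟩ := Finset.mem_image.mp hc
          exact map_one (compHom _)
        · obtain ⟨c', hc', rfl⟩ := Finset.mem_image.mp hc
          exact map_one (compHom _)
        · obtain ⟨c', hc', rfl⟩ := Finset.mem_image.mp hc
          have hd : (h' : K[X]) ∣ ∏ q ∈ B.erase h, q :=
            Finset.dvd_prod_of_mem (fun q => q) (Finset.mem_erase.mpr ⟨fun h => hj (by rw [Subtype.ext h]), h'.2⟩)
          obtain ⟨w, hw⟩ := hd
          ext y
          change c' (aeval (frob K L) (∏ q ∈ B.erase h, q) y) = 1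
          apply quoSet_triv (R h') c' hc'
          rw [hw, map_mul, Module.End.mul_apply]
          exact ⟨_, rfl⟩
      · intro c hc
        obtain ⟨c', hc', rfl⟩ := Finset.mem_image.mp hc
        intro h1
        apply quoSet_ne_one (R h) c' hc'
        refine add_indep (K := K) h.1 (∏ q ∈ B.erase h, q) ?_ c' (fun x hx => quoSet_triv (R h) c' hc' x hx) ?_
        · apply IsCoprime.prod_right
          intro q hq
          rw [Finset.mem_erase] at hq
          obtain ⟨m1, r1, _⟩ := (hB h).mp h.2
          obtain ⟨m2, r2, _⟩ := (hB q).mp hq.2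
          refine (r1.coprime_iff_not_dvd).mpr (fun hdv => hq.1 ?_)
          exact (eq_of_monic_of_associated m1 m2 (r1.associated_of_dvd r2 hdv)).symm
        · intro y
          exact DFunLike.congr_fun h1 y
  have hNgt : ∀ j, 1 < N j := by
    rintro ((p | p) | h)
    · exact (hAp p).one_lt
    · exact (hAp p).one_lt
    · exact Nat.one_lt_pow ((hB h).mp h.2).2.1.natDegree_pos.ne' Fintype.one_lt_card
  let S : Finset ι := ((S1.subtype (· ∈ A)).disjSum (S1.subtype (· ∈ A))).disjSum (S2.subtype (· ∈ B))
  let T : Finset ι := ((T1.subtype (· ∈ A)).disjSum (T1.subtype (· ∈ A))).disjSum (T2.subtype (· ∈ B))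
  have hA12 : ∀ p ∈ A, p ∈ S1 ∨ p ∈ T1 := fun p hp => by rwa [← h1u, Finset.mem_union] at hp
  have hS1A : ∀ x ∈ S1, x ∈ A := fun x hx => h1u ▸ Finset.mem_union_left _ hx
  have hT1A : ∀ x ∈ T1, x ∈ A := fun x hx => h1u ▸ Finset.mem_union_right _ hx
  have hScard : S.card = 2 * S1.card + S2.card := idx_card A B S1 S2 hS1A hS2B
  have hTcard : T.card = 2 * T1.card + T2.card := idx_card A B T1 T2 hT1A hT2B
  have hST : Disjoint S T := idx_disj A B S1 T1 S2 T2 h1d h2d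
  have hall : ∀ j, j ∈ S ∪ T := idx_all A B S1 T1 S2 T2 hA12 h2u
  have hTsum : ∑ t ∈ T, 1 / (N t : ℝ) = 2 * ∑ p ∈ T1, 1 / (p : ℝ) + ∑ h ∈ T2, 1 / (Fintype.card K : ℝ) ^ h.natDegree := by
    refine idx_sum A B T1 T2 hT1A hT2B (fun p => 1 / (p : ℝ)) (fun h => 1 / (Fintype.card K : ℝ) ^ h.natDegree) _ ?_ ?_ ?_
    · intro p; rfl
    · intro p; rfl
    · intro p; simp only [N, Sum.elim_inr]; push_cast; rfl
  have hPc : (Fintype.card L : ℝ) - 6 ≤ P.card := nonroot_card f1 f2 hf1 hf2 hd1 hd2 P (fun x h0 h1 h2 => Finset.mem_filter.mpr ⟨Finset.mem_univ _, h0, h1, h2⟩)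
  have hsq1 : 1 ≤ √(Fintype.card L : ℝ) := by
    rw [Real.one_le_sqrt]; exact_mod_cast Fintype.card_pos
  have hsq : √(Fintype.card L : ℝ) * √(Fintype.card L : ℝ) = Fintype.card L := Real.mul_self_sqrt (by positivity)
  have key : ∃ x ∈ P, ∀ j ∈ S ∪ T, ¬ bad j x := by
    refine char_sieve P S T hST N hNgt bad C ev ?_ ?_ ?_ ?_
      ?_ (fun J _ hJ c hc => hind_of C hind J hJ c hc) (6 * √(Fintype.card L)) (by positivity) ?_ δ hδ0
      (by rw [hTsum]; exact hδ) ?_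
    · intro x hx
      change (1 : MulChar L ℂ) x * (1 : MulChar L ℂ) (fr x) * (1 : AddChar L ℂ) x = 1
      rw [hone _ (hx0 x hx), hone _ (hfr0 x hx), AddChar.one_apply]; norm_num
    · intro x _ m m'
      change (m.1 * m'.1) x * (m.2.1 * m'.2.1) (fr x) * (m.2.2 * m'.2.2) x = _
      rw [MulChar.mul_apply, MulChar.mul_apply, AddChar.mul_apply]
      simp only [ev]; ring
    · rintro ((p | p) | h)
      · simp only [C, N, Sum.elim_inl]
        rw [Finset.card_image_of_injective _ i1i, powSet_card _ _ (hχ p)]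
      · simp only [C, N, Sum.elim_inl, Sum.elim_inr]
        rw [Finset.card_image_of_injective _ i2i, powSet_card _ _ (hχ p)]
      · simp only [C, N, Sum.elim_inr]
        rw [Finset.card_image_of_injective _ i3i, quoSet_card, hRN]
    · intro j x hx hb
      rw [hsum j x hx, if_pos hb]
    · intro j x hx hb
      rw [hsum j x hx, if_neg hb]
    · intro m hm
      have hmx := mixed f1 f2 hf1 hf2 hd1 hd2 hc k g hgm hgi hgX hk hg1 hg2 m.1 m.2.1 m.2.2
        (fun h => hm (Prod.ext h.1 (Prod.ext h.2.1 h.2.2)))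
      have hz : ∑ x ∈ P, ev x m = ∑ x : L, m.1 x * m.2.1 (f1.eval x / f2.eval x) * m.2.2 x := by
        apply Finset.sum_subset (Finset.subset_univ _)
        intro x _ hx
        simp only [P, Finset.mem_filter, Finset.mem_univ, true_and] at hx
        change m.1 x * m.2.1 (f1.eval x / f2.eval x) * m.2.2 x = 0
        by_cases h0 : x = 0
        · rw [h0, MulChar.map_zero, zero_mul, zero_mul]
        · have : f1.eval x / f2.eval x = 0 := by
            rw [div_eq_zero_iff]; by_contra hcon; push Not at hcon; exact hx ⟨h0, hcon.1, hcon.2⟩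
          rw [this, MulChar.map_zero, mul_zero, zero_mul]
      rw [hz]; exact hmx
    · rw [hScard, hTcard]
      push_cast
      have h1 : δ * (Fintype.card L : ℝ) ≤ δ * (P.card + 6 * √(Fintype.card L)) := by
        apply mul_le_mul_of_nonneg_left _ hδ0.le; linarith
      refine lt_of_lt_of_le ?_ h1
      have h2 := mul_lt_mul_of_pos_right hcond (by linarith : 0 < √(Fintype.card L : ℝ))
      rw [mul_assoc δ, hsq] at h2
      calc _ = 2 ^ (2 * S1.card + S2.card) * 6 * (2 * (T1.card : ℝ) + T2.card + 2 * δ) * √(Fintype.card L) := by ring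
        _ < _ := h2
  obtain ⟨x, hxP, hx⟩ := key
  have hgood := fun j => hx j (hall j)
  have hmemA : ∀ p : ℕ, p.Prime → p ∣ Fintype.card L - 1 → p ∈ A := by
    intro p hp hpd
    rw [hA, Nat.mem_primeFactors]
    exact ⟨hp, hpd, by have := Fintype.one_lt_card (α := L); omega⟩
  refine ⟨x, ?_, ?_, ?_, ?_⟩
  · simp only [P, Finset.mem_filter] at hxP; exact hxP.2.2.2
  · refine prim_of x (hx0 x hxP) (fun p hp hpd => ⟨χ ⟨p, hmemA p hp hpd⟩, ?_, hgood (Sum.inl (Sum.inl ⟨p, hmemA p hp hpd⟩))⟩)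
    have := pow_orderOf_eq_one (χ ⟨p, hmemA p hp hpd⟩)
    rwa [hχ] at this
  · exact normal_of n hn hL x (fun h h1 h2 h3 => hgood (Sum.inr ⟨h, (hB h).mpr ⟨h1, h2, h3⟩⟩))
  · refine prim_of (fr x) (hfr0 x hxP) (fun p hp hpd => ⟨χ ⟨p, hmemA p hp hpd⟩, ?_, hgood (Sum.inl (Sum.inr ⟨p, hmemA p hp hpd⟩))⟩)
    have := pow_orderOf_eq_one (χ ⟨p, hmemA p hp hpd⟩)
    rwa [hχ] at this
end
end S12
end

section
open Polynomial
namespace S12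
set_option linter.unusedSectionVars false

section
variable {K : Type} [Field K] [Fintype K]

theorem deg_sum_le (B : Finset K[X]) (hB : ∀ h ∈ B, h.Monic ∧ Irreducible h) (m : ℕ) (hm : 0 < m)
    (hd : ∀ h ∈ B, h ∣ X ^ m - 1) : ∑ h ∈ B, h.natDegree ≤ m := by
  have hp : ∏ h ∈ B, h ∣ (X ^ m - 1 : K[X]) := by
    apply Finset.prod_dvd_of_coprime _ hd
    intro a ha b hb hab
    obtain ⟨m1, r1⟩ := hB a ha
    obtain ⟨m2, r2⟩ := hB b hb
    refine (r1.coprime_iff_not_dvd).mpr (fun hdv => hab ?_)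
    exact eq_of_monic_of_associated m1 m2 (r1.associated_of_dvd r2 hdv)
  have h1 := natDegree_le_of_dvd hp (X_pow_sub_C_ne_zero hm 1)
  rw [natDegree_prod_of_monic _ _ (fun h hh => (hB h hh).1)] at h1
  refine h1.trans (le_of_eq ?_)
  exact natDegree_X_pow_sub_C

theorem dvd_gcd_pow (n k : ℕ) (hn : 0 < n) (h : K[X]) (hi : Irreducible h) (hk : h.natDegree = k) (hd : h ∣ X ^ n - 1) :
    h ∣ X ^ (Nat.gcd n (Fintype.card K ^ k - 1)) - 1 := by
  have : Fact (Irreducible h) := ⟨hi⟩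
  have key : ∀ m, h ∣ X ^ m - 1 ↔ AdjoinRoot.root h ^ m = 1 := by
    intro m
    rw [← AdjoinRoot.mk_eq_zero, map_sub, map_pow, AdjoinRoot.mk_X, map_one, sub_eq_zero]
  have h1 := (key n).mp hd
  have hr : AdjoinRoot.root h ≠ 0 := by
    intro h0
    rw [h0, zero_pow hn.ne'] at h1
    exact zero_ne_one h1
  rw [key]
  have h2 : h ∣ X ^ (Nat.card K) ^ k - X := by
    rw [← hi.natDegree_dvd_iff_dvd_X_pow_card_pow_sub_X]
    exact ⟨1, by omega⟩
  rw [← AdjoinRoot.mk_eq_zero, map_sub, map_pow, AdjoinRoot.mk_X, sub_eq_zero, Nat.card_eq_fintype_card] at h2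
  have h3 : AdjoinRoot.root h ^ (Fintype.card K ^ k - 1) = 1 := by
    have : AdjoinRoot.root h ^ (Fintype.card K ^ k - 1) * AdjoinRoot.root h = 1 * AdjoinRoot.root h := by
      rw [← pow_succ, Nat.sub_add_cancel (Nat.one_le_pow _ _ Fintype.card_pos), h2, one_mul]
    exact mul_right_cancel₀ hr this
  rw [← orderOf_dvd_iff_pow_eq_one] at *
  exact Nat.dvd_gcd h1 h3

theorem count_deg (n k : ℕ) (hn : 0 < n) (hk : 0 < k) (B : Finset K[X])
    (hB : ∀ h ∈ B, h.Monic ∧ Irreducible h ∧ h ∣ X ^ n - 1 ∧ h.natDegree = k) : B.card ≤ Nat.gcd n (Fintype.card K ^ k - 1) / k := by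
  rw [Nat.le_div_iff_mul_le hk]
  have := deg_sum_le B (fun h hh => ⟨(hB h hh).1, (hB h hh).2.1⟩) (Nat.gcd n (Fintype.card K ^ k - 1)) (Nat.gcd_pos_of_pos_left _ hn)
    (fun h hh => dvd_gcd_pow n k hn h (hB h hh).2.1 (hB h hh).2.2.2 (hB h hh).2.2.1)
  rwa [Finset.sum_congr rfl (fun h hh => (hB h hh).2.2.2), Finset.sum_const, smul_eq_mul] at this

theorem count_ge (n k : ℕ) (hn : 0 < n) (hk : 0 < k) (B : Finset K[X])
    (hB : ∀ h ∈ B, h.Monic ∧ Irreducible h ∧ h ∣ X ^ n - 1 ∧ k ≤ h.natDegree) : B.card ≤ n / k := by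
  rw [Nat.le_div_iff_mul_le hk]
  refine le_trans ?_ (deg_sum_le B (fun h hh => ⟨(hB h hh).1, (hB h hh).2.1⟩) n hn (fun h hh => (hB h hh).2.2.1))
  rw [← smul_eq_mul]
  exact Finset.card_nsmul_le_sum _ _ _ (fun h hh => (hB h hh).2.2.2)

theorem exists_B (n : ℕ) (hn : 0 < n) : ∃ B : Finset K[X], ∀ h, h ∈ B ↔ (h.Monic ∧ Irreducible h ∧ h ∣ X ^ n - 1) := by
  classical
  refine ⟨(UniqueFactorizationMonoid.normalizedFactors (X ^ n - 1 : K[X])).toFinset, fun h => ?_⟩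
  rw [Multiset.mem_toFinset, Polynomial.mem_normalizedFactors_iff (show (X ^ n - 1 : K[X]) ≠ 0 from X_pow_sub_C_ne_zero hn 1)]
  tauto

/-- sum over the degrees in `[D, km)` plus the tail. -/
theorem sum_split (n D km : ℕ) (hn : 0 < n) (hD : 0 < D) (hDk : D ≤ km) (B : Finset K[X])
    (hB : ∀ h ∈ B, h.Monic ∧ Irreducible h ∧ h ∣ X ^ n - 1) (w : ℕ → ℝ) (hw : Antitone w) (hw0 : ∀ k, 0 ≤ w k) :
    ∑ h ∈ B.filter (fun h => D ≤ h.natDegree), w h.natDegree ≤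
      ∑ k ∈ Finset.Ico D km, ((Nat.gcd n (Fintype.card K ^ k - 1) / k : ℕ) : ℝ) * w k + ((n / km : ℕ) : ℝ) * w km := by
  classical
  have e : B.filter (fun h => D ≤ h.natDegree) = ((Finset.Ico D km).biUnion fun k => B.filter (fun h => h.natDegree = k)) ∪ B.filter (fun h => km ≤ h.natDegree) := by
    ext h
    simp only [Finset.mem_filter, Finset.mem_union, Finset.mem_biUnion, Finset.mem_Ico]
    constructor
    · rintro ⟨h1, h2⟩
      rcases lt_or_ge h.natDegree km with h3 | h3
      · exact Or.inl ⟨_, ⟨h2, h3⟩, h1, rfl⟩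
      · exact Or.inr ⟨h1, h3⟩
    · rintro (⟨k, h1, h2, rfl⟩ | h1)
      · exact ⟨h2, h1.1⟩
      · exact ⟨h1.1, hDk.trans h1.2⟩
  rw [e, Finset.sum_union, Finset.sum_biUnion]
  · apply add_le_add
    · apply Finset.sum_le_sum
      intro k hk
      rw [Finset.mem_Ico] at hk
      rw [Finset.sum_congr rfl (g := fun _ => w k) (fun h hh => by rw [(Finset.mem_filter.mp hh).2]), Finset.sum_const, nsmul_eq_mul]
      apply mul_le_mul_of_nonneg_right _ (hw0 k)
      have := count_deg n k hn (by omega) (B.filter (fun h => h.natDegree = k))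
        (fun h hh => by
          rw [Finset.mem_filter] at hh
          obtain ⟨a, b, c⟩ := hB h hh.1
          exact ⟨a, b, c, hh.2⟩)
      exact_mod_cast this
    · have := count_ge n km hn (by omega) (B.filter (fun h => km ≤ h.natDegree))
        (fun h hh => by
          rw [Finset.mem_filter] at hh
          obtain ⟨a, b, c⟩ := hB h hh.1
          exact ⟨a, b, c, hh.2⟩)
      have h2 : ((B.filter (fun h => km ≤ h.natDegree)).card : ℝ) ≤ ((n / km : ℕ) : ℝ) := by exact_mod_cast this
      refine le_trans ?_ (mul_le_mul_of_nonneg_right h2 (hw0 km))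
      rw [← nsmul_eq_mul]
      exact Finset.sum_le_card_nsmul _ _ _ (fun h hh => hw (Finset.mem_filter.mp hh).2)
  · intro a _ b _ hab
    rw [Function.onFun, Finset.disjoint_left]
    intro h h1 h2
    rw [Finset.mem_filter] at h1 h2
    exact hab (h1.2.symm.trans h2.2)
  · rw [Finset.disjoint_left]
    intro h h1 h2
    simp only [Finset.mem_filter, Finset.mem_biUnion, Finset.mem_Ico] at h1 h2
    obtain ⟨k, h3, _, h4⟩ := h1
    omega

theorem count_lt (n D : ℕ) (hn : 0 < n) (B : Finset K[X])
    (hB : ∀ h ∈ B, h.Monic ∧ Irreducible h ∧ h ∣ X ^ n - 1) :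
    (B.filter (fun h => ¬ D ≤ h.natDegree)).card ≤ ∑ k ∈ Finset.Ico 1 D, Nat.gcd n (Fintype.card K ^ k - 1) / k := by
  classical
  have e : B.filter (fun h => ¬ D ≤ h.natDegree) ⊆ ((Finset.Ico 1 D).biUnion fun k => B.filter (fun h => h.natDegree = k)) := by
    intro h hh
    rw [Finset.mem_filter] at hh
    simp only [Finset.mem_filter, Finset.mem_biUnion, Finset.mem_Ico]
    exact ⟨_, ⟨(hB h hh.1).2.1.natDegree_pos, by omega⟩, hh.1, rfl⟩
  refine (Finset.card_le_card e).trans (Finset.card_biUnion_le.trans (Finset.sum_le_sum ?_))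
  intro k hk
  rw [Finset.mem_Ico] at hk
  apply count_deg n k hn (by omega)
  intro h hh
  rw [Finset.mem_filter] at hh
  obtain ⟨a, b, c⟩ := hB h hh.1
  exact ⟨a, b, c, hh.2⟩
end
end S12
end

section
open Polynomial
namespace S12
set_option linter.unusedSectionVars false

def numOK (n : ℕ) (Ls Lm : List ℕ) (W t D km M : ℕ) : Prop :=
  2 * ((Lm.map (fun p => M / p + 1)).sum + t * (M / W + 1)) +
    (∑ k ∈ Finset.Ico D km, Nat.gcd n (3 ^ k - 1) / k * (M / 3 ^ k + 1) + n / km * (M / 3 ^ km + 1)) < M ∧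
  (2 ^ (2 * Ls.length + ∑ k ∈ Finset.Ico 1 D, Nat.gcd n (3 ^ k - 1) / k) * 6 *
    ((2 * (Lm.length + t) + (∑ k ∈ Finset.Ico D km, Nat.gcd n (3 ^ k - 1) / k + n / km)) * M +
     2 * (M - (2 * ((Lm.map (fun p => M / p + 1)).sum + t * (M / W + 1)) +
    (∑ k ∈ Finset.Ico D km, Nat.gcd n (3 ^ k - 1) / k * (M / 3 ^ k + 1) + n / km * (M / 3 ^ km + 1)))))) ^ 2 <
  (M - (2 * ((Lm.map (fun p => M / p + 1)).sum + t * (M / W + 1)) +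
    (∑ k ∈ Finset.Ico D km, Nat.gcd n (3 ^ k - 1) / k * (M / 3 ^ k + 1) + n / km * (M / 3 ^ km + 1)))) ^ 2 * 3 ^ n

instance (n : ℕ) (Ls Lm : List ℕ) (W t D km M : ℕ) : Decidable (numOK n Ls Lm W t D km M) := by
  unfold numOK; infer_instance

theorem sum_le_list (F : Finset ℕ) (l : List ℕ) (f : ℕ → ℝ) (hf : ∀ x, 0 ≤ f x) (h : ∀ x ∈ F, x ∈ l) :
    ∑ x ∈ F, f x ≤ (l.map f).sum := by
  induction l generalizing F with
  | nil =>
    have : F = ∅ := Finset.eq_empty_of_forall_notMem (fun x hx => by simpa using h x hx)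
    simp [this]
  | cons a l ih =>
    rw [List.map_cons, List.sum_cons]
    have h1 := ih (F.erase a) (fun x hx => by
      rw [Finset.mem_erase] at hx
      rcases List.mem_cons.mp (h x hx.2) with h2 | h2
      · exact absurd h2 hx.1
      · exact h2)
    by_cases ha : a ∈ F
    · rw [← Finset.add_sum_erase F f ha]; linarith
    · rw [Finset.erase_eq_of_notMem ha] at h1; linarith [hf a]

theorem card_le_list (F : Finset ℕ) (l : List ℕ) (h : ∀ x ∈ F, x ∈ l) : F.card ≤ l.length := by
  refine (Finset.card_le_card (t := l.toFinset) (fun x hx => List.mem_toFinset.mpr (h x hx))).trans (List.toFinset_card_le l)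

theorem inv_le (M p : ℕ) (hM : 0 < M) (hp : 0 < p) : 1 / (p : ℝ) ≤ ((M / p + 1 : ℕ) : ℝ) / M := by
  have h : M < p * (M / p + 1) := Nat.lt_mul_div_succ M hp
  have h' : (M : ℝ) < p * ((M / p + 1 : ℕ) : ℝ) := by exact_mod_cast h
  rw [div_le_div_iff₀ (by exact_mod_cast hp) (by exact_mod_cast hM)]
  linarith

/-- The large prime divisors are few. -/
theorem large_card (N W t : ℕ) (hN : 0 < N) (hW : 0 < W) (hNt : N < W ^ (t + 1)) (F : Finset ℕ) (hF : ∀ p ∈ F, p ∈ N.primeFactors ∧ W ≤ p) :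
    F.card ≤ t := by
  have h1 : ∏ p ∈ F, p ∣ N := (Finset.prod_dvd_prod_of_subset _ _ _ (fun p hp => (hF p hp).1)).trans (Nat.prod_primeFactors_dvd N)
  have h2 := Nat.le_of_dvd hN h1
  have h3 : W ^ F.card ≤ ∏ p ∈ F, p := Finset.pow_card_le_prod F _ _ (fun p hp => (hF p hp).2)
  have h4 : W ^ F.card < W ^ (t + 1) := by omega
  by_contra hc
  have := Nat.pow_le_pow_right hW (show t + 1 ≤ F.card by omega)
  omega

section
variable {K L : Type} [Field K] [Fintype K] [Field L] [Fintype L] [Algebra K L]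

theorem core (n : ℕ) (hn : 0 < n) (hK : Fintype.card K = 3) (hL : Fintype.card L = 3 ^ n)
    (Ls Lm : List ℕ) (W t D km M : ℕ) (hW : 0 < W) (hM : 0 < M) (hD : 0 < D) (hDk : D ≤ km) (ht : 3 ^ n ≤ W ^ (t + 1))
    (hp : ∀ p : ℕ, p.Prime → p ∣ 3 ^ n - 1 → p ∈ Ls ∨ p ∈ Lm ∨ W ≤ p) (hnum : numOK n Ls Lm W t D km M)
    (f1 f2 : L[X]) (hf1 : f1 ≠ 0) (hf2 : f2 ≠ 0)
    (hd1 : f1.natDegree ≤ 3) (hd2 : f2.natDegree ≤ 2) (hc : IsCoprime f1 f2) (k : ℕ) (g : L[X])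
    (hgm : g.Monic) (hgi : Irreducible g) (hgX : g ≠ X) (hk : Nat.gcd k (Fintype.card L - 1) = 1)
    (hg1 : g ^ k ∣ f1 * f2) (hg2 : ¬ g ^ (k+1) ∣ f1 * f2) :
    ∃ α : L, f2.eval α ≠ 0 ∧ orderOf α = Fintype.card L - 1 ∧
     (LinearIndependent K (fun i : Fin n => α ^ Fintype.card K ^ (i : ℕ)) ∧
    Submodule.span K (Set.range fun i : Fin n => α ^ Fintype.card K ^ (i : ℕ)) = ⊤) ∧
    orderOf (f1.eval α / f2.eval α) = Fintype.card L - 1 := by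
  classical
  obtain ⟨B, hB⟩ := exists_B (K := K) n hn
  have hB' : ∀ h ∈ B, h.Monic ∧ Irreducible h ∧ h ∣ X ^ n - 1 := fun h hh => (hB h).mp hh
  have h3n : 1 < 3 ^ n := Nat.one_lt_pow hn.ne' (by norm_num)
  set A := (Fintype.card L - 1).primeFactors with hA
  have hA3 : A = (3 ^ n - 1).primeFactors := by rw [hA, hL]
  have hAm : ∀ p ∈ A, p.Prime ∧ p ∣ 3 ^ n - 1 := fun p hp => by
    rw [hA3] at hp; exact ⟨Nat.prime_of_mem_primeFactors hp, Nat.dvd_of_mem_primeFactors hp⟩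
  set S1 := A.filter (fun p => p ∈ Ls) with hS1
  set T1 := A.filter (fun p => ¬ p ∈ Ls) with hT1
  set T1a := T1.filter (fun p => p ∈ Lm) with hT1a
  set T1b := T1.filter (fun p => ¬ p ∈ Lm) with hT1b
  set S2 := B.filter (fun h => ¬ D ≤ h.natDegree) with hS2
  set T2 := B.filter (fun h => D ≤ h.natDegree) with hT2
  have cS1 : S1.card ≤ Ls.length := card_le_list _ _ (fun x hx => (Finset.mem_filter.mp hx).2)
  have cT1a : T1a.card ≤ Lm.length := card_le_list _ _ (fun x hx => (Finset.mem_filter.mp hx).2)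
  have hT1bW : ∀ p ∈ T1b, p ∈ A ∧ W ≤ p := by
    intro p hpm
    rw [hT1b, Finset.mem_filter, hT1, Finset.mem_filter] at hpm
    refine ⟨hpm.1.1, ?_⟩
    obtain ⟨q1, q2⟩ := hAm p hpm.1.1
    rcases hp p q1 q2 with h | h | h
    · exact absurd h hpm.1.2
    · exact absurd h hpm.2
    · exact h
  have cT1b : T1b.card ≤ t := by
    refine large_card (3 ^ n - 1) W t (by omega) hW (by omega) _ (fun p hp => ?_)
    rw [← hA3]; exact hT1bW p hp
  have cT1 : T1.card = T1a.card + T1b.card := (Finset.card_filter_add_card_filter_not _).symm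
  have hMr : (0 : ℝ) < M := by exact_mod_cast hM
  have sT1a : ∑ p ∈ T1a, 1 / (p : ℝ) ≤ (((Lm.map (fun p => M / p + 1)).sum : ℕ) : ℝ) / M := by
    have h1 : ∑ p ∈ T1a, 1 / (p : ℝ) ≤ ∑ p ∈ T1a, ((M / p + 1 : ℕ) : ℝ) / M := by
      apply Finset.sum_le_sum
      intro p hpm
      apply inv_le M p hM
      exact (hAm p (Finset.mem_filter.mp (Finset.mem_filter.mp hpm).1).1).1.pos
    refine h1.trans ?_
    rw [← Finset.sum_div]
    apply div_le_div_of_nonneg_right _ hMr.le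
    have h2 := sum_le_list T1a Lm (fun p => ((M / p + 1 : ℕ) : ℝ)) (fun x => by positivity) (fun x hx => (Finset.mem_filter.mp hx).2)
    refine h2.trans (le_of_eq ?_)
    rw [Nat.cast_list_sum, List.map_map]; rfl
  have sT1b : ∑ p ∈ T1b, 1 / (p : ℝ) ≤ ((t * (M / W + 1) : ℕ) : ℝ) / M := by
    have h1 : ∑ p ∈ T1b, 1 / (p : ℝ) ≤ T1b.card • (1 / (W : ℝ)) := by
      apply Finset.sum_le_card_nsmul
      intro p hpm
      have : (W : ℝ) ≤ p := by exact_mod_cast (hT1bW p hpm).2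
      exact one_div_le_one_div_of_le (by exact_mod_cast hW) this
    rw [nsmul_eq_mul] at h1
    have h2 : (T1b.card : ℝ) ≤ t := by exact_mod_cast cT1b
    have h3 := inv_le M W hM hW
    have h4 : (T1b.card : ℝ) * (1 / (W : ℝ)) ≤ t * (((M / W + 1 : ℕ) : ℝ) / M) :=
      mul_le_mul h2 h3 (by positivity) (by positivity)
    refine h1.trans (h4.trans (le_of_eq ?_))
    rw [Nat.cast_mul, mul_div_assoc]
  have sT1 : ∑ p ∈ T1, 1 / (p : ℝ) = ∑ p ∈ T1a, 1 / (p : ℝ) + ∑ p ∈ T1b, 1 / (p : ℝ) := (Finset.sum_filter_add_sum_filter_not _ _ _).symm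
  have cS2 : S2.card ≤ ∑ k ∈ Finset.Ico 1 D, Nat.gcd n (3 ^ k - 1) / k := by
    have := count_lt n D hn B hB'
    rwa [hK] at this
  have cT2 : T2.card ≤ ∑ k ∈ Finset.Ico D km, Nat.gcd n (3 ^ k - 1) / k + n / km := by
    have := sum_split n D km hn hD hDk B hB' (fun _ => 1) (fun _ _ _ => le_rfl) (fun _ => by norm_num)
    rw [hK] at this
    simp only [Finset.sum_const, mul_one, nsmul_eq_mul] at this
    exact_mod_cast this
  have sT2 : ∑ h ∈ T2, 1 / (Fintype.card K : ℝ) ^ h.natDegree ≤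
      ((∑ k ∈ Finset.Ico D km, Nat.gcd n (3 ^ k - 1) / k * (M / 3 ^ k + 1) + n / km * (M / 3 ^ km + 1) : ℕ) : ℝ) / M := by
    have := sum_split n D km hn hD hDk B hB' (fun k => 1 / (3 : ℝ) ^ k)
      (fun a b hab => one_div_le_one_div_of_le (by positivity) (pow_le_pow_right₀ (by norm_num) hab)) (fun _ => by positivity)
    rw [hK] at this
    rw [hK, Nat.cast_ofNat]
    refine this.trans ?_
    have hi : ∀ k : ℕ, 1 / (3 : ℝ) ^ k ≤ ((M / 3 ^ k + 1 : ℕ) : ℝ) / M := fun k => by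
      have := inv_le M (3 ^ k) hM (by positivity)
      rwa [Nat.cast_pow, Nat.cast_ofNat] at this
    rw [Nat.cast_add, add_div, Nat.cast_sum, Finset.sum_div, Nat.cast_mul, mul_div_assoc]
    apply add_le_add
    · apply Finset.sum_le_sum
      intro k _
      rw [Nat.cast_mul, mul_div_assoc]
      exact mul_le_mul_of_nonneg_left (hi k) (by positivity)
    · exact mul_le_mul_of_nonneg_left (hi km) (by positivity)
  unfold numOK at hnum
  set a1 := (Lm.map (fun p => M / p + 1)).sum
  set a2 := t * (M / W + 1)
  set b := ∑ k ∈ Finset.Ico D km, Nat.gcd n (3 ^ k - 1) / k * (M / 3 ^ k + 1) + n / km * (M / 3 ^ km + 1)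
  set u2 := ∑ k ∈ Finset.Ico D km, Nat.gcd n (3 ^ k - 1) / k + n / km
  set s2 := ∑ k ∈ Finset.Ico 1 D, Nat.gcd n (3 ^ k - 1) / k
  obtain ⟨hn1, hn2⟩ := hnum
  set d := M - (2 * (a1 + a2) + b) with hd
  have hd0 : 0 < d := by omega
  have hdM : (d : ℝ) + (2 * (a1 + a2) + b) = M := by
    have : d + (2 * (a1 + a2) + b) = M := by omega
    exact_mod_cast this
  have hd0r : (0 : ℝ) < d := by exact_mod_cast hd0
  refine criterion n hn (by rw [hK, hL]) f1 f2 hf1 hf2 hd1 hd2 hc k g hgm hgi hgX hk hg1 hg2 A rfl B hB S1 T1 S2 T2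
    (Finset.disjoint_filter_filter_not _ _ _) (Finset.filter_union_filter_not_eq _ _) (Finset.disjoint_filter_filter_not _ _ _).symm
    (fun h hh => (Finset.mem_filter.mp hh).1) (fun h hh => (Finset.mem_filter.mp hh).1) ?_ ((d : ℝ) / M) (by positivity) ?_ ?_
  · intro h hh
    by_cases hq : D ≤ h.natDegree
    · exact Or.inr (Finset.mem_filter.mpr ⟨hh, hq⟩)
    · exact Or.inl (Finset.mem_filter.mpr ⟨hh, hq⟩)
  · have h1 : (2 * ∑ p ∈ T1, 1 / (p : ℝ) + ∑ h ∈ T2, 1 / (Fintype.card K : ℝ) ^ h.natDegree) ≤ 2 * ((a1 : ℝ) / M + a2 / M) + b / M := by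
      rw [sT1]; linarith
    have h2 : (d : ℝ) / M = 1 - (2 * ((a1 : ℝ) / M + a2 / M) + b / M) := by
      field_simp; linarith
    rw [h2]; linarith
  · have e1 : 2 * S1.card + S2.card ≤ 2 * Ls.length + s2 := by omega
    have e2 : 2 * T1.card + T2.card ≤ 2 * (Lm.length + t) + u2 := by omega
    have e2r : 2 * (T1.card : ℝ) + T2.card ≤ 2 * (Lm.length + t) + u2 := by exact_mod_cast e2
    have e3 : (2 : ℝ) ^ (2 * S1.card + S2.card) ≤ 2 ^ (2 * Ls.length + s2) := pow_le_pow_right₀ (by norm_num) e1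
    have e4 : (2 : ℝ) ^ (2 * Ls.length + s2) * 6 * ((2 * (Lm.length + t) + u2) * M + 2 * d) < d * √(Fintype.card L) := by
      apply lt_of_pow_lt_pow_left₀ 2 (by positivity)
      rw [mul_pow (d : ℝ), Real.sq_sqrt (by positivity), hL]
      exact_mod_cast hn2
    calc (2 : ℝ) ^ (2 * S1.card + S2.card) * 6 * (2 * T1.card + T2.card + 2 * (d / M))
        ≤ 2 ^ (2 * Ls.length + s2) * 6 * ((2 * (Lm.length + t) + u2) + 2 * (d / M)) := by gcongr
      _ = (2 ^ (2 * Ls.length + s2) * 6 * ((2 * (Lm.length + t) + u2) * M + 2 * d)) / M := by field_simp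
      _ < (d * √(Fintype.card L)) / M := by gcongr
      _ = d / M * √(Fintype.card L) := by ring
end
end S12
end

section
open Polynomial
namespace S12
set_option linter.unusedSectionVars false

/-- The primes below 80. -/
def primesA : List ℕ :=
  [2, 3, 5, 7, 11, 13, 17, 19, 23, 29, 31, 37, 41, 43, 47, 53, 59, 61, 67, 71, 73, 79]

/-- The primes between 80 and 700. -/
def primesB : List ℕ :=
  [83, 89, 97, 101, 103, 107, 109, 113, 127, 131, 137, 139, 149, 151, 157, 163, 167, 173, 179, 181, 191, 193,
    197, 199, 211, 223, 227, 229, 233, 239, 241, 251, 257, 263, 269, 271, 277, 281, 283, 293, 307, 311, 313,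
    317, 331, 337, 347, 349, 353, 359, 367, 373, 379, 383, 389, 397, 401, 409, 419, 421, 431, 433, 439, 443,
    449, 457, 461, 463, 467, 479, 487, 491, 499, 503, 509, 521, 523, 541, 547, 557, 563, 569, 571, 577, 587,
    593, 599, 601, 607, 613, 617, 619, 631, 641, 643, 647, 653, 659, 661, 673, 677, 683, 691]

def noSmallFactor (d : ℕ) : Bool :=
  2 ≤ d && [2, 3, 5, 7, 11, 13, 17, 19, 23].all (fun q => d % q != 0 || d == q)

theorem noSmallFactor_of_prime (p : ℕ) (hp : p.Prime) : noSmallFactor p = true := by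
  unfold noSmallFactor
  rw [Bool.and_eq_true, List.all_eq_true, decide_eq_true_eq]
  refine ⟨hp.two_le, fun q hq => ?_⟩
  have hq1 : q ≠ 1 := by rintro rfl; simp at hq
  rw [Bool.or_eq_true, bne_iff_ne, beq_iff_eq, or_iff_not_imp_left]
  intro h
  rw [not_not] at h
  exact ((hp.eq_one_or_self_of_dvd q (Nat.dvd_of_mod_eq_zero h)).resolve_left hq1).symm

theorem primes_complete_aux : (List.range 700).all (fun d => !noSmallFactor d || primesA.contains d || primesB.contains d) = true := by
  decide +kernel

theorem primes_complete (p : ℕ) (hp : p.Prime) (h : p < 700) : p ∈ primesA ∨ p ∈ primesB := by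
  have h1 := List.all_eq_true.mp primes_complete_aux p (List.mem_range.mpr h)
  rw [noSmallFactor_of_prime p hp] at h1
  simpa using h1

def Cert (n : ℕ) : Prop := ∃ (Ls Lm : List ℕ) (W t D km M : ℕ), 0 < W ∧ 0 < M ∧ 0 < D ∧ D ≤ km ∧ 3 ^ n ≤ W ^ (t + 1) ∧
    (∀ p : ℕ, p.Prime → p ∣ 3 ^ n - 1 → p ∈ Ls ∨ p ∈ Lm ∨ W ≤ p) ∧ numOK n Ls Lm W t D km M

theorem cert_full (n : ℕ) (hn : 0 < n) (Ls Lm : List ℕ) (D km M : ℕ) (hM : 0 < M) (hD : 0 < D) (hDk : D ≤ km)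
    (hdvd : 3 ^ n - 1 ∣ (Ls ++ Lm).prod ^ 8) (hpr : ∀ q ∈ Ls ++ Lm, q.Prime)
    (hnum : numOK n Ls Lm (3 ^ n) 0 D km M) : Cert n := by
  refine ⟨Ls, Lm, 3 ^ n, 0, D, km, M, by positivity, hM, hD, hDk, by simp, ?_, hnum⟩
  intro p hp hd
  have h1 : p ∣ (Ls ++ Lm).prod := hp.dvd_of_dvd_pow (hd.trans hdvd)
  obtain ⟨q, hq, hpq⟩ := (Prime.dvd_prod_iff hp.prime).mp h1
  rw [(Nat.prime_dvd_prime_iff_eq hp (hpr q hq)).mp hpq, ← or_assoc]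
  exact Or.inl (List.mem_append.mp hq)

/-- One divisibility-based filter. -/
def pdiv (n : ℕ) (l : List ℕ) : List ℕ := l.filter (fun p => 3 ^ n % p == 1 % p)

theorem mem_pdiv (n p : ℕ) (l : List ℕ) (hp : p ∈ l) (hd : p ∣ 3 ^ n - 1) : p ∈ pdiv n l := by
  unfold pdiv
  rw [List.mem_filter]
  refine ⟨hp, ?_⟩
  rw [beq_iff_eq]
  exact ((Nat.modEq_iff_dvd' (Nat.one_le_pow _ _ (by norm_num))).mpr hd).symm

def midOK (n : ℕ) : Prop :=
  3 ^ n ≤ 700 ^ (n * 1000 / 5963 + 1) ∧ numOK n (pdiv n primesA) (pdiv n primesB) 700 (n * 1000 / 5963) 4 6 1000000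

instance (n : ℕ) : Decidable (midOK n) := by unfold midOK; infer_instance

theorem cert_mid (n : ℕ) (h : midOK n) : Cert n := by
  refine ⟨pdiv n primesA, pdiv n primesB, 700, n * 1000 / 5963, 4, 6, 1000000, by norm_num, by norm_num, by norm_num, by norm_num, h.1, ?_, h.2⟩
  intro p hp hd
  rcases lt_or_ge p 700 with h7 | h7
  · rcases primes_complete p hp h7 with h1 | h1
    · exact Or.inl (mem_pdiv n p _ h1 hd)
    · exact Or.inr (Or.inl (mem_pdiv n p _ h1 hd))
  · exact Or.inr (Or.inr h7)

theorem mid_a : ∀ n ∈ List.range' 25 225, midOK n := by decide +kernel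
theorem mid_b : ∀ n ∈ List.range' 250 250, midOK n := by decide +kernel
theorem mid_c : ∀ n ∈ List.range' 500 250, midOK n := by decide +kernel
theorem mid_d : ∀ n ∈ [14, 17, 19, 21, 22, 23], midOK n := by decide +kernel

theorem cert_all (n : ℕ) (h : n ∈ ({11, 13, 14, 15} : Finset ℕ) ∨ 17 ≤ n) (hlt : n < 750) : Cert n := by
  rcases lt_or_ge n 25 with h25 | h25
  · have h' : n = 11 ∨ n = 13 ∨ n = 15 ∨ n = 18 ∨ n = 20 ∨ n = 24 ∨ n ∈ [14, 17, 19, 21, 22, 23] := by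
      simp only [Finset.mem_insert, Finset.mem_singleton, List.mem_cons, List.not_mem_nil] at h ⊢
      omega
    rcases h' with rfl | rfl | rfl | rfl | rfl | rfl | h'
    · exact cert_full 11 (by norm_num) [2] [23, 3851] 1 5 1000000 (by norm_num) (by norm_num) (by norm_num) (by decide +kernel) (by norm_num) (by decide +kernel)
    · exact cert_full 13 (by norm_num) [2] [797161] 1 6 1000000 (by norm_num) (by norm_num) (by norm_num) (by decide +kernel) (by norm_num) (by decide +kernel)
    · exact cert_full 15 (by norm_num) [2] [11, 13, 4561] 4 7 1000000 (by norm_num) (by norm_num) (by norm_num) (by decide +kernel) (by norm_num) (by decide +kernel)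
    · exact cert_full 18 (by norm_num) [2] [7, 13, 19, 37, 757] 2 7 1000000 (by norm_num) (by norm_num) (by norm_num) (by decide +kernel) (by norm_num) (by decide +kernel)
    · exact cert_full 20 (by norm_num) [2, 5] [11, 61, 1181] 2 4 1000000 (by norm_num) (by norm_num) (by norm_num) (by decide +kernel) (by norm_num) (by decide +kernel)
    · exact cert_full 24 (by norm_num) [2, 5, 7] [13, 41, 73, 6481] 2 7 1000000 (by norm_num) (by norm_num) (by norm_num) (by decide +kernel) (by norm_num) (by decide +kernel)
    · exact cert_mid n (mid_d n h')
  · rcases lt_or_ge n 250 with h1 | h1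
    · exact cert_mid n (mid_a n (List.mem_range'_1.mpr (by omega)))
    rcases lt_or_ge n 500 with h2 | h2
    · exact cert_mid n (mid_b n (List.mem_range'_1.mpr (by omega)))
    · exact cert_mid n (mid_c n (List.mem_range'_1.mpr (by omega)))
end S12
end

section
open Polynomial
namespace S12
set_option linter.unusedSectionVars false

theorem crude_num (m : ℕ) (hm : 150 ≤ m) : 4 ^ 140 * 64 ^ m * 144 < 243 ^ m := by
  induction m, hm using Nat.le_induction with
  | base => norm_num
  | succ m _ ih => rw [pow_succ, pow_succ]; omega

theorem crude_pow (a m : ℕ) : ((2 : ℝ) ^ (a + 3 * m) * 6 * 2) ^ 2 = 4 ^ a * 64 ^ m * 144 := by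
  have h1 : (4 : ℝ) ^ a = (2 ^ a) ^ 2 := by rw [← pow_mul, mul_comm, pow_mul]; norm_num
  have h2 : (64 : ℝ) ^ m = (2 ^ (3 * m)) ^ 2 := by
    rw [← pow_mul, show 3 * m * 2 = 6 * m by ring, pow_mul]; norm_num
  rw [h1, h2, pow_add]; ring

theorem small_primes_card (n : ℕ) : ((3 ^ n - 1).primeFactors.filter (fun p => p < 243)).card ≤ 53 := by
  refine (card_le_list _ ((primesA ++ primesB).filter (fun p => p < 243)) ?_).trans (by decide +kernel)
  intro p hp
  rw [Finset.mem_filter] at hp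
  rw [List.mem_filter, List.mem_append]
  exact ⟨primes_complete p (Nat.prime_of_mem_primeFactors hp.1) (by omega), by simpa using hp.2⟩

theorem omega_le (n : ℕ) (hn : 0 < n) : (3 ^ n - 1).primeFactors.card ≤ 53 + n / 5 := by
  have h3n : 1 < 3 ^ n := Nat.one_lt_pow hn.ne' (by norm_num)
  rw [← Finset.card_filter_add_card_filter_not (fun p => p < 243)]
  apply add_le_add (small_primes_card n)
  apply large_card (3 ^ n - 1) 243 (n / 5) (by omega) (by norm_num)
  · have : 3 ^ n ≤ 243 ^ (n / 5 + 1) := by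
      rw [show 243 = 3 ^ 5 by norm_num, ← pow_mul]
      exact Nat.pow_le_pow_right (by norm_num) (by omega)
    omega
  · intro p hp
    rw [Finset.mem_filter] at hp
    exact ⟨hp.1, by omega⟩

section
variable {K L : Type} [Field K] [Fintype K] [Field L] [Fintype L] [Algebra K L]

theorem crude (n : ℕ) (hn : 750 ≤ n) (hK : Fintype.card K = 3) (hL : Fintype.card L = 3 ^ n)
    (f1 f2 : L[X]) (hf1 : f1 ≠ 0) (hf2 : f2 ≠ 0)
    (hd1 : f1.natDegree ≤ 3) (hd2 : f2.natDegree ≤ 2) (hc : IsCoprime f1 f2) (k : ℕ) (g : L[X])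
    (hgm : g.Monic) (hgi : Irreducible g) (hgX : g ≠ X) (hk : Nat.gcd k (Fintype.card L - 1) = 1)
    (hg1 : g ^ k ∣ f1 * f2) (hg2 : ¬ g ^ (k+1) ∣ f1 * f2) :
    ∃ α : L, f2.eval α ≠ 0 ∧ orderOf α = Fintype.card L - 1 ∧
     (LinearIndependent K (fun i : Fin n => α ^ Fintype.card K ^ (i : ℕ)) ∧
    Submodule.span K (Set.range fun i : Fin n => α ^ Fintype.card K ^ (i : ℕ)) = ⊤) ∧
    orderOf (f1.eval α / f2.eval α) = Fintype.card L - 1 := by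
  classical
  have hn0 : 0 < n := by omega
  obtain ⟨B, hB⟩ := exists_B (K := K) n hn0
  have hB' : ∀ h ∈ B, h.Monic ∧ Irreducible h ∧ h ∣ X ^ n - 1 := fun h hh => (hB h).mp hh
  have cA : (Fintype.card L - 1).primeFactors.card ≤ 53 + n / 5 := by rw [hL]; exact omega_le n hn0
  have cB : B.card ≤ 34 + n / 5 := by
    have := sum_split n 1 5 hn0 (by norm_num) (by norm_num) B hB' (fun _ => 1) (fun _ _ _ => le_rfl) (fun _ => by norm_num)
    rw [hK] at this
    simp only [Finset.sum_const, mul_one, nsmul_eq_mul] at this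
    have h2 : (B.filter (fun h => 1 ≤ h.natDegree)).card ≤ ∑ k ∈ Finset.Ico 1 5, Nat.gcd n (3 ^ k - 1) / k + n / 5 := by exact_mod_cast this
    rw [Finset.filter_true_of_mem (p := fun h : K[X] => 1 ≤ h.natDegree) (fun h hh => (hB' h hh).2.1.natDegree_pos)] at h2
    refine h2.trans (Nat.add_le_add_right ?_ _)
    have hk : ∀ k ∈ Finset.Ico 1 5, Nat.gcd n (3 ^ k - 1) / k ≤ (3 ^ k - 1) / k := by
      intro k hk
      rw [Finset.mem_Ico] at hk
      apply Nat.div_le_div_right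
      apply Nat.gcd_le_right
      have := Nat.one_lt_pow (n := k) (by omega) (show 1 < 3 by norm_num)
      omega
    exact (Finset.sum_le_sum hk).trans (by decide)
  refine criterion n hn0 (by rw [hK, hL]) f1 f2 hf1 hf2 hd1 hd2 hc k g hgm hgi hgX hk hg1 hg2 _ rfl B hB _ ∅ B ∅
    (Finset.disjoint_empty_right _) (Finset.union_empty _) (Finset.disjoint_empty_right _) (fun h hh => hh) (by simp) (fun h hh => Or.inl hh)
    1 one_pos (by simp) ?_
  rw [Finset.card_empty, Finset.card_empty, one_mul, hL]
  have e1 : 2 * (Fintype.card L - 1).primeFactors.card + B.card ≤ 140 + 3 * (n / 5) := by omega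
  apply lt_of_pow_lt_pow_left₀ 2 (by positivity)
  rw [Real.sq_sqrt (by positivity)]
  have e3 : (2 : ℝ) ^ (2 * (Fintype.card L - 1).primeFactors.card + B.card) ≤ 2 ^ (140 + 3 * (n / 5)) := pow_le_pow_right₀ (by norm_num) e1
  have e4 : (4 : ℝ) ^ 140 * 64 ^ (n / 5) * 144 < 243 ^ (n / 5) := by exact_mod_cast crude_num (n / 5) (by omega)
  have e5 : (243 : ℝ) ^ (n / 5) ≤ 3 ^ n := by
    rw [show (243 : ℝ) = 3 ^ 5 by norm_num, ← pow_mul]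
    exact pow_le_pow_right₀ (by norm_num) (by omega)
  have e6 : ((2 : ℝ) ^ (140 + 3 * (n / 5)) * 6 * 2) ^ 2 = 4 ^ 140 * 64 ^ (n / 5) * 144 := by
    exact crude_pow 140 (n / 5)
  push_cast
  calc _ ≤ ((2 : ℝ) ^ (140 + 3 * (n / 5)) * 6 * 2) ^ 2 := by
        apply pow_le_pow_left₀ (by positivity)
        have : (2 * (0 : ℝ) + 0 + 2 * 1) = 2 := by norm_num
        rw [this]
        exact mul_le_mul_of_nonneg_right (mul_le_mul_of_nonneg_right (by rw [hL] at e3; exact e3) (by norm_num)) (by norm_num)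
    _ < _ := by rw [e6]; exact e4.trans_le e5

theorem final_exists (n : ℕ) (h : n ∈ ({11, 13, 14, 15} : Finset ℕ) ∨ 17 ≤ n) (hn : 0 < n) (hK : Fintype.card K = 3) (hL : Fintype.card L = 3 ^ n)
    (f1 f2 : L[X]) (hf1 : f1 ≠ 0) (hf2 : f2 ≠ 0)
    (hd1 : f1.natDegree ≤ 3) (hd2 : f2.natDegree ≤ 2) (hc : IsCoprime f1 f2) (k : ℕ) (g : L[X])
    (hgm : g.Monic) (hgi : Irreducible g) (hgX : g ≠ X) (hk : Nat.gcd k (Fintype.card L - 1) = 1)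
    (hg1 : g ^ k ∣ f1 * f2) (hg2 : ¬ g ^ (k+1) ∣ f1 * f2) :
    ∃ α : L, f2.eval α ≠ 0 ∧ orderOf α = Fintype.card L - 1 ∧
     (LinearIndependent K (fun i : Fin n => α ^ Fintype.card K ^ (i : ℕ)) ∧
    Submodule.span K (Set.range fun i : Fin n => α ^ Fintype.card K ^ (i : ℕ)) = ⊤) ∧
    orderOf (f1.eval α / f2.eval α) = Fintype.card L - 1 := by
  rcases lt_or_ge n 750 with h7 | h7
  · obtain ⟨Ls, Lm, W, t, D, km, M, hW, hM, hD, hDk, ht, hp, hnum⟩ := cert_all n h h7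
    exact core n hn hK hL Ls Lm W t D km M hW hM hD hDk ht hp hnum f1 f2 hf1 hf2 hd1 hd2 hc k g hgm hgi hgX hk hg1 hg2
  · exact crude n h7 hK hL f1 f2 hf1 hf2 hd1 hd2 hc k g hgm hgi hgX hk hg1 hg2
end

theorem ratEval_div {L : Type} [Field L] (f1 f2 : L[X]) (α : L) (h : f2.eval α ≠ 0) :
    (algebraMap L[X] (RatFunc L) f1 / algebraMap L[X] (RatFunc L) f2).eval (RingHom.id L) α = f1.eval α / f2.eval α := by
  have hf2 : f2 ≠ 0 := by rintro rfl; simp at h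
  have e := (RatFunc.num_mul_eq_mul_denom_iff (p := f1) hf2).mpr (rfl : algebraMap L[X] (RatFunc L) f1 / algebraMap L[X] (RatFunc L) f2 = _)
  have hd := RatFunc.denom_div_dvd f1 f2
  generalize algebraMap L[X] (RatFunc L) f1 / algebraMap L[X] (RatFunc L) f2 = x at e hd ⊢
  have hx : x.denom.eval α ≠ 0 := by
    intro h0
    obtain ⟨c, rfl⟩ := hd
    exact h (by rw [eval_mul, h0, zero_mul])
  have e2 := congrArg (Polynomial.eval α) e
  rw [eval_mul, eval_mul] at e2
  rw [RatFunc.eval, eval₂_id, eval₂_id, div_eq_div_iff hx h, e2]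
end S12
end

theorem stmt12 (n : ℕ) (hn : 3 ≤ n)
    (h : n ∈ ({11, 13, 14, 15} : Finset ℕ) ∨ 17 ≤ n) :
    memB 3 2 3 n := by
  intro K L _ _ _ _ _ hK hL f hf
  obtain ⟨f₁, f₂, hf2, rfl, hd1, hd2, hc, k, g, _, hgm, hgi, hgX, hk, hg1, hg2⟩ := hf
  have hf1 : f₁ ≠ 0 := by
    rintro rfl
    exact hg2 (by rw [zero_mul]; exact dvd_zero _)
  obtain ⟨α, h0, h1, h2, h3⟩ := S12.final_exists n h (by omega) hK hL f₁ f₂ hf1 hf2 hd1 hd2 hc k g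
    hgm hgi hgX hk hg1 hg2
  refine ⟨α, h1, h2, ?_⟩
  unfold IsPrimitiveElem ratEval
  rw [S12.ratEval_div _ _ _ h0]
  exact h3
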